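/- Let u : ℝ^{1+m} → ℝ^{1+m} be smooth, divergence-free, h-periodic in every coordinate, and mean-zero over its period cell, and let f : [0,1] → ℝ be Lipschitz with f(0) = f(1) = 0 and f(T) > 0 for all T ∈ (0,1). Let c, θ > 0 and p > 3 be such that f(T) ≤ c T^p for all T ∈ [0,θ]. Then there exists ε > 0 such that every classical solution of T_t + u·∇T = ΔT + M f(T) whose initial datum T₀ satisfies 0 ≤ T₀ ≤ 1 and ‖T₀‖₁ ≤ ε quenches. -/

import Mathlib

open MeasureTheory
open scoped BigOperators

noncomputable section

/-- Partial derivative of `g : ℝ^N → ℝ` in the `i`-th coordinate direction. -/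
def pd {N : ℕ} (i : Fin N) (g : (Fin N → ℝ) → ℝ) (z : Fin N → ℝ) : ℝ :=
  fderiv ℝ g z (Pi.single i 1)

/-- Laplacian of `g : ℝ^N → ℝ`. -/
def lap {N : ℕ} (g : (Fin N → ℝ) → ℝ) (z : Fin N → ℝ) : ℝ :=
  ∑ i, pd i (pd i g) z

/-- A classical solution of `T_t + u·∇T = ΔT + M f(T)` on the cylinder `ℝ×[0,h]^m`,
viewed as a `[0,1]`-valued function on `ℝ^{1+m}` (coordinate `0` is `x`, the remaining `m`
coordinates are `y`), `h`-periodic in each of the last `m` spatial coordinates,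
continuous on `[0,∞)×ℝ^{1+m}`, `C¹` in `t` and `C²` in the spatial variables for `t > 0`,
satisfying the equation pointwise for `t > 0` and `T(0,·) = T₀`. -/
structure IsCylSol (m : ℕ) (h M : ℝ) (u : (Fin (m+1) → ℝ) → Fin (m+1) → ℝ)
    (f : ℝ → ℝ) (T0 : (Fin (m+1) → ℝ) → ℝ) (T : ℝ → (Fin (m+1) → ℝ) → ℝ) : Prop where
  cont : ContinuousOn (fun p : ℝ × (Fin (m+1) → ℝ) => T p.1 p.2) {p | 0 ≤ p.1}
  mem_Icc : ∀ t z, 0 ≤ t → T t z ∈ Set.Icc (0:ℝ) 1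
  periodic : ∀ t z, 0 ≤ t → ∀ j : Fin m, T t (z + Pi.single j.succ h) = T t z
  timeDiff : ∀ t z, 0 < t → DifferentiableAt ℝ (fun s => T s z) t
  spaceC2 : ∀ t, 0 < t → ContDiff ℝ 2 (T t)
  eqn : ∀ t z, 0 < t →
    deriv (fun s => T s z) t + ∑ i, u z i * pd i (T t) z
      = lap (T t) z + M * f (T t z)
  init : ∀ z, T 0 z = T0 z

/-- The fundamental cell `ℝ × [0,h)^m` of the cylinder, lifted to `ℝ^{1+m}`. -/
def cylCell (m : ℕ) (h : ℝ) : Set (Fin (m+1) → ℝ) :=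
  {z | ∀ j : Fin m, z j.succ ∈ Set.Ico (0:ℝ) h}

/-- `T` quenches: `lim_{t→∞} sup_{(x,y)} T(t,x,y) = 0` (for nonnegative `T`). -/
def CylQuenches (m : ℕ) (T : ℝ → (Fin (m+1) → ℝ) → ℝ) : Prop :=
  ∀ ε > (0:ℝ), ∃ t₀ : ℝ, ∀ t ≥ t₀, ∀ z, T t z ≤ ε

/-! ### The standard Gaussian density -/

/-- The unnormalised Gaussian `exp (-b |ξ|²)` on `ℝ^N`. -/
def expSq {N : ℕ} (b : ℝ) (ξ : Fin N → ℝ) : ℝ := Real.exp (-(b * ∑ i, ξ i ^ 2))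

/-- The standard Gaussian density on `ℝ^N`. -/
def gauss {N : ℕ} (ξ : Fin N → ℝ) : ℝ := expSq (1 / 2) ξ / ∫ η : Fin N → ℝ, expSq (1 / 2) η

lemma expSq_pos {N : ℕ} (b : ℝ) (ξ : Fin N → ℝ) : 0 < expSq b ξ := Real.exp_pos _

lemma continuous_expSq {N : ℕ} (b : ℝ) : Continuous (expSq b : (Fin N → ℝ) → ℝ) := by
  unfold expSq; fun_prop

lemma integrable_expSq {N : ℕ} {b : ℝ} (hb : 0 < b) :
    Integrable (expSq b : (Fin N → ℝ) → ℝ) := by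
  have h : Integrable (fun ξ : Fin N → ℝ => ∏ i, Real.exp (-b * ξ i ^ 2)) :=
    Integrable.fintype_prod (f := fun _ (x : ℝ) => Real.exp (-b * x ^ 2))
      fun _ => integrable_exp_neg_mul_sq hb
  refine h.congr (Filter.Eventually.of_forall fun ξ => ?_)
  simp only [expSq, ← Real.exp_sum, Finset.mul_sum, neg_mul, Finset.sum_neg_distrib]

lemma integral_expSq_pos {N : ℕ} {b : ℝ} (hb : 0 < b) :
    0 < ∫ η : Fin N → ℝ, expSq b η := by
  rw [integral_pos_iff_support_of_nonneg (fun ξ => (expSq_pos b ξ).le) (integrable_expSq hb)]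
  have : Function.support (expSq b : (Fin N → ℝ) → ℝ) = Set.univ := by
    ext ξ; simp [(expSq_pos b ξ).ne']
  rw [this]
  exact Measure.measure_univ_pos.2 (NeZero.ne _)

lemma gauss_pos {N : ℕ} (ξ : Fin N → ℝ) : 0 < gauss ξ :=
  div_pos (expSq_pos _ _) (integral_expSq_pos (by norm_num))

@[fun_prop]
lemma continuous_gauss {N : ℕ} : Continuous (gauss : (Fin N → ℝ) → ℝ) :=
  (continuous_expSq _).div_const _

@[fun_prop]
lemma measurable_gauss {N : ℕ} : Measurable (gauss : (Fin N → ℝ) → ℝ) :=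
  continuous_gauss.measurable

lemma integrable_gauss {N : ℕ} : Integrable (gauss : (Fin N → ℝ) → ℝ) :=
  (integrable_expSq (by norm_num)).div_const _

lemma integral_gauss {N : ℕ} : ∫ ξ : Fin N → ℝ, gauss ξ = 1 := by
  unfold gauss
  rw [integral_div, div_self (integral_expSq_pos (by norm_num)).ne']

lemma lintegral_gauss {N : ℕ} : ∫⁻ ξ : Fin N → ℝ, ENNReal.ofReal (gauss ξ) = 1 := by
  rw [← ofReal_integral_eq_lintegral_ofReal integrable_gauss
    (Filter.Eventually.of_forall fun ξ => (gauss_pos ξ).le), integral_gauss, ENNReal.ofReal_one]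

lemma gauss_neg {N : ℕ} (ξ : Fin N → ℝ) : gauss (-ξ) = gauss ξ := by
  simp [gauss, expSq]

lemma sq_norm_le_sum_sq {N : ℕ} (ξ : Fin N → ℝ) : ‖ξ‖ ^ 2 ≤ ∑ i, ξ i ^ 2 := by
  rw [← Real.sqrt_le_sqrt_iff (by positivity), Real.sqrt_sq (norm_nonneg _)]
  refine (pi_norm_le_iff_of_nonneg (Real.sqrt_nonneg _)).2 fun i => ?_
  rw [Real.norm_eq_abs]
  exact Real.abs_le_sqrt (Finset.single_le_sum (f := fun i => ξ i ^ 2)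
    (fun j _ => sq_nonneg _) (Finset.mem_univ i))

lemma integrable_norm_mul_gauss {N : ℕ} :
    Integrable (fun ξ : Fin N → ℝ => ‖ξ‖ * gauss ξ) := by
  refine Integrable.mono' ((integrable_expSq (N := N) (b := 1 / 4) (by norm_num)).div_const
    (∫ η : Fin N → ℝ, expSq (1 / 2) η))
    (continuous_norm.mul continuous_gauss).aestronglyMeasurable
    (Filter.Eventually.of_forall fun ξ => ?_)
  rw [Real.norm_of_nonneg (mul_nonneg (norm_nonneg _) (gauss_pos ξ).le), gauss, ← mul_div_assoc]
  refine div_le_div_of_nonneg_right ?_ (integral_expSq_pos (by norm_num)).le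
  have h1 : ‖ξ‖ ≤ Real.exp (1 / 4 * ∑ i, ξ i ^ 2) := by
    have := Real.add_one_le_exp (1 / 4 * ∑ i, ξ i ^ 2)
    nlinarith [sq_nonneg (‖ξ‖ / 2 - 1), sq_norm_le_sum_sq ξ]
  calc ‖ξ‖ * expSq (1 / 2) ξ
      ≤ Real.exp (1 / 4 * ∑ i, ξ i ^ 2) * expSq (1 / 2) ξ :=
        mul_le_mul_of_nonneg_right h1 (expSq_pos _ _).le
    _ = expSq (1 / 4) ξ := by
        rw [expSq, expSq, ← Real.exp_add]; congr 1; ring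

lemma hasFDerivAt_gauss {N : ℕ} (ξ : Fin N → ℝ) :
    HasFDerivAt gauss (∑ i, (-(ξ i * gauss ξ)) •
      (ContinuousLinearMap.proj i : (Fin N → ℝ) →L[ℝ] ℝ)) ξ := by
  have h1 : HasFDerivAt (fun ξ : Fin N → ℝ => -((1 / 2 : ℝ) * ∑ i, ξ i ^ 2))
      (∑ i, (-ξ i) • (ContinuousLinearMap.proj i : (Fin N → ℝ) →L[ℝ] ℝ)) ξ := by
    have := ((HasFDerivAt.fun_sum (u := Finset.univ) fun i (_ : i ∈ Finset.univ) =>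
      ((ContinuousLinearMap.proj i : (Fin N → ℝ) →L[ℝ] ℝ).hasFDerivAt (x := ξ)).pow 2).const_mul
        (1 / 2 : ℝ)).neg
    refine this.congr_fderiv ?_
    ext v
    simp [Finset.mul_sum]
    exact Finset.sum_congr rfl fun i _ => by ring
  have h2 := (h1.exp).mul_const (∫ η : Fin N → ℝ, expSq (1 / 2) η)⁻¹
  simp only [← div_eq_mul_inv] at h2
  refine h2.congr_fderiv ?_
  ext v
  simp [gauss, expSq, Finset.mul_sum]
  exact Finset.sum_congr rfl fun i _ => by ring

lemma fderiv_gauss_single {N : ℕ} (ξ : Fin N → ℝ) (i : Fin N) :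
    fderiv ℝ gauss ξ (Pi.single i 1) = -(ξ i * gauss ξ) := by
  rw [(hasFDerivAt_gauss ξ).fderiv]
  simp [Pi.single_apply, eq_comm]

/-- Gaussian integration by parts. -/
lemma integral_mul_coord_gauss {N : ℕ} {F : (Fin N → ℝ) → ℝ} {B : ℝ} (hF : ContDiff ℝ 1 F)
    (hB : ∀ ξ, |F ξ| ≤ B) (hB' : ∀ ξ, ‖fderiv ℝ F ξ‖ ≤ B) (i : Fin N) :
    ∫ ξ, F ξ * (ξ i * gauss ξ) = ∫ ξ, fderiv ℝ F ξ (Pi.single i 1) * gauss ξ := by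
  have hF' : Continuous (fderiv ℝ F) := hF.continuous_fderiv one_ne_zero
  have i1 : Integrable (fun ξ => fderiv ℝ F ξ (Pi.single i 1) * gauss ξ) := by
    refine Integrable.mono' (integrable_gauss.const_mul B)
      (by have := continuous_gauss (N := N); fun_prop) (Filter.Eventually.of_forall fun ξ => ?_)
    rw [norm_mul, Real.norm_of_nonneg (gauss_pos ξ).le]
    refine mul_le_mul_of_nonneg_right ?_ (gauss_pos ξ).le
    refine (ContinuousLinearMap.le_opNorm _ _).trans ?_
    simpa [Pi.norm_single] using hB' ξ
  have i2 : Integrable (fun ξ => F ξ * (ξ i * gauss ξ)) := by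
    refine Integrable.mono' (integrable_norm_mul_gauss.const_mul B)
      (by have := continuous_gauss (N := N); have := hF.continuous; fun_prop)
      (Filter.Eventually.of_forall fun ξ => ?_)
    rw [norm_mul, norm_mul, Real.norm_of_nonneg (gauss_pos ξ).le]
    have := hB ξ
    have h0 : 0 ≤ B := (abs_nonneg _).trans this
    exact mul_le_mul this (mul_le_mul_of_nonneg_right (norm_le_pi_norm ξ i) (gauss_pos ξ).le)
      (mul_nonneg (norm_nonneg _) (gauss_pos ξ).le) h0
  have i3 : Integrable (fun ξ => F ξ * gauss ξ) := by
    refine Integrable.mono' (integrable_gauss.const_mul B)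
      (by have := continuous_gauss (N := N); have := hF.continuous; fun_prop)
      (Filter.Eventually.of_forall fun ξ => ?_)
    rw [norm_mul, Real.norm_of_nonneg (gauss_pos ξ).le]
    exact mul_le_mul_of_nonneg_right (hB ξ) (gauss_pos ξ).le
  have key := integral_mul_fderiv_eq_neg_fderiv_mul_of_integrable (μ := volume) (v := Pi.single i 1)
    (f := F) (g := gauss) i1 (by simp only [fderiv_gauss_single, mul_neg]; exact i2.neg) i3
    (fun ξ _ => hF.differentiable one_ne_zero ξ) (fun ξ _ => (hasFDerivAt_gauss ξ).differentiableAt)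
  simp only [fderiv_gauss_single, mul_neg, integral_neg, neg_inj] at key
  exact key

lemma gauss_mul_gauss_sub {N : ℕ} (ξ η : Fin N → ℝ) :
    gauss ξ * gauss (η - ξ) =
      gauss ((Real.sqrt 2)⁻¹ • η) * gauss (Real.sqrt 2 • (ξ - (1 / 2 : ℝ) • η)) := by
  simp only [gauss, div_mul_div_comm]
  congr 1
  simp only [expSq, ← Real.exp_add]
  congr 1
  simp only [Finset.mul_sum, ← Finset.sum_neg_distrib, ← Finset.sum_add_distrib, Pi.smul_apply,
    Pi.sub_apply, smul_eq_mul, mul_pow, inv_pow, Real.sq_sqrt (zero_le_two : (0 : ℝ) ≤ 2)]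
  exact Finset.sum_congr rfl fun i _ => by ring

/-! ### The period lattice of the cylinder -/

/-- The lattice of periods `{0} × (hℤ)^m`. -/
def lat (m : ℕ) (h : ℝ) : AddSubgroup (Fin (m + 1) → ℝ) where
  carrier := {v | v 0 = 0 ∧ ∀ j : Fin m, ∃ k : ℤ, v j.succ = k * h}
  zero_mem' := ⟨rfl, fun _ => ⟨0, by simp⟩⟩
  add_mem' := by
    rintro a b ⟨ha, ha'⟩ ⟨hb, hb'⟩
    refine ⟨by simp [ha, hb], fun j => ?_⟩
    obtain ⟨k, hk⟩ := ha' j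
    obtain ⟨l, hl⟩ := hb' j
    exact ⟨k + l, by simp [hk, hl, add_mul]⟩
  neg_mem' := by
    rintro a ⟨ha, ha'⟩
    refine ⟨by simp [ha], fun j => ?_⟩
    obtain ⟨k, hk⟩ := ha' j
    exact ⟨-k, by simp [hk]⟩

/-- Invariance under the lattice `lat m h`. -/
def LatPer (m : ℕ) (h : ℝ) {α : Type*} (φ : (Fin (m + 1) → ℝ) → α) : Prop :=
  ∀ g ∈ lat m h, ∀ z, φ (g + z) = φ z

lemma latPer_of_single {m : ℕ} {h : ℝ} {α : Type*} {φ : (Fin (m + 1) → ℝ) → α}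
    (H : ∀ z, ∀ j : Fin m, φ (z + Pi.single j.succ h) = φ z) : LatPer m h φ := by
  let P : AddSubgroup (Fin (m + 1) → ℝ) :=
    { carrier := {g | ∀ z, φ (g + z) = φ z}
      zero_mem' := fun z => by simp
      add_mem' := fun {a b} ha hb z => by rw [add_assoc, ha, hb]
      neg_mem' := fun {a} ha z => by rw [← ha (-a + z), add_neg_cancel_left] }
  rintro g ⟨hg0, hg⟩
  choose k hk using hg
  have hsum : g = ∑ j : Fin m, k j • (Pi.single j.succ h : Fin (m + 1) → ℝ) := by
    ext i
    refine Fin.cases ?_ (fun j => ?_) i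
    · simp [hg0, Finset.sum_apply, (Fin.succ_ne_zero _).symm]
    · simp [hk, Finset.sum_apply, Pi.single_apply]
  have : g ∈ P := by
    rw [hsum]
    exact sum_mem fun j _ => zsmul_mem (show _ ∈ P from fun z => by rw [add_comm, H]) _
  exact this

instance lat_countable (m : ℕ) (h : ℝ) : Countable (lat m h) := by
  choose k hk using fun (g : lat m h) => g.2.2
  refine Function.Injective.countable (f := k) fun a b hab => ?_
  ext i
  refine Fin.cases ?_ (fun j => ?_) i
  · rw [a.2.1, b.2.1]
  · rw [hk, hk, hab]

lemma cell_existsUnique {m : ℕ} {h : ℝ} (hh : 0 < h) (z : Fin (m + 1) → ℝ) :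
    ∃! g : lat m h, g +ᵥ z ∈ cylCell m h := by
  choose k hk hk' using fun j : Fin m => existsUnique_add_zsmul_mem_Ico hh (z j.succ) 0
  simp only [zsmul_eq_mul, zero_add] at hk hk'
  refine ⟨⟨Fin.cons 0 fun j => k j * h, ⟨rfl, fun j => ⟨k j, by simp⟩⟩⟩, fun j => ?_, ?_⟩
  · have := hk j
    rw [add_comm] at this
    simpa [AddSubgroup.vadd_def] using this
  · rintro ⟨g, hg0, hg⟩ hgz
    ext i
    refine Fin.cases ?_ (fun j => ?_) i
    · simpa using hg0
    · obtain ⟨l, hl⟩ := hg j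
      have := hgz j
      simp only [AddSubgroup.vadd_def, vadd_eq_add, Pi.add_apply, hl] at this
      rw [add_comm] at this
      simp [hl, hk' j l this]

lemma measurableSet_cylCell (m : ℕ) (h : ℝ) : MeasurableSet (cylCell m h) := by
  have : cylCell m h = ⋂ j : Fin m, (fun z : Fin (m + 1) → ℝ => z j.succ) ⁻¹' Set.Ico 0 h := by
    ext z; simp [cylCell]
  rw [this]
  exact MeasurableSet.iInter fun j => measurableSet_Ico.preimage (measurable_pi_apply _)

lemma fundamental_preimage {m : ℕ} {h : ℝ} (hh : 0 < h)
    {e : (Fin (m + 1) → ℝ) → Fin (m + 1) → ℝ} (he : Measurable e)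
    (hper : ∀ g ∈ lat m h, ∀ z, e (g + z) = g + e z) :
    IsAddFundamentalDomain (lat m h) (e ⁻¹' cylCell m h) volume := by
  refine IsAddFundamentalDomain.mk' ((measurableSet_cylCell m h).preimage he).nullMeasurableSet
    fun z => ?_
  have := cell_existsUnique hh (e z)
  refine (existsUnique_congr fun g => ?_).1 this
  rw [Set.mem_preimage, AddSubgroup.vadd_def, AddSubgroup.vadd_def, vadd_eq_add, vadd_eq_add,
    hper g g.2]

lemma fundamental_cell {m : ℕ} {h : ℝ} (hh : 0 < h) :
    IsAddFundamentalDomain (lat m h) (cylCell m h) volume :=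
  fundamental_preimage (e := id) hh measurable_id fun _ _ _ => rfl

lemma setLIntegral_preimage_cell {m : ℕ} {h : ℝ} (hh : 0 < h)
    {e : (Fin (m + 1) → ℝ) → Fin (m + 1) → ℝ} (he : Measurable e)
    (hper : ∀ g ∈ lat m h, ∀ z, e (g + z) = g + e z) {φ : (Fin (m + 1) → ℝ) → ENNReal}
    (hφ : LatPer m h φ) : ∫⁻ z in e ⁻¹' cylCell m h, φ z = ∫⁻ z in cylCell m h, φ z :=
  (fundamental_preimage hh he hper).setLIntegral_eq (fundamental_cell hh) φ
    fun g z => hφ g g.2 z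

lemma setLIntegral_cell_add {m : ℕ} {h : ℝ} (hh : 0 < h) {φ : (Fin (m + 1) → ℝ) → ENNReal}
    (hφ : LatPer m h φ) (a : Fin (m + 1) → ℝ) :
    ∫⁻ z in cylCell m h, φ (z + a) = ∫⁻ z in cylCell m h, φ z := by
  rw [← setLIntegral_preimage_cell hh (e := fun z => z - a) (by fun_prop)
    (fun g _ z => add_sub_assoc g z a) hφ,
    ← lintegral_indicator (measurableSet_cylCell m h),
    ← lintegral_indicator ((measurableSet_cylCell m h).preimage (by fun_prop)),
    ← lintegral_add_right_eq_self (((fun z => z - a) ⁻¹' cylCell m h).indicator φ) a]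
  refine lintegral_congr fun z => ?_
  by_cases hz : z ∈ cylCell m h <;> simp [hz]

lemma ae_of_ae_cell {m : ℕ} {h : ℝ} (hh : 0 < h) {φ : (Fin (m + 1) → ℝ) → ENNReal}
    (hφ : LatPer m h φ) {B : ENNReal}
    (H : ∀ᵐ z ∂volume.restrict (cylCell m h), φ z ≤ B) : ∀ᵐ z, φ z ≤ B := by
  rw [ae_iff] at H ⊢
  rw [Measure.restrict_apply' (measurableSet_cylCell m h)] at H
  refine (fundamental_cell hh).measure_zero_of_invariant _ (fun g => ?_) H
  ext z
  rw [Set.mem_vadd_set_iff_neg_vadd_mem, Set.mem_ofPred_eq, Set.mem_ofPred_eq]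
  have := hφ (-g : lat m h) (-g).2 z
  rw [AddSubgroup.vadd_def, vadd_eq_add, this]

lemma LatPer.mul {m : ℕ} {h : ℝ} {φ ψ : (Fin (m + 1) → ℝ) → ENNReal} (hφ : LatPer m h φ)
    (hψ : LatPer m h ψ) : LatPer m h (fun z => φ z * ψ z) :=
  fun g hg z => by simp only [hφ g hg, hψ g hg]

/-! ### Gaussian averages -/

/-- The average of `φ` against the Gaussian of width `a`; `avg (√(2 * s))` is the heat semigroup. -/
def avg {N : ℕ} (a : ℝ) (φ : (Fin N → ℝ) → ENNReal) (z : Fin N → ℝ) : ENNReal :=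
  ∫⁻ ξ, φ (z - a • ξ) * ENNReal.ofReal (gauss ξ)

lemma measurable_avg {N : ℕ} {φ : (Fin N → ℝ) → ENNReal} (hφ : Measurable φ) (a : ℝ) :
    Measurable (avg a φ) := by
  refine Measurable.lintegral_prod_right'
    (f := fun p : (Fin N → ℝ) × (Fin N → ℝ) => φ (p.1 - a • p.2) * ENNReal.ofReal (gauss p.2)) ?_
  exact (hφ.comp (by fun_prop)).mul (by fun_prop)

lemma LatPer.avg {m : ℕ} {h : ℝ} {φ : (Fin (m + 1) → ℝ) → ENNReal} (hφ : LatPer m h φ) (a : ℝ) :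
    LatPer m h (avg a φ) := fun g hg z => by
  simp only [_root_.avg, add_sub_assoc, hφ g hg]

lemma avg_le_of_ae {N : ℕ} {φ : (Fin N → ℝ) → ENNReal} {B : ENNReal} (H : ∀ᵐ z, φ z ≤ B)
    {a : ℝ} (ha : a ≠ 0) (z : Fin N → ℝ) : avg a φ z ≤ B := by
  have hq : Measure.QuasiMeasurePreserving (fun ξ : Fin N → ℝ => z - a • ξ) := by
    refine (Measure.measurePreserving_sub_left volume z).quasiMeasurePreserving.comp
      (f := fun ξ : Fin N → ℝ => a • ξ) ⟨by fun_prop, ?_⟩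
    rw [Measure.map_addHaar_smul volume ha]
    exact Measure.smul_absolutelyContinuous
  calc avg a φ z ≤ ∫⁻ ξ : Fin N → ℝ, B * ENNReal.ofReal (gauss ξ) := by
        refine lintegral_mono_ae ?_
        filter_upwards [hq.ae H] with ξ hξ
        gcongr
    _ = B := by rw [lintegral_const_mul _ (by fun_prop), lintegral_gauss, mul_one]

lemma avg_const {N : ℕ} (a : ℝ) (B : ENNReal) (z : Fin N → ℝ) : avg a (fun _ => B) z = B := by
  simp only [avg]
  rw [lintegral_const_mul _ (by fun_prop), lintegral_gauss, mul_one]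

lemma avg_symm {m : ℕ} {h : ℝ} (hh : 0 < h) {φ ψ : (Fin (m + 1) → ℝ) → ENNReal}
    (hφ : LatPer m h φ) (hψ : LatPer m h ψ) (mφ : Measurable φ) (mψ : Measurable ψ) (a : ℝ) :
    ∫⁻ z in cylCell m h, avg a φ z * ψ z = ∫⁻ z in cylCell m h, φ z * avg a ψ z := by
  have e1 : ∀ z, avg a φ z * ψ z =
      ∫⁻ ξ, φ (z - a • ξ) * ψ z * ENNReal.ofReal (gauss ξ) := fun z => by
    rw [avg, ← lintegral_mul_const _ (by fun_prop)]
    exact lintegral_congr fun ξ => by ring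
  have e2 : ∀ z, φ z * avg a ψ z =
      ∫⁻ ξ, φ z * ψ (z - a • ξ) * ENNReal.ofReal (gauss ξ) := fun z => by
    rw [avg, ← lintegral_const_mul _ (by fun_prop)]
    exact lintegral_congr fun ξ => by ring
  simp only [e1, e2]
  refine (lintegral_lintegral_swap ?_).trans
    (Eq.trans ?_ (lintegral_lintegral_swap ?_).symm)
  · exact (by fun_prop : Measurable fun p : (Fin (m + 1) → ℝ) × (Fin (m + 1) → ℝ) =>
      φ (p.1 - a • p.2) * ψ p.1 * ENNReal.ofReal (gauss p.2)).aemeasurable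
  · rw [← lintegral_neg_eq_self (μ := (volume : Measure (Fin (m + 1) → ℝ)))]
    refine lintegral_congr fun ξ => ?_
    rw [lintegral_mul_const _ (by fun_prop), lintegral_mul_const _ (by fun_prop), gauss_neg]
    congr 1
    rw [← setLIntegral_cell_add hh (φ := fun z => φ z * ψ (z - a • ξ)) (fun g hg z => ?_) (a • ξ)]
    · simp [sub_neg_eq_add]
    · simp only [add_sub_assoc, hφ g hg, hψ g hg]
  · exact (by fun_prop : Measurable fun p : (Fin (m + 1) → ℝ) × (Fin (m + 1) → ℝ) =>
      φ p.1 * ψ (p.1 - a • p.2) * ENNReal.ofReal (gauss p.2)).aemeasurable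

lemma lintegral_avg {m : ℕ} {h : ℝ} (hh : 0 < h) {φ : (Fin (m + 1) → ℝ) → ENNReal}
    (hφ : LatPer m h φ) (mφ : Measurable φ) (a : ℝ) :
    ∫⁻ z in cylCell m h, avg a φ z = ∫⁻ z in cylCell m h, φ z := by
  have := avg_symm hh hφ (ψ := fun _ => 1) (fun _ _ _ => rfl) mφ measurable_const a
  simpa [avg_const] using this

lemma lintegral_comp_smul' {N : ℕ} {f : (Fin N → ℝ) → ENNReal} (hf : Measurable f) {a : ℝ}
    (ha : 0 < a) : ∫⁻ x, f (a • x) = ENNReal.ofReal ((a ^ N)⁻¹) * ∫⁻ x, f x := by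
  rw [← lintegral_map hf (by fun_prop : Measurable fun x : Fin N → ℝ => a • x)]
  change ∫⁻ x, f x ∂(Measure.map (a • ·) volume) = _
  rw [Measure.map_addHaar_smul volume ha.ne', lintegral_smul_measure]
  simp [abs_of_pos ha]

lemma avg_avg {N : ℕ} {φ : (Fin N → ℝ) → ENNReal} (mφ : Measurable φ) (a : ℝ)
    (z : Fin N → ℝ) : avg a (avg a φ) z = avg (Real.sqrt 2 * a) φ z := by
  have h2 : (0 : ℝ) < Real.sqrt 2 := by positivity
  have e1 : avg a (avg a φ) z = ∫⁻ ξ, ∫⁻ η, φ (z - a • η) *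
      ENNReal.ofReal (gauss ξ * gauss (η - ξ)) := by
    refine lintegral_congr fun ξ => ?_
    rw [avg, ← lintegral_mul_const _ (by fun_prop), ← lintegral_sub_right_eq_self _ ξ]
    refine lintegral_congr fun η => ?_
    rw [ENNReal.ofReal_mul (gauss_pos _).le, sub_sub, ← smul_add, add_sub_cancel]
    ring
  rw [e1, lintegral_lintegral_swap]
  · have e2 : ∀ η : Fin N → ℝ, ∫⁻ ξ, φ (z - a • η) * ENNReal.ofReal (gauss ξ * gauss (η - ξ)) =
        ENNReal.ofReal ((Real.sqrt 2 ^ N)⁻¹) *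
          (φ (z - a • η) * ENNReal.ofReal (gauss ((Real.sqrt 2)⁻¹ • η))) := fun η => by
      simp only [gauss_mul_gauss_sub, ENNReal.ofReal_mul (gauss_pos _).le]
      rw [lintegral_const_mul _ (by fun_prop), lintegral_const_mul _ (by fun_prop),
        lintegral_sub_right_eq_self
          (fun ξ : Fin N → ℝ => ENNReal.ofReal (gauss (Real.sqrt 2 • ξ))),
        lintegral_comp_smul' (f := fun ξ => ENNReal.ofReal (gauss ξ)) (by fun_prop) h2,
        lintegral_gauss]
      ring
    simp only [e2]
    rw [lintegral_const_mul _ (by fun_prop), ← lintegral_comp_smul'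
      (f := fun η => φ (z - a • η) * ENNReal.ofReal (gauss ((Real.sqrt 2)⁻¹ • η)))
      (by fun_prop) h2]
    refine lintegral_congr fun η => ?_
    rw [smul_smul, smul_smul, inv_mul_cancel₀ h2.ne', one_smul, mul_comm a]
  · exact (by fun_prop : Measurable fun p : (Fin N → ℝ) × (Fin N → ℝ) =>
      φ (z - a • p.2) * ENNReal.ofReal (gauss p.1 * gauss (p.2 - p.1))).aemeasurable

/-! ### Smoothing of Gaussian averages on the cylinder -/

lemma gauss_le_gauss_shift {N : ℕ} {a c : ℝ} (ha : 0 < a) (hac : a ≤ c) (w b : Fin N → ℝ)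
    (hb : ∀ i, |b i| ≤ c) :
    gauss (a⁻¹ • w) ≤ Real.exp (N / 2) * gauss ((Real.sqrt 2 * c)⁻¹ • (w + b)) := by
  have hc : 0 < c := ha.trans_le hac
  rw [gauss, gauss, ← mul_div_assoc]
  refine div_le_div_of_nonneg_right ?_ (integral_expSq_pos (by norm_num)).le
  rw [expSq, expSq, ← Real.exp_add, Real.exp_le_exp]
  have key : ∀ i, (1 / 2 : ℝ) * ((Real.sqrt 2 * c)⁻¹ * (w i + b i)) ^ 2 ≤
      1 / 2 + 1 / 2 * (a⁻¹ * w i) ^ 2 := fun i => by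
    have h1 : ((Real.sqrt 2 * c)⁻¹ * (w i + b i)) ^ 2 = (w i + b i) ^ 2 / (2 * c ^ 2) := by
      rw [mul_pow, inv_pow, mul_pow, Real.sq_sqrt zero_le_two]; field_simp
    have h2 : (c⁻¹ * w i) ^ 2 ≤ (a⁻¹ * w i) ^ 2 := by
      rw [mul_pow, mul_pow]; gcongr
    have h3 : (w i + b i) ^ 2 / (2 * c ^ 2) ≤ (c⁻¹ * w i) ^ 2 + 1 := by
      rw [div_le_iff₀ (by positivity), mul_pow, inv_pow]
      have h4 : b i ^ 2 ≤ c ^ 2 := sq_le_sq.2 (by rw [abs_of_pos hc]; exact hb i)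
      have h5 : ((c ^ 2)⁻¹ * w i ^ 2 + 1) * (2 * c ^ 2) = 2 * w i ^ 2 + 2 * c ^ 2 := by
        field_simp
      rw [h5]
      nlinarith [sq_nonneg (w i - b i)]
    rw [h1]; linarith
  have hs := Finset.sum_le_sum fun i (_ : i ∈ Finset.univ) => key i
  simp only [Finset.mul_sum, Pi.smul_apply, Pi.add_apply, smul_eq_mul] at *
  rw [Finset.sum_add_distrib] at hs
  simp only [Finset.sum_const, Finset.card_univ, Fintype.card_fin, nsmul_eq_mul] at hs
  linarith

/-- The box `[0,c) × [0,h)^m`. -/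
def box (m : ℕ) (c h : ℝ) : Set (Fin (m + 1) → ℝ) :=
  Set.univ.pi fun i => Set.Ico 0 ((Fin.cons c fun _ => h : Fin (m + 1) → ℝ) i)

lemma volume_box (m : ℕ) {c h : ℝ} (hc : 0 ≤ c) (hh : 0 ≤ h) :
    volume (box m c h) = ENNReal.ofReal (c * h ^ m) := by
  rw [box, Real.volume_pi_Ico, Fin.prod_univ_succ, ENNReal.ofReal_mul hc, ENNReal.ofReal_pow hh]
  simp

lemma tsum_gauss_lat_le {m : ℕ} {h : ℝ} (hh : 0 < h) {a : ℝ} (ha : 0 < a)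
    (w : Fin (m + 1) → ℝ) :
    ∑' g : lat m h, ENNReal.ofReal (gauss (a⁻¹ • (w - (g : Fin (m + 1) → ℝ)))) ≤
      ENNReal.ofReal (Real.exp ((m + 1 : ℕ) / 2) * Real.sqrt 2 ^ (m + 1) * (h + a) ^ m
        * (h ^ m)⁻¹) := by
  set c := h + a with hc
  have hc0 : 0 < c := by positivity
  set V := ENNReal.ofReal (c * h ^ m) with hV
  have hV0 : V ≠ 0 := by rw [hV]; simp; positivity
  have hVt : V ≠ ⊤ := ENNReal.ofReal_ne_top
  have hbox : box m c h ⊆ cylCell m h := fun z hz j => by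
    simpa using hz j.succ (Set.mem_univ _)
  have hboxm : MeasurableSet (box m c h) := MeasurableSet.univ_pi fun _ => measurableSet_Ico
  set G : (Fin (m + 1) → ℝ) → ENNReal := fun z => ENNReal.ofReal (gauss ((Real.sqrt 2 * c)⁻¹ • z))
    with hG
  have mG : Measurable G := by fun_prop
  have e1 : ∀ g : lat m h, V * ENNReal.ofReal (gauss (a⁻¹ • (w - (g : Fin (m + 1) → ℝ)))) ≤
      ENNReal.ofReal (Real.exp ((m + 1 : ℕ) / 2)) * ∫⁻ b in cylCell m h, G (w + (-g +ᵥ b)) :=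
      fun g => by
    calc V * ENNReal.ofReal (gauss (a⁻¹ • (w - (g : Fin (m + 1) → ℝ))))
        = ∫⁻ b in box m c h, ENNReal.ofReal (gauss (a⁻¹ • (w - (g : Fin (m + 1) → ℝ)))) := by
          rw [setLIntegral_const, volume_box m hc0.le hh.le, mul_comm]
      _ ≤ ∫⁻ b in box m c h, ENNReal.ofReal (Real.exp ((m + 1 : ℕ) / 2)) *
            G (w + (-g +ᵥ b)) := by
          refine setLIntegral_mono (by fun_prop) fun b hb => ?_
          rw [hG, ← ENNReal.ofReal_mul (Real.exp_pos _).le]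
          refine ENNReal.ofReal_le_ofReal ?_
          have := gauss_le_gauss_shift ha (by linarith : a ≤ c) (w - (g : Fin (m + 1) → ℝ)) b fun i => ?_
          · convert this using 4
            rw [AddSubgroup.vadd_def, vadd_eq_add, AddSubgroup.coe_neg]
            abel
          · have hbi := hb i (Set.mem_univ _)
            rw [abs_of_nonneg hbi.1]
            refine hbi.2.le.trans ?_
            refine Fin.cases ?_ (fun j => ?_) i
            · simp
            · simp; linarith
      _ ≤ ∫⁻ b in cylCell m h, ENNReal.ofReal (Real.exp ((m + 1 : ℕ) / 2)) *
            G (w + (-g +ᵥ b)) := lintegral_mono_set hbox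
      _ = _ := lintegral_const_mul _ (by fun_prop)
  have e2 : V * ∑' g : lat m h, ENNReal.ofReal (gauss (a⁻¹ • (w - (g : Fin (m + 1) → ℝ)))) ≤
      ENNReal.ofReal (Real.exp ((m + 1 : ℕ) / 2) * (Real.sqrt 2 * c) ^ (m + 1)) := by
    rw [← ENNReal.tsum_mul_left]
    refine (ENNReal.tsum_le_tsum e1).trans ?_
    rw [ENNReal.tsum_mul_left, ENNReal.ofReal_mul (Real.exp_pos _).le]
    gcongr
    rw [← (fundamental_cell hh).lintegral_eq_tsum' (fun b => G (w + b))]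
    rw [lintegral_add_left_eq_self, hG, lintegral_comp_smul'
      (f := fun ξ => ENNReal.ofReal (gauss ξ)) (by fun_prop) (by positivity), lintegral_gauss, mul_one, ← inv_pow, inv_inv]
  rw [← ENNReal.mul_le_mul_iff_right hV0 hVt]
  refine e2.trans ?_
  rw [hV, ← ENNReal.ofReal_mul (by positivity)]
  refine ENNReal.ofReal_le_ofReal (le_of_eq ?_)
  field_simp
  rw [mul_pow, pow_succ, pow_succ]; ring_nf

/-- An upper bound for the heat kernel of the cylinder, as a function of its width `a`. -/
def decay (m : ℕ) (h : ℝ) (a : ℝ) : ℝ :=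
  Real.exp ((m + 1 : ℕ) / 2) * Real.sqrt 2 ^ (m + 1) * (h ^ m)⁻¹ * (a⁻¹ * (1 + h * a⁻¹) ^ m)

lemma decay_pos {m : ℕ} {h : ℝ} (hh : 0 < h) {a : ℝ} (ha : 0 < a) : 0 < decay m h a := by
  unfold decay; positivity

lemma decay_anti {m : ℕ} {h : ℝ} (hh : 0 < h) {a b : ℝ} (ha : 0 < a) (hab : a ≤ b) :
    decay m h b ≤ decay m h a := by
  have := ha.trans_le hab
  unfold decay
  gcongr

lemma decay_le_of_mul {m : ℕ} {h : ℝ} (hh : 0 < h) {a l : ℝ} (ha : 0 < a) (hl : 1 ≤ l) :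
    decay m h a ≤ l ^ (m + 1) * decay m h (l * a) := by
  have hl0 : 0 < l := by linarith
  have e : a⁻¹ = l * (l * a)⁻¹ := by field_simp
  have hp : 0 < (l * a)⁻¹ := by positivity
  unfold decay
  have h1 : 1 + h * a⁻¹ ≤ l * (1 + h * (l * a)⁻¹) := by
    rw [e]; nlinarith [mul_pos hh hp]
  have h2 : a⁻¹ * (1 + h * a⁻¹) ^ m ≤
      l ^ (m + 1) * ((l * a)⁻¹ * (1 + h * (l * a)⁻¹) ^ m) := by
    calc a⁻¹ * (1 + h * a⁻¹) ^ m ≤ a⁻¹ * (l * (1 + h * (l * a)⁻¹)) ^ m := by gcongr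
      _ = _ := by rw [mul_pow, e]; ring
  calc _ ≤ Real.exp ((m + 1 : ℕ) / 2) * Real.sqrt 2 ^ (m + 1) * (h ^ m)⁻¹ *
        (l ^ (m + 1) * ((l * a)⁻¹ * (1 + h * (l * a)⁻¹) ^ m)) := by gcongr
    _ = _ := by ring

lemma avg_le_decay {m : ℕ} {h : ℝ} (hh : 0 < h) {φ : (Fin (m + 1) → ℝ) → ENNReal}
    (hφ : LatPer m h φ) (mφ : Measurable φ) {a : ℝ} (ha : 0 < a) (z : Fin (m + 1) → ℝ) :
    avg a φ z ≤ ENNReal.ofReal (decay m h a) * ∫⁻ z in cylCell m h, φ z := by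
  have e1 : avg a φ z = ENNReal.ofReal ((a ^ (m + 1))⁻¹) *
      ∫⁻ w, φ w * ENNReal.ofReal (gauss (a⁻¹ • (z - w))) := by
    rw [← lintegral_sub_left_eq_self _ z, ← lintegral_comp_smul' (by fun_prop) ha, avg]
    simp only [sub_sub_cancel, smul_smul, inv_mul_cancel₀ ha.ne', one_smul]
  have e2 : ∫⁻ w, φ w * ENNReal.ofReal (gauss (a⁻¹ • (z - w))) ≤
      ENNReal.ofReal (Real.exp ((m + 1 : ℕ) / 2) * Real.sqrt 2 ^ (m + 1) * (h + a) ^ m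
        * (h ^ m)⁻¹) * ∫⁻ z in cylCell m h, φ z := by
    rw [(fundamental_cell hh).lintegral_eq_tsum'', ← lintegral_tsum fun g => by fun_prop,
      ← lintegral_const_mul _ mφ]
    refine lintegral_mono fun w => ?_
    simp only [AddSubgroup.vadd_def, vadd_eq_add, fun g : lat m h => hφ g g.2 w]
    rw [ENNReal.tsum_mul_left, mul_comm]
    gcongr
    refine le_trans (le_of_eq ?_) (tsum_gauss_lat_le hh ha (z - w))
    exact tsum_congr fun g => by rw [sub_sub, add_comm w]
  rw [e1]
  refine (mul_le_mul_right e2 _).trans ?_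
  rw [← mul_assoc, ← ENNReal.ofReal_mul (by positivity)]
  gcongr
  refine le_of_eq ?_
  have : 1 + h * a⁻¹ = (h + a) * a⁻¹ := by field_simp; ring
  rw [decay, this, mul_pow]
  rw [inv_pow]
  field_simp
  ring

/-! ### A Nash-type inequality for iterated averages -/

/-- The squared `L²` norm over one period cell. -/
def nsq (m : ℕ) (h : ℝ) (φ : (Fin (m + 1) → ℝ) → ENNReal) : ENNReal :=
  ∫⁻ z in cylCell m h, φ z * φ z

lemma sq_lintegral_mul_le {m : ℕ} {h : ℝ} {φ ψ : (Fin (m + 1) → ℝ) → ENNReal}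
    (mφ : Measurable φ) (mψ : Measurable ψ) :
    (∫⁻ z in cylCell m h, φ z * ψ z) ^ 2 ≤ nsq m h φ * nsq m h ψ := by
  have H := ENNReal.lintegral_mul_le_Lp_mul_Lq (volume.restrict (cylCell m h))
    Real.HolderConjugate.two_two mφ.aemeasurable mψ.aemeasurable
  have e : ∀ x : ENNReal, x ^ (2 : ℝ) = x * x := fun x => by
    rw [show (2 : ℝ) = (2 : ℕ) by norm_num, ENNReal.rpow_natCast, sq]
  have e' : ∀ x : ENNReal, (x ^ (1 / 2 : ℝ)) ^ 2 = x := fun x => by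
    rw [← ENNReal.rpow_natCast, ← ENNReal.rpow_mul]; norm_num
  simp only [e, Pi.mul_apply] at H
  calc _ ≤ _ := pow_le_pow_left' H 2
    _ = _ := by rw [mul_pow, e', e', nsq, nsq]

lemma nsq_avg {m : ℕ} {h : ℝ} (hh : 0 < h) {φ : (Fin (m + 1) → ℝ) → ENNReal}
    (hφ : LatPer m h φ) (mφ : Measurable φ) (a : ℝ) :
    nsq m h (avg a φ) = ∫⁻ z in cylCell m h, φ z * avg (Real.sqrt 2 * a) φ z := by
  rw [nsq, avg_symm hh hφ (hφ.avg a) mφ (measurable_avg mφ a)]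
  simp only [avg_avg mφ]

lemma sq_nsq_avg_le {m : ℕ} {h : ℝ} (hh : 0 < h) {φ : (Fin (m + 1) → ℝ) → ENNReal}
    (hφ : LatPer m h φ) (mφ : Measurable φ) (a : ℝ) :
    nsq m h (avg a φ) ^ 2 ≤ nsq m h φ * nsq m h (avg (Real.sqrt 2 * a) φ) := by
  rw [nsq_avg hh hφ mφ]
  exact sq_lintegral_mul_le mφ (measurable_avg mφ _)

lemma avg_sq_le {N : ℕ} {φ : (Fin N → ℝ) → ENNReal} (mφ : Measurable φ) (a : ℝ)
    (z : Fin N → ℝ) : avg a φ z * avg a φ z ≤ avg a (fun z => φ z * φ z) z := by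
  set μ : Measure (Fin N → ℝ) := volume.withDensity fun ξ => ENNReal.ofReal (gauss ξ) with hμ
  have e0 : ∀ F : (Fin N → ℝ) → ENNReal, Measurable F →
      ∫⁻ ξ, F ξ ∂μ = ∫⁻ ξ, F ξ * ENNReal.ofReal (gauss ξ) := fun F hF => by
    rw [hμ, lintegral_withDensity_eq_lintegral_mul _ (by fun_prop) hF]
    exact lintegral_congr fun ξ => mul_comm _ _
  have H := ENNReal.lintegral_mul_le_Lp_mul_Lq μ Real.HolderConjugate.two_two
    (f := fun ξ => φ (z - a • ξ)) (g := fun _ => 1)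
    (by fun_prop) (by fun_prop)
  have e : ∀ x : ENNReal, x ^ (2 : ℝ) = x * x := fun x => by
    rw [show (2 : ℝ) = (2 : ℕ) by norm_num, ENNReal.rpow_natCast, sq]
  have e' : ∀ x : ENNReal, (x ^ (1 / 2 : ℝ)) * (x ^ (1 / 2 : ℝ)) = x := fun x => by
    rw [← ENNReal.rpow_add_of_nonneg _ _ (by norm_num) (by norm_num)]; norm_num
  simp only [e, Pi.mul_apply, mul_one] at H
  rw [e0 _ (by fun_prop), e0 _ (by fun_prop), e0 _ (by fun_prop)] at H
  simp only [one_mul, lintegral_gauss, ENNReal.one_rpow, mul_one] at H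
  calc _ ≤ _ := mul_le_mul' H H
    _ = _ := by rw [e']; rfl

lemma nsq_avg_le {m : ℕ} {h : ℝ} (hh : 0 < h) {φ : (Fin (m + 1) → ℝ) → ENNReal}
    (hφ : LatPer m h φ) (mφ : Measurable φ) (a : ℝ) : nsq m h (avg a φ) ≤ nsq m h φ := by
  refine (lintegral_mono fun z => avg_sq_le mφ a z).trans (le_of_eq ?_)
  exact lintegral_avg hh (hφ.mul hφ) (mφ.mul mφ) a

lemma nsq_avg_le_decay {m : ℕ} {h : ℝ} (hh : 0 < h) {φ : (Fin (m + 1) → ℝ) → ENNReal}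
    (hφ : LatPer m h φ) (mφ : Measurable φ) {a : ℝ} (ha : 0 < a)
    (h1 : ∫⁻ z in cylCell m h, φ z ≤ 1) :
    nsq m h (avg a φ) ≤ ENNReal.ofReal (decay m h (Real.sqrt 2 * a)) := by
  rw [nsq_avg hh hφ mφ]
  have : ∀ z, φ z * avg (Real.sqrt 2 * a) φ z ≤
      φ z * ENNReal.ofReal (decay m h (Real.sqrt 2 * a)) := fun z => by
    gcongr
    refine (avg_le_decay hh hφ mφ (by positivity) z).trans ?_
    exact mul_le_of_le_one_right' h1
  refine (lintegral_mono this).trans ?_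
  rw [lintegral_mul_const _ mφ]
  exact mul_le_of_le_one_left' h1

lemma nsq_avg_pow_le {m : ℕ} {h : ℝ} (hh : 0 < h) {φ : (Fin (m + 1) → ℝ) → ENNReal}
    (hφ : LatPer m h φ) (mφ : Measurable φ) (a : ℝ) (i : ℕ) :
    nsq m h (avg a φ) ^ 2 ^ i ≤
      nsq m h φ ^ (2 ^ i - 1) * nsq m h (avg (Real.sqrt 2 ^ i * a) φ) := by
  induction i with
  | zero => simp
  | succ i ih =>
    have h2 : 1 ≤ 2 ^ i := Nat.one_le_two_pow
    calc nsq m h (avg a φ) ^ 2 ^ (i + 1) = (nsq m h (avg a φ) ^ 2 ^ i) ^ 2 := by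
          rw [← pow_mul, pow_succ]
      _ ≤ (nsq m h φ ^ (2 ^ i - 1) * nsq m h (avg (Real.sqrt 2 ^ i * a) φ)) ^ 2 := by gcongr
      _ = nsq m h φ ^ ((2 ^ i - 1) * 2) * nsq m h (avg (Real.sqrt 2 ^ i * a) φ) ^ 2 := by
          rw [mul_pow, pow_mul]
      _ ≤ nsq m h φ ^ ((2 ^ i - 1) * 2) *
          (nsq m h φ * nsq m h (avg (Real.sqrt 2 * (Real.sqrt 2 ^ i * a)) φ)) := by
          gcongr; exact sq_nsq_avg_le hh hφ mφ _
      _ = _ := by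
          rw [← mul_assoc, ← pow_succ, ← mul_assoc, ← pow_succ']
          congr 2
          rw [pow_succ]; omega

lemma two_mul_pred_pow_le (k : ℕ) (hk : 1 ≤ k) : 2 * (k - 1) ^ k ≤ k ^ k := by
  obtain ⟨l, rfl⟩ : ∃ l, k = l + 1 := ⟨k - 1, by omega⟩
  simp only [Nat.add_sub_cancel]
  have h1 : l ^ (l + 1) + (l + 1) * l ^ l ≤ (l + 1) ^ (l + 1) := by
    rw [add_pow]
    have hs : ({l, l + 1} : Finset ℕ) ⊆ Finset.range (l + 1 + 1) := by
      intro x; simp only [Finset.mem_insert, Finset.mem_singleton, Finset.mem_range]; omega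
    refine le_trans (le_of_eq ?_) (Finset.sum_le_sum_of_subset hs)
    rw [Finset.sum_pair (by omega)]
    simp
    ring
  have h2 : l ^ (l + 1) ≤ (l + 1) * l ^ l := by
    rw [pow_succ']; gcongr; omega
  omega

lemma pow_iterate_le {x : ℕ → ENNReal} {C D : ENNReal} {k n : ℕ} (hk : 1 ≤ k)
    (h0 : x n ≤ C ^ 2 * D) (hx : ∀ j, x (j + 1) ^ k ≤ x j ^ (k - 1) * D) (l : ℕ) :
    x (n + l) ^ k ^ l ≤ C ^ (2 * (k - 1) ^ l) * D ^ k ^ l := by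
  induction l with
  | zero => simpa using h0
  | succ l ih =>
    calc x (n + (l + 1)) ^ k ^ (l + 1) = (x (n + l + 1) ^ k) ^ k ^ l := by
          rw [← pow_mul, pow_succ', add_assoc]
      _ ≤ (x (n + l) ^ (k - 1) * D) ^ k ^ l := by gcongr; exact hx _
      _ = (x (n + l) ^ k ^ l) ^ (k - 1) * D ^ k ^ l := by
          rw [mul_pow, ← pow_mul, ← pow_mul, mul_comm (k - 1)]
      _ ≤ (C ^ (2 * (k - 1) ^ l) * D ^ k ^ l) ^ (k - 1) * D ^ k ^ l := by gcongr
      _ = _ := by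
          rw [mul_pow, ← pow_mul, ← pow_mul, mul_assoc, ← pow_add]
          congr 2
          · rw [pow_succ]; ring
          · rw [pow_succ]
            obtain ⟨l, rfl⟩ : ∃ l, k = l + 1 := ⟨k - 1, by omega⟩
            simp only [Nat.add_sub_cancel]; ring

lemma nash_bound {m : ℕ} {h : ℝ} (hh : 0 < h) {a : ℝ} (ha : 0 < a)
    {φ : ℕ → (Fin (m + 1) → ℝ) → ENNReal} (hφ : ∀ n, LatPer m h (φ n))
    (mφ : ∀ n, Measurable (φ n)) (h1 : ∀ n, ∫⁻ z in cylCell m h, φ n z ≤ 1)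
    (h2 : ∀ n, nsq m h (φ (n + 1)) ≤ nsq m h (avg a (φ n))) (i : ℕ) :
    nsq m h (φ (2 ^ i)) ≤ 2 ^ (m + 1) * ENNReal.ofReal (decay m h (Real.sqrt 2 ^ i * a)) := by
  have hs : (0 : ℝ) < Real.sqrt 2 := by positivity
  have hs1 : 1 ≤ Real.sqrt 2 := Real.one_le_sqrt.2 one_le_two
  induction i with
  | zero =>
    refine (h2 0).trans ((nsq_avg_le_decay hh (hφ 0) (mφ 0) ha (h1 0)).trans ?_)
    refine le_trans ?_ (le_mul_of_one_le_left' (one_le_pow₀ one_le_two))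
    exact ENNReal.ofReal_le_ofReal (decay_anti hh (by simpa using ha) (by simp; nlinarith))
  | succ i ih =>
    set D := ENNReal.ofReal (decay m h (Real.sqrt 2 ^ (i + 1) * a)) with hD
    have hk : 1 ≤ 2 ^ i := Nat.one_le_two_pow
    have h0 : nsq m h (φ (2 ^ i)) ≤ (2 ^ (m + 1)) ^ 2 * D := by
      refine ih.trans ?_
      rw [sq, mul_assoc]
      gcongr
      calc ENNReal.ofReal (decay m h (Real.sqrt 2 ^ i * a))
          ≤ ENNReal.ofReal (2 ^ (m + 1) * decay m h (Real.sqrt 2 ^ (i + 1) * a)) := by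
            refine ENNReal.ofReal_le_ofReal ((decay_le_of_mul hh (by positivity) hs1).trans ?_)
            rw [← mul_assoc, ← pow_succ']
            have := (decay_pos (m := m) hh (by positivity : 0 < Real.sqrt 2 ^ (i + 1) * a)).le
            gcongr
            rw [Real.sqrt_le_left (by norm_num)]; norm_num
        _ = _ := by
            rw [ENNReal.ofReal_mul (by positivity), ENNReal.ofReal_pow (by norm_num)]; simp [hD]
    have hx : ∀ j, nsq m h (φ (j + 1)) ^ 2 ^ i ≤ nsq m h (φ j) ^ (2 ^ i - 1) * D := fun j => by
      refine (pow_le_pow_left' (h2 j) _).trans ((nsq_avg_pow_le hh (hφ j) (mφ j) a i).trans ?_)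
      gcongr
      refine (nsq_avg_le_decay hh (hφ j) (mφ j) (by positivity) (h1 j)).trans (le_of_eq ?_)
      rw [hD, pow_succ']; ring_nf
    have := pow_iterate_le hk h0 hx (2 ^ i)
    rw [← two_mul, ← pow_succ'] at this
    refine (ENNReal.pow_le_pow_left_iff (n := (2 ^ i) ^ 2 ^ i) (by positivity)).1 ?_
    refine this.trans ?_
    rw [mul_pow]
    gcongr
    · exact one_le_pow₀ one_le_two
    · exact two_mul_pred_pow_le _ hk

lemma avg_const_mul {N : ℕ} {φ : (Fin N → ℝ) → ENNReal} (mφ : Measurable φ) (a : ℝ) (c : ENNReal)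
    (z : Fin N → ℝ) : avg a (fun z => c * φ z) z = c * avg a φ z := by
  simp only [avg, mul_assoc]
  exact lintegral_const_mul _ (by fun_prop)

lemma nsq_const_mul {m : ℕ} {h : ℝ} {φ : (Fin (m + 1) → ℝ) → ENNReal} (mφ : Measurable φ)
    (c : ENNReal) : nsq m h (fun z => c * φ z) = c ^ 2 * nsq m h φ := by
  rw [nsq, nsq, ← lintegral_const_mul _ (by fun_prop)]
  exact lintegral_congr fun z => by ring

lemma nash_bound' {m : ℕ} {h : ℝ} (hh : 0 < h) {a : ℝ} (ha : 0 < a)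
    {φ : ℕ → (Fin (m + 1) → ℝ) → ENNReal} (hφ : ∀ n, LatPer m h (φ n))
    (mφ : ∀ n, Measurable (φ n)) {κ A : ENNReal} (hκ : κ ≠ 0) (hκ' : κ ≠ ⊤) (hA : A ≠ 0)
    (hA' : A ≠ ⊤) (h1 : ∀ n, ∫⁻ z in cylCell m h, φ n z ≤ κ ^ n * A)
    (h2 : ∀ n, nsq m h (φ (n + 1)) ≤ κ ^ 2 * nsq m h (avg a (φ n))) (i : ℕ) :
    nsq m h (φ (2 ^ i)) ≤ (κ ^ 2 ^ i * A) ^ 2 *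
      (2 ^ (m + 1) * ENNReal.ofReal (decay m h (Real.sqrt 2 ^ i * a))) := by
  have hn0 : ∀ n, κ ^ n * A ≠ 0 := fun n => mul_ne_zero (pow_ne_zero _ hκ) hA
  have hnt : ∀ n, κ ^ n * A ≠ ⊤ := fun n => ENNReal.mul_ne_top (ENNReal.pow_ne_top hκ') hA'
  have key := nash_bound hh ha (φ := fun n z => (κ ^ n * A)⁻¹ * φ n z)
    (fun n g hg z => by simp only [hφ n g hg z]) (fun n => by fun_prop)
    (fun n => by
      rw [lintegral_const_mul _ (mφ n), mul_comm, ← div_eq_mul_inv]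
      exact ENNReal.div_le_of_le_mul (by simpa using h1 n))
    (fun n => by
      have e : avg a (fun z => (κ ^ n * A)⁻¹ * φ n z) = fun z => (κ ^ n * A)⁻¹ * avg a (φ n) z :=
        funext fun z => avg_const_mul (mφ n) _ _ _
      rw [e, nsq_const_mul (mφ _), nsq_const_mul (measurable_avg (mφ n) a)]
      refine (mul_le_mul_right (h2 n) _).trans (le_of_eq ?_)
      rw [← mul_assoc, ← mul_pow]
      congr 2
      rw [pow_succ, mul_right_comm, ENNReal.mul_inv (Or.inl (hn0 n)) (Or.inl (hnt n)), mul_assoc,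
        ENNReal.inv_mul_cancel hκ hκ', mul_one]) i
  rw [nsq_const_mul (mφ _)] at key
  calc nsq m h (φ (2 ^ i)) = (κ ^ 2 ^ i * A) ^ 2 *
        ((κ ^ 2 ^ i * A)⁻¹ ^ 2 * nsq m h (φ (2 ^ i))) := by
        rw [← mul_assoc, ← mul_pow, ENNReal.mul_inv_cancel (hn0 _) (hnt _), one_pow, one_mul]
    _ ≤ _ := by gcongr

/-! ### Uniform decay for the splitting scheme -/

/-- A lattice-equivariant change of variables `σ` with inverse `e`, whose transfer operator is
`ψ ↦ J * (ψ ∘ e)`, with `J ≤ κ`. -/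
structure Transport (m : ℕ) (h : ℝ) (σ e : (Fin (m + 1) → ℝ) → Fin (m + 1) → ℝ)
    (J : (Fin (m + 1) → ℝ) → ENNReal) (κ : ENNReal) : Prop where
  meas : Measurable σ
  meas_inv : Measurable e
  meas_jac : Measurable J
  per : ∀ g ∈ lat m h, ∀ z, σ (g + z) = g + σ z
  per_inv : ∀ g ∈ lat m h, ∀ z, e (g + z) = g + e z
  per_jac : LatPer m h J
  jac_le : ∀ z, J z ≤ κ
  dual : ∀ φ ψ : (Fin (m + 1) → ℝ) → ENNReal, LatPer m h φ → LatPer m h ψ → Measurable φ →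
    Measurable ψ → ∫⁻ z in cylCell m h, φ (σ z) * ψ z =
      ∫⁻ z in cylCell m h, φ z * (J z * ψ (e z))

/-- One step of the splitting scheme: average, then transport. -/
def stepOp {N : ℕ} (a : ℝ) (σ : (Fin N → ℝ) → Fin N → ℝ) (φ : (Fin N → ℝ) → ENNReal) :
    (Fin N → ℝ) → ENNReal := fun z => avg a φ (σ z)

namespace Transport

variable {m : ℕ} {h : ℝ} {σ e : (Fin (m + 1) → ℝ) → Fin (m + 1) → ℝ}
  {J : (Fin (m + 1) → ℝ) → ENNReal} {κ : ENNReal}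

lemma latPer_comp (H : Transport m h σ e J κ) {φ : (Fin (m + 1) → ℝ) → ENNReal}
    (hφ : LatPer m h φ) : LatPer m h (fun z => φ (σ z)) := fun g hg z => by
  simp only [H.per g hg, hφ g hg]

lemma latPer_adj (H : Transport m h σ e J κ) {ψ : (Fin (m + 1) → ℝ) → ENNReal}
    (hψ : LatPer m h ψ) : LatPer m h (fun z => J z * ψ (e z)) := fun g hg z => by
  simp only [H.per_inv g hg, hψ g hg, H.per_jac g hg]

lemma lintegral_comp_le (H : Transport m h σ e J κ) {φ : (Fin (m + 1) → ℝ) → ENNReal}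
    (hφ : LatPer m h φ) (mφ : Measurable φ) :
    ∫⁻ z in cylCell m h, φ (σ z) ≤ κ * ∫⁻ z in cylCell m h, φ z := by
  have := H.dual φ (fun _ => 1) hφ (fun _ _ _ => rfl) mφ measurable_const
  simp only [mul_one] at this
  rw [this, ← lintegral_const_mul _ mφ]
  exact lintegral_mono fun z => by rw [mul_comm]; exact mul_le_mul_left (H.jac_le z) _

lemma lintegral_adj (H : Transport m h σ e J κ) {ψ : (Fin (m + 1) → ℝ) → ENNReal}
    (hψ : LatPer m h ψ) (mψ : Measurable ψ) :
    ∫⁻ z in cylCell m h, J z * ψ (e z) = ∫⁻ z in cylCell m h, ψ z := by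
  have := H.dual (fun _ => 1) ψ (fun _ _ _ => rfl) hψ measurable_const mψ
  simpa using this.symm

lemma nsq_comp_le (H : Transport m h σ e J κ) {φ : (Fin (m + 1) → ℝ) → ENNReal}
    (hφ : LatPer m h φ) (mφ : Measurable φ) :
    nsq m h (fun z => φ (σ z)) ≤ κ * nsq m h φ :=
  H.lintegral_comp_le (hφ.mul hφ) (mφ.mul mφ)

lemma nsq_adj_le (H : Transport m h σ e J κ) {ψ : (Fin (m + 1) → ℝ) → ENNReal}
    (hψ : LatPer m h ψ) (mψ : Measurable ψ) :
    nsq m h (fun z => J z * ψ (e z)) ≤ κ * nsq m h ψ := by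
  have := H.meas_inv
  have := H.meas_jac
  rw [nsq, nsq, ← H.lintegral_adj (hψ.mul hψ) (mψ.mul mψ),
    ← lintegral_const_mul _ (by fun_prop)]
  refine lintegral_mono fun z => ?_
  calc J z * ψ (e z) * (J z * ψ (e z)) = J z * (J z * (ψ (e z) * ψ (e z))) := by ring
    _ ≤ _ := mul_le_mul_left (H.jac_le z) _

lemma latPer_step (H : Transport m h σ e J κ) {φ : (Fin (m + 1) → ℝ) → ENNReal}
    (hφ : LatPer m h φ) (a : ℝ) (n : ℕ) : LatPer m h ((stepOp a σ)^[n] φ) := by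
  induction n with
  | zero => exact hφ
  | succ n ih => rw [Function.iterate_succ_apply']; exact H.latPer_comp (ih.avg a)

lemma measurable_step (H : Transport m h σ e J κ) {φ : (Fin (m + 1) → ℝ) → ENNReal}
    (mφ : Measurable φ) (a : ℝ) (n : ℕ) : Measurable ((stepOp a σ)^[n] φ) := by
  induction n with
  | zero => exact mφ
  | succ n ih => rw [Function.iterate_succ_apply']; exact (measurable_avg ih a).comp H.meas

lemma lintegral_step_le (H : Transport m h σ e J κ) (hh : 0 < h)
    {φ : (Fin (m + 1) → ℝ) → ENNReal} (hφ : LatPer m h φ) (mφ : Measurable φ) (a : ℝ) (n : ℕ) :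
    ∫⁻ z in cylCell m h, (stepOp a σ)^[n] φ z ≤ κ ^ n * ∫⁻ z in cylCell m h, φ z := by
  induction n with
  | zero => simp
  | succ n ih =>
    rw [Function.iterate_succ_apply']
    have hp := H.latPer_step hφ a n
    have hm := H.measurable_step mφ a n
    refine (H.lintegral_comp_le (hp.avg a) (measurable_avg hm a)).trans ?_
    rw [lintegral_avg hh hp hm, pow_succ', mul_assoc]
    gcongr

/-- The adjoint iterates. -/
def adj (a : ℝ) (e : (Fin (m + 1) → ℝ) → Fin (m + 1) → ℝ) (J ψ : (Fin (m + 1) → ℝ) → ENNReal) :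
    ℕ → (Fin (m + 1) → ℝ) → ENNReal
  | 0 => fun z => J z * ψ (e z)
  | n + 1 => fun z => J z * avg a (adj a e J ψ n) (e z)

lemma adj_props (H : Transport m h σ e J κ) {ψ : (Fin (m + 1) → ℝ) → ENNReal}
    (hψ : LatPer m h ψ) (mψ : Measurable ψ) (a : ℝ) (n : ℕ) :
    LatPer m h (adj a e J ψ n) ∧ Measurable (adj a e J ψ n) := by
  have h1 := H.meas_inv
  have h2 := H.meas_jac
  induction n with
  | zero => exact ⟨H.latPer_adj hψ, h2.mul (mψ.comp h1)⟩
  | succ n ih =>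
    exact ⟨H.latPer_adj (ih.1.avg a), h2.mul ((measurable_avg ih.2 a).comp h1)⟩

lemma lintegral_adj_iter (H : Transport m h σ e J κ) (hh : 0 < h)
    {ψ : (Fin (m + 1) → ℝ) → ENNReal} (hψ : LatPer m h ψ) (mψ : Measurable ψ) (a : ℝ) (n : ℕ) :
    ∫⁻ z in cylCell m h, adj a e J ψ n z = ∫⁻ z in cylCell m h, ψ z := by
  induction n with
  | zero => exact H.lintegral_adj hψ mψ
  | succ n ih =>
    obtain ⟨hp, hm⟩ := H.adj_props hψ mψ a n
    rw [← ih, ← lintegral_avg hh hp hm a]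
    exact H.lintegral_adj (hp.avg a) (measurable_avg hm a)

lemma dual_iter (H : Transport m h σ e J κ) (hh : 0 < h)
    {φ ψ : (Fin (m + 1) → ℝ) → ENNReal} (hφ : LatPer m h φ) (mφ : Measurable φ)
    (hψ : LatPer m h ψ) (mψ : Measurable ψ) (a : ℝ) (n : ℕ) :
    ∫⁻ z in cylCell m h, (stepOp a σ)^[n + 1] φ z * ψ z =
      ∫⁻ z in cylCell m h, φ z * avg a (adj a e J ψ n) z := by
  induction n generalizing φ with
  | zero =>
    rw [← avg_symm hh hφ (H.adj_props hψ mψ a 0).1 mφ (H.adj_props hψ mψ a 0).2]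
    exact H.dual _ _ (hφ.avg a) hψ (measurable_avg mφ a) mψ
  | succ n ih =>
    obtain ⟨hp, hm⟩ := H.adj_props hψ mψ a n
    rw [Function.iterate_succ_apply, ih (φ := stepOp a σ φ) (H.latPer_step hφ a 1)
      (H.measurable_step mφ a 1),
      ← avg_symm hh hφ (H.adj_props hψ mψ a (n + 1)).1 mφ (H.adj_props hψ mψ a (n + 1)).2]
    exact H.dual _ _ (hφ.avg a) (hp.avg a) (measurable_avg mφ a) (measurable_avg hm a)

lemma lintegral_step_mul_le (H : Transport m h σ e J κ) (hh : 0 < h) (hκ : 1 ≤ κ) (hκ' : κ ≠ ⊤)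
    {φ ψ : (Fin (m + 1) → ℝ) → ENNReal} (hφ : LatPer m h φ) (mφ : Measurable φ)
    (hψ : LatPer m h ψ) (mψ : Measurable ψ) {A B : ENNReal} (hA : A ≠ 0) (hA' : A ≠ ⊤)
    (hB : B ≠ 0) (hB' : B ≠ ⊤) (iφ : ∫⁻ z in cylCell m h, φ z ≤ A)
    (iψ : ∫⁻ z in cylCell m h, ψ z ≤ B) {a : ℝ} (ha : 0 < a) (i : ℕ) :
    ∫⁻ z in cylCell m h, (stepOp a σ)^[2 * 2 ^ i + 1] φ z * ψ z ≤
      κ ^ (2 * 2 ^ i) * (2 ^ (m + 1) * ENNReal.ofReal (decay m h (Real.sqrt 2 ^ i * a))) * A * B := by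
  have hκ0 : κ ≠ 0 := (zero_lt_one.trans_le hκ).ne'
  have hκ2 : κ ≤ κ ^ 2 := by rw [sq]; exact le_mul_of_one_le_left' hκ
  set D := 2 ^ (m + 1) * ENNReal.ofReal (decay m h (Real.sqrt 2 ^ i * a)) with hD
  have hpφ := H.latPer_step hφ a
  have hmφ := H.measurable_step mφ a
  have hψ' := H.adj_props hψ mψ a
  have n1 := nash_bound' hh ha hpφ hmφ hκ0 hκ' hA hA'
    (fun n => (H.lintegral_step_le hh hφ mφ a n).trans (by gcongr))
    (fun n => by
      rw [Function.iterate_succ_apply']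
      refine (H.nsq_comp_le ((hpφ n).avg a) (measurable_avg (hmφ n) a)).trans ?_
      gcongr) i
  have n2 := nash_bound' hh ha (fun n => (hψ' n).1) (fun n => (hψ' n).2) hκ0 hκ' hB hB'
    (fun n => (H.lintegral_adj_iter hh hψ mψ a n).le.trans
      (iψ.trans (le_mul_of_one_le_left' (one_le_pow₀ hκ))))
    (fun n => by
      refine (H.nsq_adj_le ((hψ' n).1.avg a) (measurable_avg (hψ' n).2 a)).trans ?_
      gcongr) i
  rw [show 2 * 2 ^ i + 1 = (2 ^ i + 1) + 2 ^ i by ring, Function.iterate_add_apply,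
    H.dual_iter hh (hpφ _) (hmφ _) hψ mψ]
  refine (ENNReal.pow_le_pow_left_iff two_ne_zero).1 ?_
  refine (sq_lintegral_mul_le (hmφ _) (measurable_avg (hψ' _).2 a)).trans ?_
  calc _ ≤ ((κ ^ 2 ^ i * A) ^ 2 * D) * ((κ ^ 2 ^ i * B) ^ 2 * D) :=
        mul_le_mul' n1 ((nsq_avg_le hh (hψ' _).1 (hψ' _).2 a).trans n2)
    _ = _ := by ring

lemma step_le_ae (H : Transport m h σ e J κ) (hh : 0 < h) (hκ : 1 ≤ κ) (hκ' : κ ≠ ⊤)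
    {φ : (Fin (m + 1) → ℝ) → ENNReal} (hφ : LatPer m h φ) (mφ : Measurable φ)
    {A : ENNReal} (hA : A ≠ 0) (hA' : A ≠ ⊤) (iφ : ∫⁻ z in cylCell m h, φ z ≤ A)
    {a : ℝ} (ha : 0 < a) (i : ℕ) :
    ∀ᵐ z, (stepOp a σ)^[2 * 2 ^ i + 1] φ z ≤
      κ ^ (2 * 2 ^ i) * (2 ^ (m + 1) * ENNReal.ofReal (decay m h (Real.sqrt 2 ^ i * a))) * A := by
  set F := (stepOp a σ)^[2 * 2 ^ i + 1] φ with hF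
  set B := κ ^ (2 * 2 ^ i) * (2 ^ (m + 1) * ENNReal.ofReal (decay m h (Real.sqrt 2 ^ i * a))) * A
    with hB
  have hBt : B ≠ ⊤ := by
    rw [hB]
    have : (2 : ENNReal) ^ (m + 1) ≠ ⊤ := ENNReal.pow_ne_top (by simp)
    have := ENNReal.pow_ne_top hκ' (n := 2 * 2 ^ i)
    finiteness
  have pF : LatPer m h F := H.latPer_step hφ a _
  have mF : Measurable F := H.measurable_step mφ a _
  refine ae_of_ae_cell hh pF ?_
  have hs : ∀ n : ℕ, ∀ᵐ z ∂volume.restrict (cylCell m h), ¬ (B < F z ∧ |z 0| ≤ n) := fun n => by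
    set s : Set (Fin (m + 1) → ℝ) := {z | B < F z ∧ |z 0| ≤ n} with hs
    have ms : MeasurableSet s :=
      (measurableSet_lt measurable_const mF).inter
        (measurableSet_le (measurable_pi_apply 0).abs measurable_const)
    have ps : LatPer m h (s.indicator fun _ => (1 : ENNReal)) := fun g hg z => by
      have : g + z ∈ s ↔ z ∈ s := by
        simp only [hs, Set.mem_ofPred_eq, pF g hg, Pi.add_apply, hg.1, zero_add]
      by_cases hz : z ∈ s
      · rw [Set.indicator_of_mem hz, Set.indicator_of_mem (this.2 hz)]
      · rw [Set.indicator_of_notMem hz, Set.indicator_of_notMem (mt this.1 hz)]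
    have i1 : ∫⁻ z in cylCell m h, s.indicator (fun _ => (1 : ENNReal)) z =
        volume (s ∩ cylCell m h) := by
      rw [lintegral_indicator_const ms, one_mul, Measure.restrict_apply ms]
    have fin : volume (s ∩ cylCell m h) ≠ ⊤ := by
      refine ((measure_mono (t := Set.univ.pi fun i =>
        Set.Icc ((Fin.cons (-n) fun _ => 0 : Fin (m + 1) → ℝ) i)
          ((Fin.cons n fun _ => h : Fin (m + 1) → ℝ) i)) ?_).trans_lt
        (isCompact_univ_pi fun _ => isCompact_Icc).measure_lt_top).ne
      rintro z ⟨hz, hz'⟩ i -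
      refine Fin.cases ?_ (fun j => ?_) i
      · simpa [abs_le] using hz.2
      · simpa using ⟨(hz' j).1, (hz' j).2.le⟩
    by_contra hcon
    have hpos : volume (s ∩ cylCell m h) ≠ 0 := fun h0 => hcon (by
      rw [ae_iff]
      simp only [not_not]
      rw [Measure.restrict_apply' (measurableSet_cylCell m h)]
      exact h0)
    have key := H.lintegral_step_mul_le hh hκ hκ' hφ mφ ps (measurable_const.indicator ms) hA hA'
      hpos fin iφ i1.le ha i
    have e1 : ∀ z, F z * s.indicator (fun _ => (1 : ENNReal)) z = s.indicator F z := fun z => by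
      by_cases hz : z ∈ s <;> simp [hz]
    rw [← hF, ← hB] at key
    simp only [e1] at key
    rw [lintegral_indicator ms, Measure.restrict_restrict ms] at key
    have strict : ∫⁻ z in s ∩ cylCell m h, B < ∫⁻ z in s ∩ cylCell m h, F z := by
      refine setLIntegral_strict_mono (ms.inter (measurableSet_cylCell m h)) hpos mF ?_
        (ae_of_all _ fun z hz => hz.1.1)
      rw [setLIntegral_const]
      exact ENNReal.mul_ne_top hBt fin
    rw [setLIntegral_const] at strict
    exact absurd key (not_le.2 strict)
  filter_upwards [ae_all_iff.2 hs] with z hz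
  obtain ⟨n, hn⟩ := exists_nat_ge |z 0|
  exact not_lt.1 fun hlt => hz n ⟨hlt, hn⟩

lemma step_le (H : Transport m h σ e J κ) (hh : 0 < h) (hκ : 1 ≤ κ) (hκ' : κ ≠ ⊤)
    {φ : (Fin (m + 1) → ℝ) → ENNReal} (hφ : LatPer m h φ) (mφ : Measurable φ)
    {A : ENNReal} (hA : A ≠ 0) (hA' : A ≠ ⊤) (iφ : ∫⁻ z in cylCell m h, φ z ≤ A)
    {a : ℝ} (ha : 0 < a) (i n : ℕ) (hn : 2 * 2 ^ i + 2 ≤ n) (z : Fin (m + 1) → ℝ) :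
    (stepOp a σ)^[n] φ z ≤
      κ ^ (2 * 2 ^ i) * (2 ^ (m + 1) * ENNReal.ofReal (decay m h (Real.sqrt 2 ^ i * a))) * A := by
  induction n, hn using Nat.le_induction generalizing z with
  | base =>
    rw [Function.iterate_succ_apply']
    exact avg_le_of_ae (H.step_le_ae hh hκ hκ' hφ mφ hA hA' iφ ha i) ha.ne' _
  | succ n _ ih =>
    rw [Function.iterate_succ_apply']
    exact avg_le_of_ae (ae_of_all _ ih) ha.ne' _

end Transport

lemma mul_decay_anti {m : ℕ} {h : ℝ} (hh : 0 < h) {a b : ℝ} (ha : 0 < a) (hab : a ≤ b) :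
    b * decay m h b ≤ a * decay m h a := by
  have hb := ha.trans_le hab
  have e : ∀ x : ℝ, 0 < x → x * decay m h x =
      Real.exp ((m + 1 : ℕ) / 2) * Real.sqrt 2 ^ (m + 1) * (h ^ m)⁻¹ * (1 + h * x⁻¹) ^ m :=
    fun x hx => by
      unfold decay
      rw [mul_left_comm, ← mul_assoc x, mul_inv_cancel₀ hx.ne', one_mul]
  rw [e a ha, e b hb]
  gcongr

/-- Decay of the splitting scheme at rate `t^{-1/2}`. -/
lemma exists_step_le (m : ℕ) {h : ℝ} (hh : 0 < h) : ∃ C : ℝ, 0 < C ∧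
    ∀ {σ e : (Fin (m + 1) → ℝ) → Fin (m + 1) → ℝ} {J : (Fin (m + 1) → ℝ) → ENNReal} {κ : ENNReal},
      Transport m h σ e J κ → 1 ≤ κ → κ ≠ ⊤ → ∀ {φ : (Fin (m + 1) → ℝ) → ENNReal},
      LatPer m h φ → Measurable φ → ∀ {A : ENNReal}, A ≠ 0 → A ≠ ⊤ →
      ∫⁻ z in cylCell m h, φ z ≤ A → ∀ {δ : ℝ}, 0 < δ → ∀ n : ℕ, 4 ≤ n → 1 / 2 ≤ n * δ →
      ∀ z, (stepOp (Real.sqrt (2 * δ)) σ)^[n] φ z ≤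
        κ ^ n * ENNReal.ofReal (C * (Real.sqrt (n * δ))⁻¹) * A := by
  set a₀ := Real.sqrt (1 / 2) / 2 with ha₀
  have ha₀' : 0 < a₀ := by positivity
  refine ⟨2 ^ (m + 1) * (2 * (a₀ * decay m h a₀)),
    by have := decay_pos (m := m) hh ha₀'; positivity, ?_⟩
  intro σ e J κ H hκ hκ' φ hφ mφ A hA hA' iφ δ hδ n hn hnδ z
  set i := Nat.log 2 (n / 4) with hi
  have h1 : 2 ^ i ≤ n / 4 := Nat.pow_log_le_self 2 (by omega)
  have h2 : n / 4 < 2 ^ (i + 1) := Nat.lt_pow_succ_log_self (by norm_num) _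
  rw [pow_succ] at h2
  have h3 : (n : ℝ) ≤ 8 * 2 ^ i := by
    have : n ≤ 8 * 2 ^ i := by omega
    exact_mod_cast this
  have hi1 : 1 ≤ 2 ^ i := Nat.one_le_two_pow
  refine (H.step_le hh hκ hκ' hφ mφ hA hA' iφ (by positivity) i n (by omega) z).trans ?_
  gcongr
  · omega
  · have hpos : 0 < Real.sqrt (n * δ) := Real.sqrt_pos.2 (by linarith)
    have e1 : Real.sqrt (n * δ) / 2 ≤ Real.sqrt 2 ^ i * Real.sqrt (2 * δ) := by
      have e2 : Real.sqrt 2 ^ i = Real.sqrt (2 ^ i) := by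
        rw [Real.sqrt_eq_rpow, Real.sqrt_eq_rpow, ← Real.rpow_natCast, ← Real.rpow_natCast,
          ← Real.rpow_mul zero_le_two, ← Real.rpow_mul zero_le_two, mul_comm]
      rw [e2, ← Real.sqrt_mul (by positivity)]
      refine Real.le_sqrt_of_sq_le ?_
      rw [div_pow, Real.sq_sqrt (by positivity)]
      nlinarith
    have e3 : a₀ ≤ Real.sqrt (n * δ) / 2 := by
      rw [ha₀]; gcongr
    have e4 := (decay_anti (m := m) hh (by positivity) e1)
    have e5 := mul_decay_anti (m := m) hh ha₀' e3
    have e6 : decay m h (Real.sqrt (n * δ) / 2) ≤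
        2 * (a₀ * decay m h a₀) * (Real.sqrt (n * δ))⁻¹ := by
      rw [← div_eq_mul_inv, le_div_iff₀ hpos]
      linarith
    calc _ ≤ 2 ^ (m + 1) * ENNReal.ofReal (2 * (a₀ * decay m h a₀) * (Real.sqrt (n * δ))⁻¹) := by
          gcongr; exact e4.trans e6
      _ = _ := by
          rw [mul_assoc (2 ^ (m + 1) : ℝ), ENNReal.ofReal_mul (p := 2 ^ (m + 1)) (by positivity),
            ENNReal.ofReal_pow (by norm_num)]
          simp

/-! ### The change of variables `z ↦ z - δ u(z)` -/

lemma abs_prod_one_add_sub_le {ι : Type*} (s : Finset ι) (x : ι → ℝ) {η : ℝ} (hη : η ≤ 1)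
    (hx : ∀ i, |x i| ≤ η) :
    |∏ i ∈ s, (1 + x i) - 1 - ∑ i ∈ s, x i| ≤ 4 ^ s.card * η ^ 2 := by
  classical
  induction s using Finset.induction_on with
  | empty => simp; positivity
  | insert a s ha ih =>
    rw [Finset.prod_insert ha, Finset.sum_insert ha, Finset.card_insert_of_notMem ha]
    have hη0 : 0 ≤ η := (abs_nonneg _).trans (hx a)
    have hS : |∑ i ∈ s, x i| ≤ 4 ^ s.card * η := by
      refine (Finset.abs_sum_le_sum_abs _ _).trans ((Finset.sum_le_sum fun i _ => hx i).trans ?_)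
      rw [Finset.sum_const, nsmul_eq_mul]
      gcongr
      exact_mod_cast (Nat.lt_pow_self (by norm_num)).le
    have e : (1 + x a) * ∏ i ∈ s, (1 + x i) - 1 - (x a + ∑ i ∈ s, x i) =
        x a * ∑ i ∈ s, x i + (1 + x a) * (∏ i ∈ s, (1 + x i) - 1 - ∑ i ∈ s, x i) := by ring
    have h1 : |1 + x a| ≤ 2 := by
      have := abs_le.1 (hx a)
      rw [abs_le]; constructor <;> linarith
    have h2 : |x a * ∑ i ∈ s, x i| ≤ η * (4 ^ s.card * η) := by
      rw [abs_mul]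
      exact mul_le_mul (hx a) hS (abs_nonneg _) hη0
    have h3 : |(1 + x a) * (∏ i ∈ s, (1 + x i) - 1 - ∑ i ∈ s, x i)| ≤ 2 * (4 ^ s.card * η ^ 2) := by
      rw [abs_mul]
      exact mul_le_mul h1 ih (abs_nonneg _) zero_le_two
    rw [e]
    refine (abs_add_le _ _).trans ((add_le_add h2 h3).trans ?_)
    have : 0 ≤ (4 : ℝ) ^ s.card * η ^ 2 := by positivity
    rw [pow_succ (4 : ℝ)]
    nlinarith

lemma abs_prod_perm_le {N : ℕ} (B : Matrix (Fin N) (Fin N) ℝ) {η : ℝ} (hη : η ≤ 1)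
    (hB : ∀ i j, |B i j| ≤ η) {σ : Equiv.Perm (Fin N)} (hσ : σ ≠ 1) :
    |∏ i, (1 + B) (σ i) i| ≤ 2 ^ N * η ^ 2 := by
  obtain ⟨i₀, hi₀⟩ : ∃ i, σ i ≠ i := by
    by_contra! hcon
    exact hσ (Equiv.ext hcon)
  have hη0 : 0 ≤ η := (abs_nonneg _).trans (hB i₀ i₀)
  have hj : σ (σ i₀) ≠ σ i₀ := fun hc => hi₀ (σ.injective hc)
  rw [Finset.abs_prod]
  have key : ∀ i, |(1 + B) (σ i) i| ≤
      2 * ((if i = i₀ then η else 1) * (if i = σ i₀ then η else 1)) := fun i => by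
    rw [Matrix.add_apply, Matrix.one_apply]
    by_cases h1 : i = i₀
    · subst h1
      rw [if_neg hi₀, if_pos rfl, if_neg (Ne.symm hi₀), zero_add]
      linarith [hB (σ i) i]
    · by_cases h2 : i = σ i₀
      · subst h2
        rw [if_neg hj, if_neg h1, if_pos rfl, zero_add]
        linarith [hB (σ (σ i₀)) (σ i₀)]
      · rw [if_neg h1, if_neg h2]
        have := abs_le.1 (hB (σ i) i)
        split_ifs <;> (rw [abs_le]; constructor <;> linarith)
  refine (Finset.prod_le_prod (fun i _ => abs_nonneg _) fun i _ => key i).trans (le_of_eq ?_)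
  rw [Finset.prod_mul_distrib, Finset.prod_mul_distrib]
  simp only [Finset.prod_const, Finset.card_univ, Fintype.card_fin, Finset.prod_ite_eq',
    Finset.mem_univ, if_true]
  ring

lemma abs_det_one_add_sub_le {N : ℕ} (B : Matrix (Fin N) (Fin N) ℝ) {η : ℝ} (hη : η ≤ 1)
    (hB : ∀ i j, |B i j| ≤ η) :
    |(1 + B).det - 1 - B.trace| ≤ (4 ^ N + N.factorial * 2 ^ N) * η ^ 2 := by
  rw [Matrix.det_apply', ← Finset.add_sum_erase _ _ (Finset.mem_univ 1)]
  have h1 := abs_prod_one_add_sub_le Finset.univ (fun i => B i i) hη fun i => hB i i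
  have h2 : |∑ σ ∈ Finset.univ.erase (1 : Equiv.Perm (Fin N)),
      ((Equiv.Perm.sign σ : ℤ) : ℝ) * ∏ i, (1 + B) (σ i) i| ≤ N.factorial * (2 ^ N * η ^ 2) := by
    refine (Finset.abs_sum_le_sum_abs _ _).trans ?_
    refine (Finset.sum_le_sum (g := fun _ => 2 ^ N * η ^ 2) fun σ hσ => ?_).trans ?_
    · have hs : |((Equiv.Perm.sign σ : ℤ) : ℝ)| = 1 := by
        rcases Int.units_eq_one_or (Equiv.Perm.sign σ) with h | h <;> simp [h]
      rw [abs_mul, hs, one_mul]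
      exact abs_prod_perm_le B hη hB (Finset.ne_of_mem_erase hσ)
    · rw [Finset.sum_const, nsmul_eq_mul]
      gcongr
      refine (Finset.card_erase_le).trans (le_of_eq ?_)
      rw [Finset.card_univ, Fintype.card_perm, Fintype.card_fin]
  simp only [Finset.card_univ, Fintype.card_fin] at h1
  simp only [Equiv.Perm.sign_one, Units.val_one, Int.cast_one, one_mul, Equiv.Perm.coe_one, id,
    Matrix.add_apply, Matrix.one_apply_eq, Matrix.trace, Matrix.diag_apply] at *
  rw [abs_le] at *
  constructor <;> nlinarith

lemma latPer_shift {m : ℕ} {h : ℝ} {u : (Fin (m + 1) → ℝ) → Fin (m + 1) → ℝ}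
    (hu : LatPer m h u) (δ : ℝ) : ∀ g ∈ lat m h, ∀ z, g + z - δ • u (g + z) = g + (z - δ • u z) :=
  fun g hg z => by rw [hu g hg, add_sub_assoc]

lemma LatPer.fderiv {m : ℕ} {h : ℝ} {F : Type*} [NormedAddCommGroup F] [NormedSpace ℝ F]
    {φ : (Fin (m + 1) → ℝ) → F} (hφ : LatPer m h φ) : LatPer m h (fderiv ℝ φ) := fun g hg z => by
  have : (fun w => φ (g + w)) = φ := funext (hφ g hg)
  rw [← fderiv_comp_add_left (f := φ) (x := z) g, this]

lemma det_fderiv_shift {N : ℕ} {u : (Fin N → ℝ) → Fin N → ℝ} (hu : Differentiable ℝ u)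
    (hdiv : ∀ z, ∑ i, pd i (fun w => u w i) z = 0) {L : ℝ} (hL : ∀ z, ‖fderiv ℝ u z‖ ≤ L)
    {δ : ℝ} (hδ : 0 ≤ δ) (hδL : δ * L ≤ 1) (z : Fin N → ℝ) :
    |(ContinuousLinearMap.id ℝ (Fin N → ℝ) - δ • fderiv ℝ u z).det - 1| ≤
      (4 ^ N + N.factorial * 2 ^ N) * (δ * L) ^ 2 := by
  set A := fderiv ℝ u z with hA
  set B : Matrix (Fin N) (Fin N) ℝ := Matrix.of fun i j => -(δ * A (Pi.single j 1) i) with hB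
  have e1 : (ContinuousLinearMap.id ℝ (Fin N → ℝ) - δ • A).det = (1 + B).det := by
    rw [ContinuousLinearMap.det, ← LinearMap.det_toMatrix']
    congr 1
    ext i j
    simp [LinearMap.toMatrix'_apply, hB, Matrix.one_apply, Pi.single_apply]
    ring
  have e2 : B.trace = 0 := by
    have := hdiv z
    have e3 : ∀ i, pd i (fun w => u w i) z = A (Pi.single i 1) i := fun i => by
      have := hasFDerivAt_pi'.1 (hu z).hasFDerivAt i
      rw [pd, this.fderiv]; rfl
    simp only [e3] at this
    simp only [Matrix.trace, Matrix.diag_apply, hB, Matrix.of_apply, Finset.sum_neg_distrib,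
      ← Finset.mul_sum, this]
    simp
  have := abs_det_one_add_sub_le B hδL fun i j => by
    rw [hB, Matrix.of_apply, abs_neg, abs_mul, abs_of_nonneg hδ]
    gcongr
    calc |A (Pi.single j 1) i| ≤ ‖A (Pi.single j 1)‖ := norm_le_pi_norm (A (Pi.single j 1)) i
      _ ≤ ‖A‖ * ‖(Pi.single j 1 : Fin N → ℝ)‖ := A.le_opNorm _
      _ ≤ L := by rw [Pi.norm_single]; simpa using hL z
  rw [e1]
  simpa [e2] using this

lemma exists_homeomorph_shift {m : ℕ} {u : (Fin (m + 1) → ℝ) → Fin (m + 1) → ℝ}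
    (hu : Differentiable ℝ u) {L : ℝ} (hL : ∀ z, ‖fderiv ℝ u z‖ ≤ L) {δ : ℝ} (hδ : 0 ≤ δ)
    (hδL : δ * L ≤ 1 / 2) :
    ∃ s : (Fin (m + 1) → ℝ) ≃ₜ (Fin (m + 1) → ℝ), ∀ z, s z = z - δ • u z := by
  have hlip : ∀ x y, ‖u x - u y‖ ≤ L * ‖x - y‖ := fun x y =>
    convex_univ.norm_image_sub_le_of_norm_fderiv_le (fun z _ => hu z) (fun z _ => hL z)
      (Set.mem_univ y) (Set.mem_univ x)
  have happ : ApproximatesLinearOn (fun z => z - δ • u z)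
      ((ContinuousLinearEquiv.refl ℝ (Fin (m + 1) → ℝ) : (Fin (m + 1) → ℝ) ≃L[ℝ] _) :
        (Fin (m + 1) → ℝ) →L[ℝ] _) Set.univ (1 / 2) := fun x _ y _ => by
    have e : x - δ • u x - (y - δ • u y) - (x - y) = -(δ • (u x - u y)) := by
      rw [smul_sub]; abel
    simp only [ContinuousLinearEquiv.coe_refl, ContinuousLinearMap.coe_id', id]
    rw [e, norm_neg, norm_smul, Real.norm_of_nonneg hδ]
    calc δ * ‖u x - u y‖ ≤ δ * (L * ‖x - y‖) := by gcongr; exact hlip x y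
      _ = (δ * L) * ‖x - y‖ := by ring
      _ ≤ 1 / 2 * ‖x - y‖ := by gcongr
      _ = _ := by norm_num
  refine ⟨happ.toHomeomorph _ (Or.inr ?_), fun z => rfl⟩
  simp
  norm_num

lemma transport_shift {m : ℕ} {h : ℝ} (hh : 0 < h) {u : (Fin (m + 1) → ℝ) → Fin (m + 1) → ℝ}
    (hu : ContDiff ℝ 1 u) (hper : LatPer m h u)
    (hdiv : ∀ z, ∑ i, pd i (fun w => u w i) z = 0) {L : ℝ} (hL : ∀ z, ‖fderiv ℝ u z‖ ≤ L)
    {K : ℝ} (hK : K = 4 ^ (m + 1) + (m + 1).factorial * 2 ^ (m + 1))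
    {δ : ℝ} (hδ : 0 ≤ δ) (hδL : δ * L ≤ 1 / 2) (hδK : K * (δ * L) ^ 2 ≤ 1 / 2) :
    ∃ e J, Transport m h (fun z => z - δ • u z) e J (ENNReal.ofReal (1 + 2 * (K * (δ * L) ^ 2))) := by
  have hud : Differentiable ℝ u := hu.differentiable one_ne_zero
  obtain ⟨s, hs⟩ := exists_homeomorph_shift hud hL hδ hδL
  set D : (Fin (m + 1) → ℝ) → ℝ := fun z =>
    (ContinuousLinearMap.id ℝ (Fin (m + 1) → ℝ) - δ • fderiv ℝ u z).det with hD
  have hDle : ∀ z, |D z - 1| ≤ K * (δ * L) ^ 2 := fun z => by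
    rw [hK]
    exact det_fderiv_shift hud hdiv hL hδ (by linarith) z
  have hDpos : ∀ z, 1 / 2 ≤ D z := fun z => by
    have := (abs_le.1 (hDle z)).1; linarith
  have hDc : Continuous D := by
    have := hu.continuous_fderiv one_ne_zero
    exact ContinuousLinearMap.continuous_det.comp (by fun_prop)
  have hDper : LatPer m h D := fun g hg z => by
    simp only [hD, hper.fderiv g hg]
  have hperσ := latPer_shift hper δ
  have hpere : ∀ g ∈ lat m h, ∀ z, s.symm (g + z) = g + s.symm z := fun g hg z => by
    rw [s.symm_apply_eq, hs, hperσ g hg, ← hs, s.apply_symm_apply]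
  have hsm : Measurable (s.symm : (Fin (m + 1) → ℝ) → _) := s.symm.continuous.measurable
  refine ⟨s.symm, fun z => ENNReal.ofReal (D (s.symm z))⁻¹, ?_⟩
  have hJper : LatPer m h fun z => ENNReal.ofReal (D (s.symm z))⁻¹ := fun g hg z => by
    simp only [hpere g hg, hDper g hg]
  refine ⟨by have := hu.continuous.measurable; fun_prop, hsm,
    ((hDc.measurable.comp hsm).inv).ennreal_ofReal, hperσ, hpere, hJper, fun z => ?_, ?_⟩
  · refine ENNReal.ofReal_le_ofReal ?_
    have h1 := hDpos (s.symm z)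
    have h2 := (abs_le.1 (hDle (s.symm z))).1
    have h3 : 0 ≤ K * (δ * L) ^ 2 := (abs_nonneg _).trans (hDle z)
    refine inv_le_of_inv_le₀ (by positivity) ?_
    rw [inv_le_iff_one_le_mul₀ (by positivity)]
    nlinarith
  · intro φ ψ hφ hψ mφ mψ
    have hder : ∀ z ∈ cylCell m h, HasFDerivWithinAt s
        (ContinuousLinearMap.id ℝ (Fin (m + 1) → ℝ) - δ • fderiv ℝ u z) (cylCell m h) z :=
      fun z _ => by
        have := ((hasFDerivAt_id z).sub ((hud z).hasFDerivAt.const_smul δ)).hasFDerivWithinAt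
          (s := cylCell m h)
        exact this.congr (fun z _ => hs z) (hs z)
    have key := lintegral_image_eq_lintegral_abs_det_fderiv_mul volume (measurableSet_cylCell m h)
      hder s.injective.injOn fun z => φ z * (ENNReal.ofReal (D (s.symm z))⁻¹ * ψ (s.symm z))
    rw [s.image_eq_preimage_symm, setLIntegral_preimage_cell hh hsm hpere] at key
    · rw [key]
      refine lintegral_congr fun z => ?_
      have h1 := hDpos z
      rw [s.symm_apply_apply, hs]
      change _ = ENNReal.ofReal |D z| * _
      rw [abs_of_pos (by linarith), mul_left_comm, ← mul_assoc (ENNReal.ofReal _),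
        ← ENNReal.ofReal_mul (by linarith), mul_inv_cancel₀ (by linarith)]
      simp
    · exact hφ.mul (hJper.mul fun g hg z => by simp only [hpere g hg, hψ g hg])

/-! ### Gaussian averages of smooth functions -/

section Heat

variable {N : ℕ} {F : Type*} [NormedAddCommGroup F] [NormedSpace ℝ F]

/-- Convolution of `w` with the centred Gaussian of standard deviation `|a|`. -/
def heat (a : ℝ) (w : (Fin N → ℝ) → F) (ζ : Fin N → ℝ) : F :=
  ∫ ξ, gauss ξ • w (ζ - a • ξ)

lemma integrable_gauss_smul {g : (Fin N → ℝ) → F} {K : ℝ} (hg : Continuous g)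
    (hK : ∀ z, ‖g z‖ ≤ K) : Integrable (fun ξ : Fin N → ℝ => gauss ξ • g ξ) := by
  refine Integrable.mono' (integrable_gauss.mul_const K)
    (continuous_gauss.smul hg).aestronglyMeasurable (Filter.Eventually.of_forall fun ξ => ?_)
  rw [norm_smul, Real.norm_of_nonneg (gauss_pos ξ).le]
  exact mul_le_mul_of_nonneg_left (hK _) (gauss_pos ξ).le

lemma integrable_heat {w : (Fin N → ℝ) → F} {K : ℝ} (hw : Continuous w) (hK : ∀ z, ‖w z‖ ≤ K)
    (a : ℝ) (ζ : Fin N → ℝ) : Integrable (fun ξ : Fin N → ℝ => gauss ξ • w (ζ - a • ξ)) :=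
  integrable_gauss_smul (g := fun ξ => w (ζ - a • ξ)) (by fun_prop) fun _ => hK _

lemma norm_heat_le {w : (Fin N → ℝ) → F} {K : ℝ} (hK : ∀ z, ‖w z‖ ≤ K) (a : ℝ)
    (ζ : Fin N → ℝ) : ‖heat a w ζ‖ ≤ K := by
  have := norm_integral_le_of_norm_le (f := fun ξ : Fin N → ℝ => gauss ξ • w (ζ - a • ξ))
    (integrable_gauss.mul_const K) (Filter.Eventually.of_forall fun ξ => by
      rw [norm_smul, Real.norm_of_nonneg (gauss_pos ξ).le]
      exact mul_le_mul_of_nonneg_left (hK _) (gauss_pos ξ).le)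
  rwa [integral_mul_const, integral_gauss, one_mul] at this

lemma continuous_heat_uncurry {w : (Fin N → ℝ) → F} {K : ℝ} (hw : Continuous w)
    (hK : ∀ z, ‖w z‖ ≤ K) :
    Continuous fun p : ℝ × (Fin N → ℝ) => heat p.1 w p.2 := by
  refine continuous_of_dominated (bound := fun ξ => gauss ξ * K)
    (fun p => (integrable_heat hw hK p.1 p.2).aestronglyMeasurable)
    (fun p => Filter.Eventually.of_forall fun ξ => ?_) (integrable_gauss.mul_const K)
    (Filter.Eventually.of_forall fun ξ => by fun_prop)
  rw [norm_smul, Real.norm_of_nonneg (gauss_pos ξ).le]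
  exact mul_le_mul_of_nonneg_left (hK _) (gauss_pos ξ).le

lemma hasFDerivAt_heat {w : (Fin N → ℝ) → F} {Q K : ℝ} (hw : ContDiff ℝ 1 w)
    (hQ : ∀ z, ‖w z‖ ≤ Q) (hK : ∀ z, ‖fderiv ℝ w z‖ ≤ K) (a : ℝ) (ζ : Fin N → ℝ) :
    HasFDerivAt (heat a w) (heat a (fderiv ℝ w) ζ) ζ := by
  have hw' : Continuous (fderiv ℝ w) := hw.continuous_fderiv one_ne_zero
  refine hasFDerivAt_integral_of_dominated_of_fderiv_le
    (F := fun x ξ => gauss ξ • w (x - a • ξ)) (F' := fun x ξ => gauss ξ • fderiv ℝ w (x - a • ξ))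
    (bound := fun ξ => gauss ξ * K)
    Filter.univ_mem (Filter.Eventually.of_forall fun x =>
      (integrable_heat hw.continuous hQ a x).aestronglyMeasurable)
    (integrable_heat hw.continuous hQ a ζ) (integrable_heat hw' hK a ζ).aestronglyMeasurable
    (Filter.Eventually.of_forall fun ξ x _ => ?_) (integrable_gauss.mul_const K)
    (Filter.Eventually.of_forall fun ξ x _ => ?_)
  · rw [norm_smul, Real.norm_of_nonneg (gauss_pos ξ).le]
    exact mul_le_mul_of_nonneg_left (hK _) (gauss_pos ξ).le
  · have h1 := (hw.differentiable one_ne_zero (x - a • ξ)).hasFDerivAt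
    have h2 := h1.comp x ((hasFDerivAt_id x).sub_const (a • ξ))
    rw [ContinuousLinearMap.comp_id] at h2
    exact h2.const_smul (gauss ξ)

lemma fderiv_heat {w : (Fin N → ℝ) → F} {Q K : ℝ} (hw : ContDiff ℝ 1 w)
    (hQ : ∀ z, ‖w z‖ ≤ Q) (hK : ∀ z, ‖fderiv ℝ w z‖ ≤ K) (a : ℝ) :
    fderiv ℝ (heat a w) = heat a (fderiv ℝ w) :=
  funext fun ζ => (hasFDerivAt_heat hw hQ hK a ζ).fderiv

end Heat

/-- Functions of class `C²` with values in `[0, Q]` and first two derivatives bounded by `K`. -/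
structure BddC2 {N : ℕ} (Q K : ℝ) (w : (Fin N → ℝ) → ℝ) : Prop where
  contDiff : ContDiff ℝ 2 w
  nonneg : ∀ z, 0 ≤ w z
  le : ∀ z, w z ≤ Q
  fderiv_le : ∀ z, ‖fderiv ℝ w z‖ ≤ K
  fderiv2_le : ∀ z, ‖fderiv ℝ (fderiv ℝ w) z‖ ≤ K

namespace BddC2

variable {N : ℕ} {Q K : ℝ} {w : (Fin N → ℝ) → ℝ}

lemma norm_le (H : BddC2 Q K w) (z : Fin N → ℝ) : ‖w z‖ ≤ Q := by
  rw [Real.norm_of_nonneg (H.nonneg z)]; exact H.le z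

lemma contDiff_fderiv (H : BddC2 Q K w) : ContDiff ℝ 1 (fderiv ℝ w) :=
  H.contDiff.fderiv_right (by norm_num)

lemma contDiff_one (H : BddC2 Q K w) : ContDiff ℝ 1 w := H.contDiff.of_le (by norm_num)

lemma continuous_fderiv2 (H : BddC2 Q K w) : Continuous (fderiv ℝ (fderiv ℝ w)) :=
  H.contDiff_fderiv.continuous_fderiv one_ne_zero

lemma nonneg_bound (H : BddC2 Q K w) : 0 ≤ K := (norm_nonneg _).trans (H.fderiv_le 0)

lemma fderiv_heat (H : BddC2 Q K w) (a : ℝ) :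
    fderiv ℝ (heat a w) = heat a (fderiv ℝ w) :=
  _root_.fderiv_heat H.contDiff_one H.norm_le H.fderiv_le a

lemma fderiv2_heat (H : BddC2 Q K w) (a : ℝ) :
    fderiv ℝ (fderiv ℝ (heat a w)) = heat a (fderiv ℝ (fderiv ℝ w)) := by
  rw [H.fderiv_heat, _root_.fderiv_heat H.contDiff_fderiv H.fderiv_le H.fderiv2_le a]

protected lemma heat (H : BddC2 Q K w) (a : ℝ) : BddC2 Q K (heat a w) where
  contDiff := by
    rw [show (2 : WithTop ℕ∞) = 1 + 1 by norm_num, contDiff_succ_iff_fderiv]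
    refine ⟨fun ζ => (hasFDerivAt_heat H.contDiff_one H.norm_le H.fderiv_le a ζ).differentiableAt,
      by simp, ?_⟩
    rw [contDiff_one_iff_fderiv, H.fderiv2_heat, H.fderiv_heat]
    refine ⟨fun ζ => (hasFDerivAt_heat H.contDiff_fderiv H.fderiv_le H.fderiv2_le a
      ζ).differentiableAt, ?_⟩
    exact (continuous_heat_uncurry H.continuous_fderiv2 H.fderiv2_le).comp
      (continuous_const.prodMk continuous_id)
  nonneg z := integral_nonneg fun ξ => smul_nonneg (gauss_pos ξ).le (H.nonneg _)
  le z := (le_abs_self _).trans (norm_heat_le H.norm_le a z)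
  fderiv_le z := by rw [H.fderiv_heat]; exact norm_heat_le H.fderiv_le a z
  fderiv2_le z := by rw [H.fderiv2_heat]; exact norm_heat_le H.fderiv2_le a z

lemma norm_single_one_le (i : Fin N) : ‖(Pi.single i (1 : ℝ) : Fin N → ℝ)‖ ≤ 1 :=
  by
  rw [Pi.norm_single, norm_one]

lemma hasFDerivAt_fderiv_sub_smul (H : BddC2 Q K w) (a : ℝ) (ζ v ξ : Fin N → ℝ) :
    HasFDerivAt (fun ξ => fderiv ℝ w (ζ - a • ξ) v)
      (((ContinuousLinearMap.apply ℝ ℝ v).comp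
        (fderiv ℝ (fderiv ℝ w) (ζ - a • ξ))).comp (-(a • ContinuousLinearMap.id ℝ _))) ξ := by
  have h1 := (H.contDiff_fderiv.differentiable one_ne_zero (ζ - a • ξ)).hasFDerivAt
  have h2 : HasFDerivAt (fun ξ : Fin N → ℝ => ζ - a • ξ)
      (-(a • ContinuousLinearMap.id ℝ (Fin N → ℝ))) ξ :=
    ((hasFDerivAt_id ξ).const_smul a).const_sub ζ
  exact (((ContinuousLinearMap.apply ℝ ℝ v).hasFDerivAt).comp _ h1).comp ξ h2

lemma integral_fderiv_coord (H : BddC2 Q K w) (a : ℝ) (ζ : Fin N → ℝ) (i : Fin N) :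
    ∫ ξ, fderiv ℝ w (ζ - a • ξ) (Pi.single i 1) * (ξ i * gauss ξ) =
      -a * heat a (fderiv ℝ (fderiv ℝ w)) ζ (Pi.single i 1) (Pi.single i 1) := by
  have hK := H.nonneg_bound
  have hd := H.hasFDerivAt_fderiv_sub_smul a ζ (Pi.single i 1)
  have hc : ContDiff ℝ 1 (fun ξ => fderiv ℝ w (ζ - a • ξ) (Pi.single i 1)) :=
    (H.contDiff_fderiv.comp (contDiff_const.sub (contDiff_const_smul a))).clm_apply contDiff_const
  have hn := norm_single_one_le i
  rw [integral_mul_coord_gauss (B := max K (K * |a|)) hc]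
  · have hi :=
      integrable_heat (w := fderiv ℝ (fderiv ℝ w)) H.continuous_fderiv2 H.fderiv2_le a ζ
    rw [heat, ContinuousLinearMap.integral_apply hi,
      ContinuousLinearMap.integral_apply (hi.apply_continuousLinearMap _), ← integral_const_mul]
    refine integral_congr_ae (Filter.Eventually.of_forall fun ξ => ?_)
    dsimp only
    rw [(hd ξ).fderiv]
    simp only [ContinuousLinearMap.comp_apply, neg_apply,
      smul_apply, ContinuousLinearMap.id_apply, map_neg, map_smul,
      ContinuousLinearMap.apply_apply, smul_eq_mul]
    ring
  · intro ξ
    refine le_max_of_le_left ?_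
    have h1 := (fderiv ℝ w (ζ - a • ξ)).le_of_opNorm_le_of_le (H.fderiv_le _) hn
    rwa [mul_one] at h1
  · intro ξ
    refine le_max_of_le_right ?_
    rw [(hd ξ).fderiv]
    refine ContinuousLinearMap.opNorm_le_bound _ (by positivity) fun v => ?_
    have h1 := (fderiv ℝ (fderiv ℝ w) (ζ - a • ξ)).le_of_opNorm_le (H.fderiv2_le _) (-(a • v))
    have h2 := ContinuousLinearMap.le_of_opNorm_le_of_le _ h1 hn
    rw [norm_neg, norm_smul, Real.norm_eq_abs a, mul_one, ← mul_assoc] at h2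
    exact h2

/-- Gaussian integration by parts for the radial derivative. -/
lemma integral_fderiv_radial (H : BddC2 Q K w) (a : ℝ) (ζ : Fin N → ℝ) :
    ∫ ξ, gauss ξ * fderiv ℝ w (ζ - a • ξ) ξ =
      -a * ∑ i, heat a (fderiv ℝ (fderiv ℝ w)) ζ (Pi.single i 1) (Pi.single i 1) := by
  have hint : ∀ i : Fin N,
      Integrable (fun ξ => fderiv ℝ w (ζ - a • ξ) (Pi.single i 1) * (ξ i * gauss ξ)) := by
    intro i
    have hc : Continuous (fun ξ => fderiv ℝ w (ζ - a • ξ) (Pi.single i 1)) :=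
      (H.contDiff_fderiv.continuous.comp (by fun_prop)).clm_apply continuous_const
    refine Integrable.mono' (integrable_norm_mul_gauss.const_mul K)
      (hc.mul ((continuous_apply i).mul continuous_gauss)).aestronglyMeasurable
      (Filter.Eventually.of_forall fun ξ => ?_)
    rw [norm_mul, norm_mul, Real.norm_of_nonneg (gauss_pos ξ).le]
    have h1 := (fderiv ℝ w (ζ - a • ξ)).le_of_opNorm_le_of_le (H.fderiv_le _)
      (norm_single_one_le i)
    have h2 := norm_le_pi_norm ξ i
    have h3 := (gauss_pos ξ).le
    have hK := H.nonneg_bound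
    rw [mul_one] at h1
    gcongr
  rw [Finset.mul_sum, ← Finset.sum_congr rfl fun i _ => H.integral_fderiv_coord a ζ i,
    ← integral_finsetSum _ fun i _ => hint i]
  refine integral_congr_ae (Filter.Eventually.of_forall fun ξ => ?_)
  dsimp only
  have : fderiv ℝ w (ζ - a • ξ) ξ = ∑ i, ξ i * fderiv ℝ w (ζ - a • ξ) (Pi.single i 1) := by
    conv_lhs => arg 2; rw [pi_eq_sum_univ' ξ]
    rw [map_sum]
    refine Finset.sum_congr rfl fun i _ => ?_
    rw [map_smul, smul_eq_mul]
  rw [this, Finset.mul_sum]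
  refine Finset.sum_congr rfl fun i _ => ?_
  ring

lemma hasDerivAt_heat (H : BddC2 Q K w) (z c : Fin N → ℝ) {s : ℝ} (hs : 0 < s) :
    HasDerivAt (fun s => heat (√(2 * s)) w (z - s • c))
      (∑ i, heat (√(2 * s)) (fderiv ℝ (fderiv ℝ w)) (z - s • c) (Pi.single i 1) (Pi.single i 1) -
        heat (√(2 * s)) (fderiv ℝ w) (z - s • c) c) s := by
  have hK := H.nonneg_bound
  have hw' := H.contDiff_fderiv.continuous
  have hsq : ∀ r : ℝ, 0 < r → 0 < √(2 * r) := fun r hr => Real.sqrt_pos.2 (by linarith)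
  have hbound : ∀ ξ : Fin N → ℝ, ∀ r ∈ Set.Ioi (s / 2),
      ‖gauss ξ * fderiv ℝ w (z - r • c - √(2 * r) • ξ) (-c - (√(2 * r))⁻¹ • ξ)‖ ≤
        K * ‖c‖ * gauss ξ + K * (√s)⁻¹ * (‖ξ‖ * gauss ξ) := by
    intro ξ r hr
    have hr' : s / 2 < r := hr
    have h1 : (√(2 * r))⁻¹ ≤ (√s)⁻¹ := by
      refine inv_anti₀ (Real.sqrt_pos.2 hs) (Real.sqrt_le_sqrt (by linarith))
    have h2 : ‖-c - (√(2 * r))⁻¹ • ξ‖ ≤ ‖c‖ + (√s)⁻¹ * ‖ξ‖ := by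
      refine (norm_sub_le _ _).trans ?_
      rw [norm_neg, norm_smul, norm_inv, Real.norm_of_nonneg (Real.sqrt_nonneg _)]
      gcongr
    have h3 := (fderiv ℝ w (z - r • c - √(2 * r) • ξ)).le_of_opNorm_le_of_le (H.fderiv_le _) h2
    rw [norm_mul, Real.norm_of_nonneg (gauss_pos ξ).le]
    calc _ ≤ gauss ξ * (K * (‖c‖ + (√s)⁻¹ * ‖ξ‖)) :=
          mul_le_mul_of_nonneg_left h3 (gauss_pos ξ).le
      _ = _ := by ring
  have hdiff : ∀ ξ : Fin N → ℝ, ∀ r ∈ Set.Ioi (s / 2),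
      HasDerivAt (fun r => gauss ξ * w (z - r • c - √(2 * r) • ξ))
        (gauss ξ * fderiv ℝ w (z - r • c - √(2 * r) • ξ) (-c - (√(2 * r))⁻¹ • ξ)) r := by
    intro ξ r hr
    have hr0 : 0 < r := lt_trans (by linarith) (show s / 2 < r from hr)
    have h1 : HasDerivAt (fun r => √(2 * r)) ((√(2 * r))⁻¹) r := by
      have h0 := hsq r hr0
      refine (((hasDerivAt_id r).const_mul 2).sqrt (by simpa using hr0.ne')).congr_deriv ?_
      simp only [id_eq]
      field_simp
    have h2 : HasDerivAt (fun r => z - r • c - √(2 * r) • ξ) (-c - (√(2 * r))⁻¹ • ξ) r := by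
      have := (((hasDerivAt_id r).smul_const c).const_sub z).sub (h1.smul_const ξ)
      rw [one_smul] at this
      exact this
    have h3 := (H.contDiff_one.differentiable one_ne_zero
      (z - r • c - √(2 * r) • ξ)).hasFDerivAt.comp_hasDerivAt r h2
    exact h3.const_mul (gauss ξ)
  obtain ⟨hint, hder⟩ := hasDerivAt_integral_of_dominated_loc_of_deriv_le
    (F := fun r ξ => gauss ξ * w (z - r • c - √(2 * r) • ξ))
    (F' := fun r ξ => gauss ξ * fderiv ℝ w (z - r • c - √(2 * r) • ξ) (-c - (√(2 * r))⁻¹ • ξ))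
    (x₀ := s) (s := Set.Ioi (s / 2)) (μ := volume)
    (bound := fun ξ => K * ‖c‖ * gauss ξ + K * (√s)⁻¹ * (‖ξ‖ * gauss ξ))
    (Ioi_mem_nhds (by linarith))
    (Filter.Eventually.of_forall fun r =>
      (integrable_heat H.contDiff.continuous H.norm_le _ _).aestronglyMeasurable)
    (integrable_heat H.contDiff.continuous H.norm_le _ _)
    (by
      refine Continuous.aestronglyMeasurable ?_
      refine continuous_gauss.mul (Continuous.clm_apply ?_ ?_) <;> fun_prop)
    (Filter.Eventually.of_forall hbound)
    ((integrable_gauss.const_mul _).add (integrable_norm_mul_gauss.const_mul _))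
    (Filter.Eventually.of_forall hdiff)
  have e : (fun s => heat (√(2 * s)) w (z - s • c)) =
      fun r => ∫ ξ, gauss ξ * w (z - r • c - √(2 * r) • ξ) := rfl
  rw [e]
  refine hder.congr_deriv ?_
  set a := √(2 * s) with ha
  set ζ := z - s • c with hζ
  have ha0 : 0 < a := hsq s hs
  have hi := integrable_heat hw' H.fderiv_le a ζ
  have h1 : heat a (fderiv ℝ w) ζ c = ∫ ξ, gauss ξ * fderiv ℝ w (ζ - a • ξ) c := by
    rw [heat, ContinuousLinearMap.integral_apply hi]; rfl
  have hic : Integrable (fun ξ => gauss ξ * fderiv ℝ w (ζ - a • ξ) c) :=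
    hi.apply_continuousLinearMap c
  have e2 : ∀ ξ, gauss ξ * fderiv ℝ w (ζ - a • ξ) (-c - a⁻¹ • ξ) =
      -(gauss ξ * fderiv ℝ w (ζ - a • ξ) c) -
        a⁻¹ * (gauss ξ * fderiv ℝ w (ζ - a • ξ) ξ) := fun ξ => by
    rw [map_sub, map_neg, map_smul, smul_eq_mul]; ring
  have hir : Integrable (fun ξ => gauss ξ * fderiv ℝ w (ζ - a • ξ) ξ) := by
    have : Integrable fun ξ => a * (-(gauss ξ * fderiv ℝ w (ζ - a • ξ) (-c - a⁻¹ • ξ)) -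
        gauss ξ * fderiv ℝ w (ζ - a • ξ) c) := (hint.neg.sub hic).const_mul a
    refine this.congr (Filter.Eventually.of_forall fun ξ => ?_)
    dsimp only
    rw [e2]; field_simp; ring
  simp_rw [e2]
  rw [integral_sub (f := fun ξ => -(gauss ξ * fderiv ℝ w (ζ - a • ξ) c)) hic.neg
    (hir.const_mul _), integral_neg, ← h1, integral_const_mul,
    H.integral_fderiv_radial]
  field_simp
  ring_nf

end BddC2

/-! ### One step of the splitting scheme on smooth functions -/

lemma pd_pd {N : ℕ} {g : (Fin N → ℝ) → ℝ} (hg : ContDiff ℝ 2 g) (i : Fin N) (z : Fin N → ℝ) :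
    pd i (pd i g) z = fderiv ℝ (fderiv ℝ g) z (Pi.single i 1) (Pi.single i 1) := by
  have h1 : ContDiff ℝ 1 (fderiv ℝ g) := hg.fderiv_right (by norm_num)
  have h2 := (h1.differentiable one_ne_zero z).hasFDerivAt
  have h3 := ((ContinuousLinearMap.apply ℝ ℝ (Pi.single i (1 : ℝ))).hasFDerivAt).comp z h2
  have h4 : HasFDerivAt (pd i g) ((ContinuousLinearMap.apply ℝ ℝ (Pi.single i (1 : ℝ))).comp
    (fderiv ℝ (fderiv ℝ g) z)) z := h3
  rw [pd, h4.fderiv]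
  rfl

/-- Vector fields of class `C²` bounded by `U` together with two derivatives. -/
structure BddField {N : ℕ} (U : ℝ) (u : (Fin N → ℝ) → Fin N → ℝ) : Prop where
  contDiff : ContDiff ℝ 2 u
  norm_le : ∀ z, ‖u z‖ ≤ U
  fderiv_le : ∀ z, ‖fderiv ℝ u z‖ ≤ U
  fderiv2_le : ∀ z, ‖fderiv ℝ (fderiv ℝ u) z‖ ≤ U

/-- Transport along `u` followed by diffusion, both for time `s`. -/
def smoothStep {N : ℕ} (u : (Fin N → ℝ) → Fin N → ℝ) (s : ℝ) (w : (Fin N → ℝ) → ℝ)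
    (z : Fin N → ℝ) : ℝ :=
  heat (√(2 * s)) w (z - s • u z)

section

variable {N : ℕ} {U Q K s : ℝ} {u : (Fin N → ℝ) → Fin N → ℝ} {w : (Fin N → ℝ) → ℝ}

lemma BddField.nonneg (hu : BddField U u) : 0 ≤ U := (norm_nonneg _).trans (hu.norm_le 0)

lemma BddField.hasFDerivAt_shift (hu : BddField U u) (s : ℝ) (z : Fin N → ℝ) :
    HasFDerivAt (fun z => z - s • u z) (ContinuousLinearMap.id ℝ _ - s • fderiv ℝ u z) z :=
  (hasFDerivAt_id z).sub ((hu.contDiff.differentiable two_ne_zero z).hasFDerivAt.const_smul s)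

lemma BddField.contDiff_fderiv (hu : BddField U u) : ContDiff ℝ 1 (fderiv ℝ u) :=
  hu.contDiff.fderiv_right (by norm_num)

lemma hasFDerivAt_comp_shift (hu : BddField U u) (hV : BddC2 Q K w) (s : ℝ) (z : Fin N → ℝ) :
    HasFDerivAt (fun z => w (z - s • u z))
      ((fderiv ℝ w (z - s • u z)).comp (ContinuousLinearMap.id ℝ _ - s • fderiv ℝ u z)) z :=
  (hV.contDiff_one.differentiable one_ne_zero _).hasFDerivAt.comp z (hu.hasFDerivAt_shift s z)

lemma fderiv2_comp_shift (hu : BddField U u) (hV : BddC2 Q K w) (s : ℝ) (z x y : Fin N → ℝ) :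
    fderiv ℝ (fderiv ℝ fun z => w (z - s • u z)) z x y =
      fderiv ℝ (fderiv ℝ w) (z - s • u z) (x - s • fderiv ℝ u z x) (y - s • fderiv ℝ u z y) -
        s * fderiv ℝ w (z - s • u z) (fderiv ℝ (fderiv ℝ u) z x y) := by
  rw [show fderiv ℝ (fun z => w (z - s • u z)) = fun z => (fderiv ℝ w (z - s • u z)).comp
    (ContinuousLinearMap.id ℝ _ - s • fderiv ℝ u z) from
    funext fun z => (hasFDerivAt_comp_shift hu hV s z).fderiv]
  have h1 : HasFDerivAt (fun z => fderiv ℝ w (z - s • u z))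
      ((fderiv ℝ (fderiv ℝ w) (z - s • u z)).comp
        (ContinuousLinearMap.id ℝ _ - s • fderiv ℝ u z)) z :=
    (hV.contDiff_fderiv.differentiable one_ne_zero _).hasFDerivAt.comp z (hu.hasFDerivAt_shift s z)
  have h2 : HasFDerivAt (fun z => ContinuousLinearMap.id ℝ (Fin N → ℝ) - s • fderiv ℝ u z)
      (-(s • fderiv ℝ (fderiv ℝ u) z)) z :=
    ((hu.contDiff_fderiv.differentiable one_ne_zero z).hasFDerivAt.const_smul s).const_sub _
  have h3 := (h1.clm_comp h2).fderiv
  rw [h3]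
  simp only [add_apply, ContinuousLinearMap.comp_apply, ContinuousLinearMap.compL_apply,
    ContinuousLinearMap.flip_apply, neg_apply, smul_apply, sub_apply,
    ContinuousLinearMap.id_apply, map_neg, map_smul, smul_eq_mul]
  ring

lemma norm_shift_le (hu : BddField U u) (hs : 0 ≤ s) (z x : Fin N → ℝ) :
    ‖x - s • fderiv ℝ u z x‖ ≤ (1 + s * U) * ‖x‖ := by
  refine (norm_sub_le _ _).trans ?_
  rw [norm_smul, Real.norm_of_nonneg hs]
  have := (fderiv ℝ u z).le_of_opNorm_le (hu.fderiv_le z) x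
  nlinarith

lemma apply₂_le {E F G : Type*} [NormedAddCommGroup E] [NormedSpace ℝ E] [NormedAddCommGroup F]
    [NormedSpace ℝ F] [NormedAddCommGroup G] [NormedSpace ℝ G] (B : E →L[ℝ] F →L[ℝ] G)
    {a b c : ℝ} {x : E} {y : F} (hB : ‖B‖ ≤ a) (hx : ‖x‖ ≤ b) (hy : ‖y‖ ≤ c) :
    ‖B x y‖ ≤ a * b * c :=
  (B x).le_of_opNorm_le_of_le (B.le_of_opNorm_le_of_le hB hx) hy

lemma BddC2.comp_shift (hu : BddField U u) (hV : BddC2 Q K w) (hs : 0 ≤ s) (hs1 : s ≤ 1) :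
    BddC2 Q (K * (1 + s * (3 * U + U ^ 2))) (fun z => w (z - s • u z)) where
  contDiff := hV.contDiff.comp (contDiff_id.sub (hu.contDiff.const_smul s))
  nonneg z := hV.nonneg _
  le z := hV.le _
  fderiv_le z := by
    have hU := hu.nonneg
    have hK := hV.nonneg_bound
    rw [(hasFDerivAt_comp_shift hu hV s z).fderiv]
    refine ContinuousLinearMap.opNorm_le_bound _ (by positivity) fun x => ?_
    have h1 := (fderiv ℝ w (z - s • u z)).le_of_opNorm_le_of_le (hV.fderiv_le _)
      (norm_shift_le hu hs z x)
    refine h1.trans ?_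
    rw [← mul_assoc]
    gcongr
    nlinarith [mul_nonneg hs hU]
  fderiv2_le z := by
    have hU := hu.nonneg
    have hK := hV.nonneg_bound
    refine ContinuousLinearMap.opNorm_le_bound₂ _ (by positivity) fun x y => ?_
    rw [fderiv2_comp_shift hu hV]
    have h1 := apply₂_le _ (hV.fderiv2_le (z - s • u z)) (norm_shift_le hu hs z x)
      (norm_shift_le hu hs z y)
    have h2 := (fderiv ℝ w (z - s • u z)).le_of_opNorm_le_of_le (hV.fderiv_le _)
      (apply₂_le _ (hu.fderiv2_le z) le_rfl le_rfl : ‖fderiv ℝ (fderiv ℝ u) z x y‖ ≤ _)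
    refine (norm_sub_le _ _).trans ?_
    rw [norm_mul, Real.norm_of_nonneg hs]
    have h3 := mul_le_mul_of_nonneg_left h2 hs
    refine (add_le_add h1 h3).trans ?_
    have e : K * ((1 + s * U) * ‖x‖) * ((1 + s * U) * ‖y‖) + s * (K * (U * ‖x‖ * ‖y‖)) =
      K * (1 + s * (3 * U + s * U ^ 2)) * ‖x‖ * ‖y‖ := by ring
    rw [e]
    have : s * U ^ 2 ≤ U ^ 2 := mul_le_of_le_one_left (sq_nonneg _) hs1
    gcongr

lemma BddC2.smoothStep (hu : BddField U u) (hw : BddC2 Q K w) (hs : 0 ≤ s) (hs1 : s ≤ 1) :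
    BddC2 Q (K * (1 + s * (3 * U + U ^ 2))) (smoothStep u s w) :=
  (hw.heat (√(2 * s))).comp_shift hu hs hs1

lemma exists_hasDerivAt_smoothStep (hu : BddField U u) (hw : BddC2 Q K w) (hs : 0 < s)
    (hs1 : s ≤ 1) (z : Fin N → ℝ) :
    ∃ D, HasDerivAt (fun s => smoothStep u s w z) D s ∧
      |D + ∑ i, u z i * pd i (smoothStep u s w) z - lap (smoothStep u s w) z| ≤
        (N + 1) * (3 * U + U ^ 2) * K * s := by
  have hU := hu.nonneg
  have hK := hw.nonneg_bound
  refine ⟨_, hw.hasDerivAt_heat z (u z) hs, ?_⟩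
  have hV := hw.heat (√(2 * s))
  have hV2 := hw.fderiv2_heat (√(2 * s))
  have hV1 := hw.fderiv_heat (√(2 * s))
  have hv := hw.smoothStep hu hs.le hs1
  set V := heat (√(2 * s)) w with hVdef
  set ζ := z - s • u z with hζ
  rw [← hV2, ← hV1]
  have e1 : ∑ i, u z i * pd i (smoothStep u s w) z =
      fderiv ℝ V ζ (u z) - s * fderiv ℝ V ζ (fderiv ℝ u z (u z)) := by
    have : ∑ i, u z i * pd i (smoothStep u s w) z = fderiv ℝ (smoothStep u s w) z (u z) := by
      conv_rhs => arg 2; rw [pi_eq_sum_univ' (u z)]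
      rw [map_sum]
      refine Finset.sum_congr rfl fun i _ => ?_
      rw [map_smul, smul_eq_mul, pd]
    rw [this, show smoothStep u s w = fun z => V (z - s • u z) from rfl,
      (hasFDerivAt_comp_shift hu hV s z).fderiv]
    simp only [ContinuousLinearMap.comp_apply, sub_apply, smul_apply, map_sub, map_smul,
      ContinuousLinearMap.id_apply, smul_eq_mul, hζ]
  have e2 : lap (smoothStep u s w) z = ∑ i, (fderiv ℝ (fderiv ℝ V) ζ
      (Pi.single i 1 - s • fderiv ℝ u z (Pi.single i 1))
      (Pi.single i 1 - s • fderiv ℝ u z (Pi.single i 1)) -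
        s * fderiv ℝ V ζ (fderiv ℝ (fderiv ℝ u) z (Pi.single i 1) (Pi.single i 1))) := by
    refine Finset.sum_congr rfl fun i _ => ?_
    rw [pd_pd hv.contDiff]
    exact fderiv2_comp_shift hu hV s z _ _
  rw [e1, e2, show ∀ a b d e : ℝ, a - b + (b - d) - e = -d + (a - e) by intros; ring,
    ← Finset.sum_sub_distrib]
  have b1 : |(-(s * fderiv ℝ V ζ (fderiv ℝ u z (u z))))| ≤ s * (K * (U * U)) := by
    rw [abs_neg, abs_mul, abs_of_nonneg hs.le]
    exact mul_le_mul_of_nonneg_left ((fderiv ℝ V ζ).le_of_opNorm_le_of_le (hV.fderiv_le _)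
      ((fderiv ℝ u z).le_of_opNorm_le_of_le (hu.fderiv_le _) (hu.norm_le z))) hs.le
  refine (abs_add_le _ _).trans ((add_le_add b1 (Finset.abs_sum_le_sum_abs _ _)).trans ?_)
  have b2 : ∀ i : Fin N, |fderiv ℝ (fderiv ℝ V) ζ (Pi.single i 1) (Pi.single i 1) -
      (fderiv ℝ (fderiv ℝ V) ζ (Pi.single i 1 - s • fderiv ℝ u z (Pi.single i 1))
      (Pi.single i 1 - s • fderiv ℝ u z (Pi.single i 1)) -
        s * fderiv ℝ V ζ (fderiv ℝ (fderiv ℝ u) z (Pi.single i 1) (Pi.single i 1)))| ≤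
      s * K * (3 * U + U ^ 2) := by
    intro i
    have hn := BddC2.norm_single_one_le i
    set e : Fin N → ℝ := Pi.single i 1
    set d := fderiv ℝ u z e
    have hd : ‖d‖ ≤ U := by
      have := (fderiv ℝ u z).le_of_opNorm_le_of_le (hu.fderiv_le z) hn
      rwa [mul_one] at this
    have hB := hV.fderiv2_le ζ
    set B := fderiv ℝ (fderiv ℝ V) ζ
    have c1 := apply₂_le B hB hd hn
    have c2 := apply₂_le B hB hn hd
    have c3 := apply₂_le B hB hd hd
    have c4 := (fderiv ℝ V ζ).le_of_opNorm_le_of_le (hV.fderiv_le _)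
      (apply₂_le _ (hu.fderiv2_le z) hn hn)
    rw [Real.norm_eq_abs] at c1 c2 c3 c4
    have e3 : B e e - (B (e - s • d) (e - s • d) -
        s * fderiv ℝ V ζ (fderiv ℝ (fderiv ℝ u) z e e)) =
        s * (B d e + B e d - s * B d d + fderiv ℝ V ζ (fderiv ℝ (fderiv ℝ u) z e e)) := by
      simp only [map_sub, map_smul, sub_apply, smul_apply, smul_eq_mul]
      ring
    rw [e3, abs_mul, abs_of_nonneg hs.le, mul_assoc]
    refine mul_le_mul_of_nonneg_left ?_ hs.le
    have c5 : |s * B d d| ≤ K * U * U := by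
      rw [abs_mul, abs_of_nonneg hs.le]
      exact (mul_le_of_le_one_left (abs_nonneg _) hs1).trans c3
    refine (abs_add_le _ _).trans ((add_le_add ((abs_sub _ _).trans (add_le_add
      (abs_add_le _ _) le_rfl)) le_rfl).trans ?_)
    nlinarith
  refine (add_le_add le_rfl (Finset.sum_le_sum fun i _ => b2 i)).trans ?_
  rw [Finset.sum_const, Finset.card_univ, Fintype.card_fin, nsmul_eq_mul]
  have : 0 ≤ s * K * U := by positivity
  nlinarith

lemma continuous_smoothStep (hu : BddField U u) (hw : BddC2 Q K w) :
    Continuous fun p : ℝ × (Fin N → ℝ) => smoothStep u p.1 w p.2 := by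
  have hc := hu.contDiff.continuous
  exact (continuous_heat_uncurry hw.contDiff.continuous hw.norm_le).comp
    (f := fun p : ℝ × (Fin N → ℝ) => (√(2 * p.1), p.2 - p.1 • u p.2)) (by fun_prop)

lemma smoothStep_zero (z : Fin N → ℝ) : smoothStep u 0 w z = w z := by
  simp [smoothStep, heat, integral_mul_const, integral_gauss]

lemma ofReal_smoothStep (hw : BddC2 Q K w) (z : Fin N → ℝ) :
    ENNReal.ofReal (smoothStep u s w z) =
      stepOp (√(2 * s)) (fun z => z - s • u z) (fun z => ENNReal.ofReal (w z)) z := by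
  rw [smoothStep, heat, ofReal_integral_eq_lintegral_ofReal
    (integrable_heat hw.contDiff.continuous hw.norm_le _ _)
    (Filter.Eventually.of_forall fun ξ => smul_nonneg (gauss_pos ξ).le (hw.nonneg _))]
  refine lintegral_congr fun ξ => ?_
  rw [smul_eq_mul, mul_comm, ENNReal.ofReal_mul (hw.nonneg _)]

end

lemma LatPer.smoothStep {m : ℕ} {h : ℝ} {u : (Fin (m + 1) → ℝ) → Fin (m + 1) → ℝ}
    {w : (Fin (m + 1) → ℝ) → ℝ} (hu : LatPer m h u) (hw : LatPer m h w) (s : ℝ) :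
    LatPer m h (smoothStep u s w) := by
  intro g hg z
  rw [_root_.smoothStep, _root_.smoothStep, hu g hg z]
  refine integral_congr_ae (Filter.Eventually.of_forall fun ξ => ?_)
  dsimp only
  rw [show g + z - s • u z - √(2 * s) • ξ = g + (z - s • u z - √(2 * s) • ξ) by abel, hw g hg]

/-! ### A maximum principle on the cylinder -/

lemma deriv_deriv_nonpos_of_isLocalMax {φ : ℝ → ℝ} {x : ℝ} (hm : IsLocalMax φ x)
    (hc : ContinuousAt φ x) : deriv (deriv φ) x ≤ 0 := by
  by_contra! hpos
  have hmin := isLocalMin_of_deriv_deriv_pos hpos hm.deriv_eq_zero hc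
  have hloc : φ =ᶠ[nhds x] fun _ => φ x := by
    filter_upwards [hm, hmin] with y h1 h2 using le_antisymm h1 h2
  rw [hloc.deriv.deriv_eq] at hpos
  simp at hpos

lemma pd_pd_nonpos_of_isLocalMax {N : ℕ} {w : (Fin N → ℝ) → ℝ} {z : Fin N → ℝ}
    (hw : ContDiff ℝ 2 w) (hm : IsLocalMax w z) (i : Fin N) : pd i (pd i w) z ≤ 0 := by
  have hl : ∀ r : ℝ, HasDerivAt (fun r : ℝ => z + r • (Pi.single i 1 : Fin N → ℝ))
      (Pi.single i 1) r := fun r => by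
    have := ((hasDerivAt_id r).smul_const (Pi.single i 1 : Fin N → ℝ)).const_add z
    rwa [one_smul] at this
  have h1 : ContDiff ℝ 1 (pd i w) :=
    (hw.fderiv_right (m := 1) (by norm_num)).clm_apply contDiff_const
  have d1 : deriv (fun r : ℝ => w (z + r • Pi.single i 1)) =
      fun r => pd i w (z + r • Pi.single i 1) := funext fun r =>
    ((hw.differentiable two_ne_zero _).hasFDerivAt.comp_hasDerivAt r (hl r)).deriv
  have d2 : deriv (fun r : ℝ => pd i w (z + r • Pi.single i 1)) 0 =
      pd i (pd i w) (z + (0 : ℝ) • Pi.single i 1) :=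
    ((h1.differentiable one_ne_zero _).hasFDerivAt.comp_hasDerivAt 0 (hl 0)).deriv
  have hc : Continuous fun r : ℝ => z + r • (Pi.single i 1 : Fin N → ℝ) := by fun_prop
  have hm' : IsLocalMax (fun r : ℝ => w (z + r • Pi.single i 1)) 0 := by
    refine IsLocalMax.comp_continuous (f := w) (g := fun r : ℝ => z + r • Pi.single i 1) (b := 0)
      ?_ hc.continuousAt
    simpa using hm
  have := deriv_deriv_nonpos_of_isLocalMax hm' (hw.continuous.comp hc).continuousAt
  rw [d1, d2] at this
  simpa using this

lemma deriv_nonneg_of_le_left {φ : ℝ → ℝ} {s : ℝ} (hs : 0 < s) (hd : DifferentiableAt ℝ φ s)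
    (h : ∀ r ∈ Set.Icc 0 s, φ r ≤ φ s) : 0 ≤ deriv φ s := by
  have h1 := hd.hasDerivAt.hasDerivWithinAt (s := Set.Iio s)
  rw [hasDerivWithinAt_iff_tendsto_slope' (by simp)] at h1
  refine ge_of_tendsto h1 ?_
  filter_upwards [Ioo_mem_nhdsLT hs] with r hr
  rw [slope_def_field]
  exact div_nonneg_of_nonpos (by linarith [h r ⟨hr.1.le, hr.2.le⟩]) (by linarith [hr.2])

lemma exists_lat_mem {m : ℕ} {h : ℝ} (hh : 0 < h) (z : Fin (m + 1) → ℝ) :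
    ∃ g ∈ lat m h, (g + z) 0 = z 0 ∧ ∀ j : Fin m, (g + z) j.succ ∈ Set.Icc 0 h := by
  obtain ⟨g, hg, -⟩ := cell_existsUnique hh z
  refine ⟨g, g.2, ?_, fun j => Set.Ico_subset_Icc_self (hg j)⟩
  rw [Pi.add_apply, g.2.1, zero_add]

/-- A function vanishing initially and far away cannot become positive if it is a strict
subsolution wherever it is positive. -/
lemma nonpos_of_strict_subsolution {m : ℕ} {h : ℝ} (hh : 0 < h) {δ L R : ℝ}
    {u : (Fin (m + 1) → ℝ) → Fin (m + 1) → ℝ} {D : ℝ → (Fin (m + 1) → ℝ) → ℝ}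
    (hc : ContinuousOn (fun p : ℝ × (Fin (m + 1) → ℝ) => D p.1 p.2) (Set.Icc 0 δ ×ˢ Set.univ))
    (hper : ∀ s ∈ Set.Icc 0 δ, LatPer m h (D s))
    (hinit : ∀ z, D 0 z ≤ 0)
    (hfar : ∀ s ∈ Set.Icc 0 δ, ∀ z, R ≤ |z 0| → D s z ≤ 0)
    (hdiff : ∀ s ∈ Set.Ioc 0 δ, ∀ z, DifferentiableAt ℝ (fun r => D r z) s)
    (hC2 : ∀ s ∈ Set.Ioc 0 δ, ContDiff ℝ 2 (D s))
    (hineq : ∀ s ∈ Set.Ioc 0 δ, ∀ z, 0 < D s z →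
      deriv (fun r => D r z) s + ∑ i, u z i * pd i (D s) z - lap (D s) z < L * D s z) :
    ∀ s ∈ Set.Icc 0 δ, ∀ z, D s z ≤ 0 := by
  intro s₁ hs₁ z₁
  by_contra! hpos
  set lo : Fin (m + 1) → ℝ := Fin.cons (-R) fun _ => 0
  set hi : Fin (m + 1) → ℝ := Fin.cons R fun _ => h
  set W : Set (ℝ × (Fin (m + 1) → ℝ)) := Set.Icc 0 δ ×ˢ Set.Icc lo hi
  have hmemW : ∀ s ∈ Set.Icc 0 δ, ∀ z, 0 < D s z → ∃ z', (s, z') ∈ W ∧ D s z' = D s z := by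
    intro s hs z hz
    obtain ⟨g, hg, hg0, hgj⟩ := exists_lat_mem hh z
    have hR : |z 0| < R := by
      by_contra! hcon
      exact absurd (hfar s hs z hcon) (not_le.2 hz)
    rw [abs_lt] at hR
    refine ⟨g + z, ⟨hs, fun i => ?_, fun i => ?_⟩, hper s hs g hg z⟩
    · dsimp only
      refine Fin.cases ?_ (fun j => ?_) i
      · rw [hg0]; exact hR.1.le
      · exact (hgj j).1
    · dsimp only
      refine Fin.cases ?_ (fun j => ?_) i
      · rw [hg0]; exact hR.2.le
      · exact (hgj j).2
  have hW : IsCompact W := isCompact_Icc.prod isCompact_Icc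
  set E : ℝ × (Fin (m + 1) → ℝ) → ℝ := fun p => Real.exp (-(L * p.1)) * D p.1 p.2
  have hE : ContinuousOn E W :=
    (Continuous.continuousOn (by fun_prop)).mul
      (hc.mono (Set.prod_mono le_rfl (Set.subset_univ _)))
  obtain ⟨z₁', hz₁', hDz₁⟩ := hmemW s₁ hs₁ z₁ hpos
  obtain ⟨⟨s, z⟩, ⟨hs, hz⟩, hmax⟩ := hW.exists_isMaxOn ⟨_, hz₁'⟩ hE
  have hglob : ∀ r ∈ Set.Icc 0 δ, ∀ y, E (r, y) ≤ E (s, z) := by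
    have hEpos : 0 < E (s, z) := by
      refine lt_of_lt_of_le ?_ (hmax hz₁')
      exact mul_pos (Real.exp_pos _) (by rw [hDz₁]; exact hpos)
    intro r hr y
    by_cases hy : 0 < D r y
    · obtain ⟨y', hy', e⟩ := hmemW r hr y hy
      refine le_trans (le_of_eq ?_) (hmax hy')
      simp only [E, e]
    · exact (mul_nonpos_of_nonneg_of_nonpos (Real.exp_pos _).le (not_lt.1 hy)).trans hEpos.le
  have hDpos : 0 < D s z := by
    refine pos_of_mul_pos_right ?_ (Real.exp_pos (-(L * s))).le
    refine lt_of_lt_of_le ?_ (hglob s₁ hs₁ z₁)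
    exact mul_pos (Real.exp_pos _) hpos
  have hs0 : s ≠ 0 := by
    rintro rfl
    exact absurd (hinit z) (not_le.2 hDpos)
  have hs' : s ∈ Set.Ioc 0 δ := ⟨lt_of_le_of_ne hs.1 hs0.symm, hs.2⟩
  have hmz : IsLocalMax (D s) z := Filter.Eventually.of_forall fun y =>
    le_of_mul_le_mul_left (hglob s hs y) (Real.exp_pos _)
  have hgrad : ∑ i, u z i * pd i (D s) z = 0 :=
    Finset.sum_eq_zero fun i _ => by rw [pd, hmz.fderiv_eq_zero]; simp
  have hlap : lap (D s) z ≤ 0 :=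
    Finset.sum_nonpos fun i _ => pd_pd_nonpos_of_isLocalMax (hC2 s hs') hmz i
  have hder : HasDerivAt (fun r => E (r, z)) (Real.exp (-(L * s)) * -L * D s z +
      Real.exp (-(L * s)) * deriv (fun r => D r z) s) s := by
    have h1 : HasDerivAt (fun r : ℝ => Real.exp (-(L * r))) (Real.exp (-(L * s)) * -L) s := by
      have := (((hasDerivAt_id s).const_mul L).neg).exp
      simpa using this
    exact h1.mul (hdiff s hs' z).hasDerivAt
  have htime := deriv_nonneg_of_le_left hs'.1 hder.differentiableAt
    fun r hr => hglob r ⟨hr.1, hr.2.trans hs.2⟩ z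
  rw [hder.deriv, mul_assoc, ← mul_add] at htime
  have := nonneg_of_mul_nonneg_right htime (Real.exp_pos _)
  have := hineq s hs' z hDpos
  linarith

/-! ### Comparison with the splitting scheme over one step -/

section PartialDerivatives

variable {N : ℕ} {a b c : (Fin N → ℝ) → ℝ}

lemma pd_sub_mul_add (ha : Differentiable ℝ a) (hb : Differentiable ℝ b)
    (hc : Differentiable ℝ c) (γ : ℝ) (i : Fin N) :
    pd i (fun z => a z - (γ * b z + c z)) = fun z => pd i a z - (γ * pd i b z + pd i c z) := by
  funext z
  have := ((ha z).hasFDerivAt.sub (((hb z).hasFDerivAt.const_mul γ).add (hc z).hasFDerivAt))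
  rw [pd, show fderiv ℝ (fun z => a z - (γ * b z + c z)) z = _ from this.fderiv]
  rfl

lemma lap_sub_mul_add (ha : ContDiff ℝ 2 a) (hb : ContDiff ℝ 2 b) (hc : ContDiff ℝ 2 c)
    (γ : ℝ) (z : Fin N → ℝ) :
    lap (fun z => a z - (γ * b z + c z)) z = lap a z - (γ * lap b z + lap c z) := by
  have hd : ∀ {w : (Fin N → ℝ) → ℝ}, ContDiff ℝ 2 w → ∀ i, Differentiable ℝ (pd i w) :=
    fun hw i => ((hw.fderiv_right (m := 1) (by norm_num)).clm_apply contDiff_const).differentiable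
      one_ne_zero
  simp only [lap]
  rw [Finset.mul_sum, ← Finset.sum_add_distrib, ← Finset.sum_sub_distrib]
  refine Finset.sum_congr rfl fun i _ => ?_
  rw [pd_sub_mul_add (ha.differentiable two_ne_zero) (hb.differentiable two_ne_zero)
    (hc.differentiable two_ne_zero), pd_sub_mul_add (hd ha i) (hd hb i) (hd hc i)]

end PartialDerivatives

/-- The barrier absorbing all errors; it grows at both ends of the cylinder. -/
def barrier {m : ℕ} (E β ρ : ℝ) (z : Fin (m + 1) → ℝ) : ℝ := E * (β * Real.cosh (z 0) + ρ)

lemma contDiff_barrier {m : ℕ} (E β ρ : ℝ) :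
    ContDiff ℝ 2 (barrier E β ρ : (Fin (m + 1) → ℝ) → ℝ) :=
  contDiff_const.mul ((contDiff_const.mul (Real.contDiff_cosh.comp (contDiff_apply ℝ ℝ 0))).add
    contDiff_const)

lemma le_barrier {m : ℕ} {E β ρ : ℝ} (hE : 1 ≤ E) (hβ : 0 ≤ β) (hρ : 0 ≤ ρ)
    (z : Fin (m + 1) → ℝ) : β * Real.cosh (z 0) + ρ ≤ barrier E β ρ z :=
  le_mul_of_one_le_left (add_nonneg (mul_nonneg hβ (Real.cosh_pos _).le) hρ) hE

lemma latPer_barrier {m : ℕ} (h E β ρ : ℝ) :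
    LatPer m h (barrier E β ρ : (Fin (m + 1) → ℝ) → ℝ) := by
  intro g hg z
  rw [barrier, barrier, Pi.add_apply, hg.1, zero_add]

lemma pd_zero_comp_coord {m : ℕ} {φ φ' : ℝ → ℝ} (hφ : ∀ x, HasDerivAt φ (φ' x) x)
    (i : Fin (m + 1)) :
    pd i (fun z : Fin (m + 1) → ℝ => φ (z 0)) = fun z => if i = 0 then φ' (z 0) else 0 := by
  funext z
  have h1 := (hφ (z 0)).hasFDerivAt.comp z
    ((ContinuousLinearMap.proj 0 : (Fin (m + 1) → ℝ) →L[ℝ] ℝ).hasFDerivAt (x := z))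
  rw [pd, show fderiv ℝ (fun z : Fin (m + 1) → ℝ => φ (z 0)) z = _ from h1.fderiv]
  simp [Pi.single_apply, eq_comm]

lemma barrier_advection_diffusion {m : ℕ} {E β ρ U : ℝ} {u : (Fin (m + 1) → ℝ) → Fin (m + 1) → ℝ}
    (hE : 0 ≤ E) (hβ : 0 ≤ β) (hρ : 0 ≤ ρ) (z : Fin (m + 1) → ℝ) (hu : ‖u z‖ ≤ U) :
    -((U + 1) * barrier E β ρ z) ≤
      ∑ i, u z i * pd i (barrier E β ρ) z - lap (barrier E β ρ) z := by
  have h1 : ∀ i : Fin (m + 1), pd i (barrier E β ρ) =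
      fun z => if i = 0 then E * (β * Real.sinh (z 0)) else 0 := fun i =>
    pd_zero_comp_coord (φ := fun x => E * (β * Real.cosh x + ρ))
      (fun x => (((Real.hasDerivAt_cosh x).const_mul β).add_const ρ).const_mul E) i
  have e1 : ∑ i, u z i * pd i (barrier E β ρ) z = u z 0 * (E * (β * Real.sinh (z 0))) := by
    simp [h1]
  have e2 : lap (barrier E β ρ) z = E * (β * Real.cosh (z 0)) := by
    rw [lap, Finset.sum_eq_single 0]
    · rw [h1]
      simp only [if_true]
      rw [pd_zero_comp_coord (φ := fun x => E * (β * Real.sinh x))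
        (fun x => ((Real.hasDerivAt_sinh x).const_mul β).const_mul E)]
      simp
    · intro i _ hi
      rw [h1]
      simp [hi, pd]
    · simp
  have hU : 0 ≤ U := (norm_nonneg _).trans hu
  rw [e1, e2, barrier]
  have h2 : |u z 0| ≤ U := (norm_le_pi_norm (u z) 0).trans hu
  have h3 : |Real.sinh (z 0)| ≤ Real.cosh (z 0) := by
    rw [Real.abs_sinh, ← Real.cosh_abs]; exact (Real.sinh_lt_cosh _).le
  have h4 : |u z 0 * (E * (β * Real.sinh (z 0)))| ≤ U * (E * (β * Real.cosh (z 0))) := by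
    rw [abs_mul, abs_mul, abs_mul, abs_of_nonneg hE, abs_of_nonneg hβ]
    gcongr
  have h5 := neg_le_of_abs_le h4
  have h6 : 0 ≤ (U + 1) * (E * ρ) := by positivity
  linarith

lemma exists_one_le_mul_cosh {β : ℝ} (hβ : 0 < β) : ∃ R, ∀ x : ℝ, R ≤ |x| → 1 ≤ β * Real.cosh x := by
  refine ⟨2 / β, fun x hx => ?_⟩
  have h1 : 2 / β ≤ 2 * Real.cosh x := by
    rw [← Real.cosh_abs, Real.cosh_eq]
    have := Real.add_one_le_exp |x|
    have := Real.exp_pos (-|x|)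
    linarith
  rw [div_le_iff₀ hβ] at h1
  linarith

lemma IsCylSol.latPer {m : ℕ} {h M : ℝ} {u : (Fin (m + 1) → ℝ) → Fin (m + 1) → ℝ} {f : ℝ → ℝ}
    {T0 : (Fin (m + 1) → ℝ) → ℝ} {T : ℝ → (Fin (m + 1) → ℝ) → ℝ}
    (hT : IsCylSol m h M u f T0 T) {t : ℝ} (ht : 0 ≤ t) : LatPer m h (T t) :=
  latPer_of_single fun z j => hT.periodic t z ht j

lemma IsCylSol.le_step {m : ℕ} {h M U Q K L k β ρ t₀ δ : ℝ}
    {u : (Fin (m + 1) → ℝ) → Fin (m + 1) → ℝ} {f : ℝ → ℝ}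
    {T0 : (Fin (m + 1) → ℝ) → ℝ} {T : ℝ → (Fin (m + 1) → ℝ) → ℝ} {g g' : ℝ → ℝ}
    {w : (Fin (m + 1) → ℝ) → ℝ} (hT : IsCylSol m h M u f T0 T) (hh : 0 < h) (hM : 0 < M)
    (hu : BddField U u) (huper : LatPer m h u)
    (hL0 : 0 ≤ L) (hL : ∀ x ∈ Set.Icc (0 : ℝ) 1, ∀ y ∈ Set.Icc x 1, f y ≤ f x + L * (y - x))
    (hg : ∀ t, 0 ≤ t → HasDerivAt g (g' t) t) (hg0 : ∀ t, 0 ≤ g t) (hg1 : ∀ t, 0 ≤ t → g t ≤ 1)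
    (hw : BddC2 Q K w) (hwper : LatPer m h w) (ht₀ : 0 ≤ t₀) (hδ1 : δ ≤ 1)
    (hk : k = U + 2 + M * L) (hβ : 0 < β) (hρ : 0 < ρ)
    (hres : (m + 2) * (3 * U + U ^ 2) * K * δ < ρ)
    (hreact : ∀ s ∈ Set.Ioc 0 δ, ∀ z, g (t₀ + s) * smoothStep u s w z ≤ 1 →
      M * f (g (t₀ + s) * smoothStep u s w z) ≤ g' (t₀ + s) * smoothStep u s w z)
    (hinit : ∀ z, T t₀ z ≤ g t₀ * w z + barrier (Real.exp (k * t₀)) β ρ z) :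
    ∀ s ∈ Set.Icc 0 δ, ∀ z, T (t₀ + s) z ≤
      g (t₀ + s) * smoothStep u s w z + barrier (Real.exp (k * (t₀ + s))) β ρ z := by
  have hU := hu.nonneg
  have hK := hw.nonneg_bound
  have hk0 : 0 ≤ k := by rw [hk]; positivity
  have hE : ∀ s, 0 ≤ s → 1 ≤ Real.exp (k * (t₀ + s)) := fun s hs =>
    Real.one_le_exp (by positivity)
  obtain ⟨R, hR⟩ := exists_one_le_mul_cosh hβ
  have hv : ∀ s ∈ Set.Icc 0 δ, BddC2 Q (K * (1 + s * (3 * U + U ^ 2))) (smoothStep u s w) :=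
    fun s hs => hw.smoothStep hu hs.1 (hs.2.trans hδ1)
  set D : ℝ → (Fin (m + 1) → ℝ) → ℝ := fun s z => T (t₀ + s) z -
    (g (t₀ + s) * smoothStep u s w z + barrier (Real.exp (k * (t₀ + s))) β ρ z) with hD
  have hS0 : ∀ s ∈ Set.Icc 0 δ, ∀ z, 0 ≤ g (t₀ + s) * smoothStep u s w z :=
    fun s hs z => mul_nonneg (hg0 _) ((hv s hs).nonneg z)
  have hB : ∀ s, 0 ≤ s → ∀ z : Fin (m + 1) → ℝ,
      β * Real.cosh (z 0) + ρ ≤ barrier (Real.exp (k * (t₀ + s))) β ρ z :=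
    fun s hs z => le_barrier (hE s hs) hβ.le hρ.le z
  suffices H : ∀ s ∈ Set.Icc 0 δ, ∀ z, D s z ≤ 0 from fun s hs z => by
    have := H s hs z
    simp only [hD] at this
    linarith
  refine nonpos_of_strict_subsolution hh (L := M * L) (R := R) (u := u) ?_ ?_ ?_ ?_ ?_ ?_ ?_
  · refine ContinuousOn.sub ?_ (ContinuousOn.add (ContinuousOn.mul ?_ ?_) ?_)
    · exact hT.cont.comp (f := fun p : ℝ × (Fin (m + 1) → ℝ) => (t₀ + p.1, p.2))
        (Continuous.continuousOn (by fun_prop)) fun p hp => add_nonneg ht₀ hp.1.1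
    · have hgc : ContinuousOn g (Set.Ici 0) := fun t ht =>
        (hg t ht).continuousAt.continuousWithinAt
      exact hgc.comp (f := fun p : ℝ × (Fin (m + 1) → ℝ) => t₀ + p.1)
        (Continuous.continuousOn (by fun_prop)) fun p hp => add_nonneg ht₀ hp.1.1
    · exact (continuous_smoothStep hu hw).continuousOn
    · refine Continuous.continuousOn ?_
      unfold barrier
      have := Real.continuous_cosh
      fun_prop
  · intro s hs z hz y
    have h1 := hT.latPer (add_nonneg ht₀ hs.1) z hz y
    have h2 := LatPer.smoothStep huper hwper s z hz y
    have h3 := latPer_barrier h (Real.exp (k * (t₀ + s))) β ρ z hz y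
    simp only [hD, h1, h2, h3]
  · intro z
    simpa [hD, smoothStep_zero] using hinit z
  · intro s hs z hz
    have h1 := hR _ hz
    have h2 := (hT.mem_Icc (t₀ + s) z (add_nonneg ht₀ hs.1)).2
    have h3 := hB s hs.1 z
    have h4 := hS0 s hs z
    simp only [hD]
    linarith
  · intro s hs z
    obtain ⟨d, hd, -⟩ := exists_hasDerivAt_smoothStep hu hw hs.1 (hs.2.trans hδ1) z
    have ht : 0 < t₀ + s := add_pos_of_nonneg_of_pos ht₀ hs.1
    have hsh : HasDerivAt (fun r => t₀ + r) 1 s := (hasDerivAt_id s).const_add t₀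
    refine DifferentiableAt.sub ?_ (DifferentiableAt.add (DifferentiableAt.mul ?_ ?_) ?_)
    · exact (hT.timeDiff _ z ht).comp s hsh.differentiableAt
    · exact (hg _ ht.le).differentiableAt.comp s hsh.differentiableAt
    · exact hd.differentiableAt
    · unfold barrier; fun_prop
  · intro s hs
    have ht : 0 < t₀ + s := add_pos_of_nonneg_of_pos ht₀ hs.1
    exact (hT.spaceC2 _ ht).sub ((contDiff_const.mul (hv s ⟨hs.1.le, hs.2⟩).contDiff).add
      (contDiff_barrier _ _ _))
  · intro s hs z hpos
    have hs' : s ∈ Set.Icc 0 δ := ⟨hs.1.le, hs.2⟩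
    obtain ⟨d, hd, hdr⟩ := exists_hasDerivAt_smoothStep hu hw hs.1 (hs.2.trans hδ1) z
    have ht : 0 < t₀ + s := add_pos_of_nonneg_of_pos ht₀ hs.1
    have hsh : HasDerivAt (fun r => t₀ + r) 1 s := (hasDerivAt_id s).const_add t₀
    have d1 : HasDerivAt (fun r => T (t₀ + r) z) (deriv (fun r => T r z) (t₀ + s)) s := by
      have := (hT.timeDiff _ z ht).hasDerivAt.comp s hsh
      rwa [mul_one] at this
    have d2 : HasDerivAt (fun r => g (t₀ + r)) (g' (t₀ + s)) s := by
      have := (hg _ ht.le).comp s hsh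
      rwa [mul_one] at this
    have d3 : HasDerivAt (fun r => barrier (Real.exp (k * (t₀ + r))) β ρ z)
        (k * barrier (Real.exp (k * (t₀ + s))) β ρ z) s := by
      have := ((hsh.const_mul k).exp).mul_const (β * Real.cosh (z 0) + ρ)
      refine this.congr_deriv ?_
      rw [barrier]; ring
    have d4 := (d1.sub ((d2.mul hd).add d3)).deriv
    have hv2 := (hv s hs').contDiff
    have hb2 := contDiff_barrier (m := m) (Real.exp (k * (t₀ + s))) β ρ
    have hT2 := hT.spaceC2 _ ht
    have l1 := lap_sub_mul_add hT2 hv2 hb2 (g (t₀ + s)) z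
    have l2 : ∀ i, pd i (D s) z = _ := fun i => congrFun (pd_sub_mul_add
      (hT2.differentiable two_ne_zero) (hv2.differentiable two_ne_zero)
      (hb2.differentiable two_ne_zero) (g (t₀ + s)) i) z
    have l3 : ∑ i, u z i * pd i (D s) z = ∑ i, u z i * pd i (T (t₀ + s)) z -
        (g (t₀ + s) * ∑ i, u z i * pd i (smoothStep u s w) z +
          ∑ i, u z i * pd i (barrier (Real.exp (k * (t₀ + s))) β ρ) z) := by
      rw [Finset.mul_sum, ← Finset.sum_add_distrib, ← Finset.sum_sub_distrib]
      refine Finset.sum_congr rfl fun i _ => ?_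
      rw [l2]; ring
    rw [show deriv (fun r => D r z) s = _ from d4, l3, show lap (D s) z = _ from l1]
    have heq := hT.eqn _ z ht
    have hbar := barrier_advection_diffusion (u := u) (Real.exp_pos (k * (t₀ + s))).le hβ.le hρ.le
      z (hu.norm_le z)
    have hT1 := hT.mem_Icc _ z ht.le
    have hBz := hB s hs'.1 z
    have hSz := hS0 s hs' z
    have hr := hreact s hs z
    have hgs0 := hg0 (t₀ + s)
    have hgs1 := hg1 (t₀ + s) ht.le
    have hcosh : 0 < β * Real.cosh (z 0) := mul_pos hβ (Real.cosh_pos _)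
    have hDe : D s z = T (t₀ + s) z - (g (t₀ + s) * smoothStep u s w z +
      barrier (Real.exp (k * (t₀ + s))) β ρ z) := rfl
    rw [hDe] at hpos ⊢
    generalize T (t₀ + s) z = τ at *
    generalize barrier (Real.exp (k * (t₀ + s))) β ρ z = B at *
    set y := smoothStep u s w z
    have hf1 := hL (g (t₀ + s) * y + B) ⟨by linarith, by linarith [hT1.2]⟩ τ
      ⟨by linarith, hT1.2⟩
    have hf2 := hL (g (t₀ + s) * y) ⟨hSz, by linarith [hT1.2]⟩ (g (t₀ + s) * y + B)
      ⟨by linarith, by linarith [hT1.2]⟩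
    have hr' := hr (by linarith [hT1.2])
    have hf3 := mul_le_mul_of_nonneg_left (hf1.trans (add_le_add hf2 le_rfl)) hM.le
    have hres' : (((m + 1 : ℕ) : ℝ) + 1) * (3 * U + U ^ 2) * K * s < ρ := by
      refine lt_of_le_of_lt ?_ hres
      have : ((m + 1 : ℕ) : ℝ) + 1 = m + 2 := by push_cast; ring
      rw [this]
      exact mul_le_mul_of_nonneg_left hs.2 (by positivity)
    have hres2 : -(g (t₀ + s) * (d + ∑ i, u z i * pd i (smoothStep u s w) z -
        lap (smoothStep u s w) z)) < B := by
      refine lt_of_le_of_lt (neg_le_abs _) ?_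
      rw [abs_mul, abs_of_nonneg hgs0]
      have := mul_le_of_le_one_left (abs_nonneg (d + ∑ i, u z i * pd i (smoothStep u s w) z -
        lap (smoothStep u s w) z)) hgs1
      linarith
    subst hk
    linarith

lemma exists_norm_le_of_periodic {N : ℕ} {h : ℝ} (hh : 0 < h) {E : Type*} [NormedAddCommGroup E]
    {G : (Fin N → ℝ) → E} (hG : Continuous G) (hper : ∀ z i, G (z + Pi.single i h) = G z) :
    ∃ U, ∀ z, ‖G z‖ ≤ U := by
  let P : AddSubgroup (Fin N → ℝ) :=
    { carrier := {g | ∀ z, G (z + g) = G z}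
      zero_mem' := fun z => by simp
      add_mem' := fun {a b} ha hb z => by rw [← add_assoc, hb, ha]
      neg_mem' := fun {a} ha z => by rw [← ha (z + -a), neg_add_cancel_right] }
  obtain ⟨U, hU⟩ := (isCompact_Icc (a := (0 : Fin N → ℝ)) (b := fun _ => h)).exists_bound_of_continuousOn
    hG.continuousOn
  refine ⟨U, fun z => ?_⟩
  choose k hk _ using fun i => existsUnique_add_zsmul_mem_Ico hh (z i) 0
  have hP : (∑ i, k i • (Pi.single i h : Fin N → ℝ)) ∈ P :=
    sum_mem fun i _ => zsmul_mem (show _ ∈ P from fun z => hper z i) _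
  rw [← hP z]
  have hi : ∀ i, (z + ∑ i, k i • (Pi.single i h : Fin N → ℝ)) i = z i + k i • h := fun i => by
    simp [Finset.sum_apply, Pi.single_apply]
  refine hU _ ⟨fun i => ?_, fun i => ?_⟩
  · rw [hi]; exact (hk i).1
  · rw [hi]; simpa using (hk i).2.le

lemma exists_bddField {N : ℕ} {h : ℝ} (hh : 0 < h) {u : (Fin N → ℝ) → Fin N → ℝ}
    (hu : ContDiff ℝ 2 u) (hper : ∀ z i, u (z + Pi.single i h) = u z) : ∃ U, BddField U u := by
  have hper1 : ∀ z i, fderiv ℝ u (z + Pi.single i h) = fderiv ℝ u z := fun z i => by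
    rw [← fderiv_comp_add_right]
    exact congrArg (fderiv ℝ · z) (funext fun z => hper z i)
  have hper2 : ∀ z i, fderiv ℝ (fderiv ℝ u) (z + Pi.single i h) = fderiv ℝ (fderiv ℝ u) z :=
    fun z i => by
      rw [← fderiv_comp_add_right]
      exact congrArg (fderiv ℝ · z) (funext fun z => hper1 z i)
  have hu1 : ContDiff ℝ 1 (fderiv ℝ u) := hu.fderiv_right (by norm_num)
  obtain ⟨A, hA⟩ := exists_norm_le_of_periodic hh hu.continuous hper
  obtain ⟨B, hB⟩ := exists_norm_le_of_periodic hh hu1.continuous hper1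
  obtain ⟨C, hC⟩ := exists_norm_le_of_periodic hh (hu1.continuous_fderiv (by norm_num)) hper2
  exact ⟨max A (max B C), hu, fun z => (hA z).trans (le_max_left _ _),
    fun z => (hB z).trans ((le_max_left _ _).trans (le_max_right _ _)),
    fun z => (hC z).trans ((le_max_right _ _).trans (le_max_right _ _))⟩

section Mollify

open scoped Convolution

variable {N : ℕ} {E F : Type*} [NormedAddCommGroup E] [NormedSpace ℝ E]
  [NormedAddCommGroup F] [NormedSpace ℝ F]

lemma exists_norm_convolution_le {ψ : (Fin N → ℝ) → E} {g : (Fin N → ℝ) → ℝ} (B : E →L[ℝ] ℝ →L[ℝ] F)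
    (hψ : Integrable ψ) (hg : ∀ z, ‖g z‖ ≤ 1) :
    ∃ K, ∀ z, ‖(ψ ⋆[B] g) z‖ ≤ K := by
  refine ⟨‖B‖ * ∫ t, ‖ψ t‖, fun z => ?_⟩
  rw [← integral_const_mul]
  refine norm_integral_le_of_norm_le (hψ.norm.const_mul _) (ae_of_all _ fun t => ?_)
  refine (B.le_opNorm₂ _ _).trans ?_
  exact mul_le_of_le_one_right (by positivity) (hg _)

lemma integrable_fderiv_of_hasCompactSupport {ψ : (Fin N → ℝ) → E} (hψ : ContDiff ℝ 1 ψ)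
    (hc : HasCompactSupport ψ) : Integrable (fderiv ℝ ψ) :=
  (hψ.continuous_fderiv (by norm_num)).integrable_of_hasCompactSupport (hc.fderiv (𝕜 := ℝ))

/-- Convolution with a smooth bump yields bounded derivatives up to second order. -/
lemma bddC2_convolution {ψ g : (Fin N → ℝ) → ℝ} (hψ : ContDiff ℝ 2 ψ)
    (hψc : HasCompactSupport ψ) (hψ0 : ∀ z, 0 ≤ ψ z) (hψ1 : ∫ z, ψ z = 1)
    (hg : Continuous g) (hg01 : ∀ z, g z ∈ Set.Icc (0 : ℝ) 1) :
    ∃ K, BddC2 1 K (ψ ⋆[ContinuousLinearMap.lsmul ℝ ℝ] g) := by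
  have hgn : ∀ z, ‖g z‖ ≤ 1 := fun z => by
    rw [Real.norm_of_nonneg (hg01 z).1]; exact (hg01 z).2
  have hψ' : ContDiff ℝ 1 (fderiv ℝ ψ) := hψ.fderiv_right (by norm_num)
  have h1 := fun z => hψc.hasFDerivAt_convolution_left (ContinuousLinearMap.lsmul ℝ ℝ)
    (hψ.of_le (by norm_num)) (hg.locallyIntegrable (μ := volume)) z
  have e1 := funext fun z => (h1 z).fderiv
  have h2 := fun z => (hψc.fderiv (𝕜 := ℝ)).hasFDerivAt_convolution_left
    ((ContinuousLinearMap.lsmul ℝ ℝ : ℝ →L[ℝ] ℝ →L[ℝ] ℝ).precompL (Fin N → ℝ))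
    hψ' (hg.locallyIntegrable (μ := volume)) z
  have e2 := funext fun z => (h2 z).fderiv
  have i1 := integrable_fderiv_of_hasCompactSupport (hψ.of_le (by norm_num)) hψc
  have i2 := integrable_fderiv_of_hasCompactSupport hψ' (hψc.fderiv (𝕜 := ℝ))
  have i0 : Integrable ψ := hψ.continuous.integrable_of_hasCompactSupport hψc
  obtain ⟨K₁, hK₁⟩ : ∃ K, ∀ z, ‖fderiv ℝ (ψ ⋆[ContinuousLinearMap.lsmul ℝ ℝ] g) z‖ ≤ K := by
    rw [e1]
    exact exists_norm_convolution_le _ i1 hgn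
  obtain ⟨K₂, hK₂⟩ :
      ∃ K, ∀ z, ‖fderiv ℝ (fderiv ℝ (ψ ⋆[ContinuousLinearMap.lsmul ℝ ℝ] g)) z‖ ≤ K := by
    rw [e1, e2]
    exact exists_norm_convolution_le _ i2 hgn
  refine ⟨max K₁ K₂, hψc.contDiff_convolution_left _ hψ hg.locallyIntegrable, fun z => ?_,
    fun z => ?_, fun z => ?_, fun z => ?_⟩
  · exact integral_nonneg fun t => mul_nonneg (hψ0 t) (hg01 _).1
  · rw [← hψ1]
    refine integral_mono_of_nonneg (ae_of_all _ fun t => mul_nonneg (hψ0 t) (hg01 _).1) i0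
      (ae_of_all _ fun t => ?_)
    exact mul_le_of_le_one_right (hψ0 t) (hg01 _).2
  · exact (hK₁ z).trans (le_max_left _ _)
  · exact (hK₂ z).trans (le_max_right _ _)

end Mollify

lemma lintegral_convolution_cell_le {m : ℕ} {h : ℝ} (hh : 0 < h) {ψ g : (Fin (m + 1) → ℝ) → ℝ}
    (hψ : Continuous ψ) (hψi : Integrable ψ) (hψ0 : ∀ z, 0 ≤ ψ z) (hψ1 : ∫ z, ψ z = 1)
    (hg : Continuous g) (hgper : LatPer m h g) (hg0 : ∀ z, 0 ≤ g z) :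
    ∫⁻ z in cylCell m h, ENNReal.ofReal (convolution ψ g (ContinuousLinearMap.lsmul ℝ ℝ) volume z)
      ≤ ∫⁻ z in cylCell m h, ENNReal.ofReal (g z) := by
  have hper : LatPer m h fun z => ENNReal.ofReal (g z) := fun a ha z => by
    simp only [hgper a ha z]
  have hmeas : Measurable fun p : (Fin (m + 1) → ℝ) × (Fin (m + 1) → ℝ) =>
      ENNReal.ofReal (ψ p.2) * ENNReal.ofReal (g (p.1 - p.2)) := by
    have := hψ.measurable
    have := hg.measurable
    fun_prop
  calc _ ≤ ∫⁻ z in cylCell m h, ∫⁻ t, ENNReal.ofReal (ψ t) * ENNReal.ofReal (g (z - t)) := by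
        refine lintegral_mono fun z => ?_
        refine (ENNReal.ofReal_le_ofReal (le_abs_self _)).trans ?_
        rw [← Real.enorm_eq_ofReal_abs]
        refine (enorm_integral_le_lintegral_enorm _).trans_eq (lintegral_congr fun t => ?_)
        rw [ContinuousLinearMap.lsmul_apply, enorm_smul, Real.enorm_of_nonneg (hψ0 t),
          Real.enorm_of_nonneg (hg0 _)]
    _ = ∫⁻ t, ENNReal.ofReal (ψ t) * ∫⁻ z in cylCell m h, ENNReal.ofReal (g (z - t)) := by
        rw [lintegral_lintegral_swap hmeas.aemeasurable]
        exact lintegral_congr fun t => lintegral_const_mul _ (by have := hg.measurable; fun_prop)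
    _ = ∫⁻ t, ENNReal.ofReal (ψ t) * ∫⁻ z in cylCell m h, ENNReal.ofReal (g z) := by
        refine lintegral_congr fun t => ?_
        simp_rw [sub_eq_add_neg]
        rw [setLIntegral_cell_add hh hper]
    _ = _ := by
        rw [lintegral_mul_const _ (by have := hψ.measurable; fun_prop),
          ← ofReal_integral_eq_lintegral_ofReal hψi (ae_of_all _ hψ0), hψ1, ENNReal.ofReal_one,
          one_mul]

/-- Uniform continuity on the bounded part of the cylinder. -/
lemma exists_uniform_dist_le {m : ℕ} {h : ℝ} (hh : 0 < h) {g : (Fin (m + 1) → ℝ) → ℝ}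
    (hg : Continuous g) (hgper : LatPer m h g) (R : ℝ) {ρ : ℝ} (hρ : 0 < ρ) :
    ∃ r > 0, ∀ z, |z 0| < R → ∀ x, dist x z < r → dist (g x) (g z) ≤ ρ := by
  set lo : Fin (m + 1) → ℝ := Fin.cons (-R) fun _ => 0
  set hi : Fin (m + 1) → ℝ := Fin.cons R fun _ => h
  have hu := (isCompact_Icc (a := lo) (b := hi)).uniformContinuousAt_of_continuousAt g
    (fun x _ => hg.continuousAt) (Metric.dist_mem_uniformity hρ)
  obtain ⟨r, hr, H⟩ := Metric.mem_uniformity_dist.1 hu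
  refine ⟨r, hr, fun z hz x hx => ?_⟩
  obtain ⟨a, ha, ha0, haj⟩ := exists_lat_mem hh z
  rw [abs_lt] at hz
  rw [← hgper a ha z, ← hgper a ha x, dist_comm]
  refine (H (a := a + z) (b := a + x) (by rwa [dist_add_left, dist_comm]) ⟨fun i => ?_, fun i => ?_⟩).le
  · refine Fin.cases ?_ (fun j => ?_) i
    · dsimp only; rw [ha0]; exact hz.1.le
    · exact (haj j).1
  · refine Fin.cases ?_ (fun j => ?_) i
    · dsimp only; rw [ha0]; exact hz.2.le
    · exact (haj j).2

lemma exists_mollify {m : ℕ} {h : ℝ} (hh : 0 < h) {g : (Fin (m + 1) → ℝ) → ℝ}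
    (hg : Continuous g) (hgper : LatPer m h g) (hg01 : ∀ z, g z ∈ Set.Icc (0 : ℝ) 1)
    {β ρ : ℝ} (hβ : 0 < β) (hρ : 0 < ρ) :
    ∃ K φ, BddC2 1 K φ ∧ LatPer m h φ ∧
      ∫⁻ z in cylCell m h, ENNReal.ofReal (φ z) ≤ ∫⁻ z in cylCell m h, ENNReal.ofReal (g z) ∧
      ∀ z, g z ≤ φ z + (β * Real.cosh (z 0) + ρ) := by
  obtain ⟨R, hR⟩ := exists_one_le_mul_cosh hβ
  obtain ⟨r, hr, H⟩ := exists_uniform_dist_le hh hg hgper R hρ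
  let b : ContDiffBump (0 : Fin (m + 1) → ℝ) := ⟨r / 2, r, by positivity, by linarith⟩
  obtain ⟨K, hK⟩ := bddC2_convolution (ψ := b.normed volume) b.contDiff_normed
    b.hasCompactSupport_normed b.nonneg_normed b.integral_normed hg hg01
  refine ⟨K, _, hK, fun a ha z => ?_, lintegral_convolution_cell_le hh b.continuous_normed
    b.integrable_normed b.nonneg_normed b.integral_normed hg hgper fun z => (hg01 z).1, fun z => ?_⟩
  · refine integral_congr_ae (ae_of_all _ fun t => ?_)
    dsimp only
    rw [add_sub_assoc, hgper a ha]
  · have hc : 0 ≤ β * Real.cosh (z 0) := by positivity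
    have h0 := hK.nonneg z
    by_cases hz : |z 0| < R
    · have := b.dist_normed_convolution_le hg.aestronglyMeasurable (x₀ := z) (μ := volume)
        fun x hx => H z hz x (Metric.mem_ball.1 hx)
      rw [Real.dist_eq, abs_le] at this
      linarith [this.1]
    · linarith [hR _ (not_lt.1 hz), (hg01 z).2]

section

variable {N : ℕ} {U Q K δ : ℝ} {u : (Fin N → ℝ) → Fin N → ℝ} {w : (Fin N → ℝ) → ℝ}

lemma norm_fderiv_const_smul_le {E F : Type*} [NormedAddCommGroup E] [NormedSpace ℝ E]
    [NormedAddCommGroup F] [NormedSpace ℝ F] {φ : E → F} {c : ℝ} (hc : 0 ≤ c) {z : E}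
    (hφ : DifferentiableAt ℝ φ z) (hK : ‖fderiv ℝ φ z‖ ≤ K) :
    ‖fderiv ℝ (fun z => c • φ z) z‖ ≤ c * K := by
  rw [fderiv_fun_const_smul hφ, norm_smul, Real.norm_of_nonneg hc]
  exact mul_le_mul_of_nonneg_left hK hc

lemma BddC2.const_mul (hw : BddC2 Q K w) {c : ℝ} (hc : 0 ≤ c) :
    BddC2 (c * Q) (c * K) fun z => c * w z := by
  have hw' : Differentiable ℝ (fderiv ℝ w) := hw.contDiff_fderiv.differentiable one_ne_zero
  have e1 : fderiv ℝ (fun z => c * w z) = fun z => c • fderiv ℝ w z := funext fun z =>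
    fderiv_const_mul (hw.contDiff_one.differentiable one_ne_zero z) c
  refine ⟨contDiff_const.mul hw.contDiff, fun z => mul_nonneg hc (hw.nonneg z),
    fun z => mul_le_mul_of_nonneg_left (hw.le z) hc, fun z => ?_, fun z => ?_⟩
  · exact norm_fderiv_const_smul_le hc (hw.contDiff_one.differentiable one_ne_zero z)
      (hw.fderiv_le z)
  · rw [e1]
    exact norm_fderiv_const_smul_le hc (hw' z) (hw.fderiv2_le z)

lemma bddC2_iterate_smoothStep (hu : BddField U u) (hw : BddC2 Q K w) (hδ : 0 ≤ δ) (hδ1 : δ ≤ 1)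
    (n : ℕ) : BddC2 Q (K * (1 + δ * (3 * U + U ^ 2)) ^ n) ((smoothStep u δ)^[n] w) := by
  induction n with
  | zero => simpa using hw
  | succ n ih =>
    rw [Function.iterate_succ_apply', pow_succ, ← mul_assoc]
    exact ih.smoothStep hu hδ hδ1

lemma ofReal_iterate_smoothStep (hu : BddField U u) (hw : BddC2 Q K w) (hδ : 0 ≤ δ) (hδ1 : δ ≤ 1)
    (n : ℕ) : (fun z => ENNReal.ofReal ((smoothStep u δ)^[n] w z)) =
      (stepOp (√(2 * δ)) fun z => z - δ • u z)^[n] fun z => ENNReal.ofReal (w z) := by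
  induction n with
  | zero => rfl
  | succ n ih =>
    rw [Function.iterate_succ_apply', Function.iterate_succ_apply', ← ih]
    exact funext fun z => ofReal_smoothStep (bddC2_iterate_smoothStep hu hw hδ hδ1 n) z

end

lemma latPer_iterate_smoothStep {m : ℕ} {h : ℝ} {u : (Fin (m + 1) → ℝ) → Fin (m + 1) → ℝ}
    {w : (Fin (m + 1) → ℝ) → ℝ} (hu : LatPer m h u) (hw : LatPer m h w) (s : ℝ) (n : ℕ) :
    LatPer m h ((smoothStep u s)^[n] w) := by
  induction n with
  | zero => exact hw
  | succ n ih =>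
    rw [Function.iterate_succ_apply']
    exact hu.smoothStep ih s

/-- On-diagonal decay of the splitting scheme, uniform in the flow and in the step size. -/
lemma exists_iterate_smoothStep_le (m : ℕ) {h : ℝ} (hh : 0 < h) : ∃ C : ℝ, 0 < C ∧
    ∀ {U D Q K : ℝ} {u : (Fin (m + 1) → ℝ) → Fin (m + 1) → ℝ} {w : (Fin (m + 1) → ℝ) → ℝ},
      BddField U u → LatPer m h u → (∀ z, ∑ i, pd i (fun w => u w i) z = 0) →
      D = 4 ^ (m + 1) + (m + 1).factorial * 2 ^ (m + 1) →
      BddC2 Q K w → LatPer m h w → ∀ {A : ℝ}, 0 < A →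
      ∫⁻ z in cylCell m h, ENNReal.ofReal (w z) ≤ ENNReal.ofReal A →
      ∀ {δ : ℝ}, 0 < δ → δ ≤ 1 → δ * U ≤ 1 / 2 → D * (δ * U) ^ 2 ≤ 1 / 2 → ∀ n : ℕ, 4 ≤ n →
      1 / 2 ≤ n * δ → (1 + 2 * (D * (δ * U) ^ 2)) ^ n ≤ 2 → ∀ z,
      (smoothStep u δ)^[n] w z ≤ C * A * (√(n * δ))⁻¹ := by
  obtain ⟨C, hC, H⟩ := exists_step_le m hh
  refine ⟨2 * C, by positivity, ?_⟩
  intro U D Q K u w hu huper hdiv hD hw hwper A hA hint δ hδ hδ1 hδU hδD n hn hnδ hpow z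
  obtain ⟨e, J, hJ⟩ := transport_shift hh (hu.contDiff.of_le (by norm_num)) huper hdiv
    hu.fderiv_le hD hδ.le hδU hδD
  have hD0 : 0 ≤ D := by rw [hD]; positivity
  have h1 : 1 ≤ 1 + 2 * (D * (δ * U) ^ 2) := by nlinarith [mul_nonneg hD0 (sq_nonneg (δ * U))]
  have key := H hJ (by rwa [ENNReal.one_le_ofReal]) ENNReal.ofReal_ne_top
    (φ := fun z => ENNReal.ofReal (w z)) (fun a ha z => by simp only [hwper a ha z])
    (by have := hw.contDiff.continuous.measurable; fun_prop) (A := ENNReal.ofReal A)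
    (by simpa using hA) ENNReal.ofReal_ne_top hint hδ n hn hnδ z
  rw [← congrFun (ofReal_iterate_smoothStep hu hw hδ.le hδ1 n) z,
    ← ENNReal.ofReal_pow (by linarith), ← ENNReal.ofReal_mul (by positivity),
    ← ENNReal.ofReal_mul (by positivity), ENNReal.ofReal_le_ofReal_iff (by positivity)] at key
  refine key.trans ?_
  have : 0 ≤ C * (√(n * δ))⁻¹ * A := by positivity
  nlinarith

lemma reaction_le {f : ℝ → ℝ} {M L a B Cf p y : ℝ} (hM : 0 < M) (hp : 1 < p) (hCf : 0 ≤ Cf)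
    (hfL : ∀ s ∈ Set.Icc (0 : ℝ) 1, f s ≤ L * s)
    (hfp : ∀ s ∈ Set.Icc (0 : ℝ) 1, f s ≤ Cf * s ^ p) (hy0 : 0 ≤ y) (hy1 : y ≤ 1)
    (h : M * L ≤ a ∨ (y ≤ B ∧ M * Cf * B ^ (p - 1) ≤ a)) : M * f y ≤ a * y := by
  rcases h with h | ⟨hyB, h⟩
  · calc M * f y ≤ M * (L * y) := mul_le_mul_of_nonneg_left (hfL y ⟨hy0, hy1⟩) hM.le
      _ = M * L * y := by ring
      _ ≤ a * y := mul_le_mul_of_nonneg_right h hy0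
  · rcases hy0.eq_or_lt with rfl | hy
    · have := mul_le_mul_of_nonneg_left (hfL 0 ⟨hy0, hy1⟩) hM.le
      simpa using this
    · calc M * f y ≤ M * (Cf * y ^ p) := mul_le_mul_of_nonneg_left (hfp y ⟨hy0, hy1⟩) hM.le
        _ = M * Cf * y ^ (p - 1) * y := by rw [Real.rpow_sub_one hy.ne']; field_simp
        _ ≤ M * Cf * B ^ (p - 1) * y := by gcongr
        _ ≤ a * y := mul_le_mul_of_nonneg_right h hy0

lemma hasDerivAt_exp_neg_rpow (b r : ℝ) {t : ℝ} (ht : 0 ≤ t) :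
    HasDerivAt (fun t => Real.exp (-b * (1 + t) ^ (-r)))
      (Real.exp (-b * (1 + t) ^ (-r)) * (b * r * (1 + t) ^ (-(r + 1)))) t := by
  have h1 : HasDerivAt (fun t : ℝ => (1 + t) ^ (-r)) (1 * -r * (1 + t) ^ (-r - 1)) t :=
    ((hasDerivAt_id t).const_add 1).rpow_const (Or.inl (by dsimp only [id]; positivity))
  refine ((h1.const_mul (-b)).exp).congr_deriv ?_
  rw [neg_add']
  ring

lemma IsCylSol.le_iterate {m : ℕ} {h M U Q K L k β ρ δ : ℝ}
    {u : (Fin (m + 1) → ℝ) → Fin (m + 1) → ℝ} {f : ℝ → ℝ}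
    {T0 : (Fin (m + 1) → ℝ) → ℝ} {T : ℝ → (Fin (m + 1) → ℝ) → ℝ} {g g' : ℝ → ℝ}
    {w : (Fin (m + 1) → ℝ) → ℝ} (hT : IsCylSol m h M u f T0 T) (hh : 0 < h) (hM : 0 < M)
    (hu : BddField U u) (huper : LatPer m h u)
    (hL0 : 0 ≤ L) (hL : ∀ x ∈ Set.Icc (0 : ℝ) 1, ∀ y ∈ Set.Icc x 1, f y ≤ f x + L * (y - x))
    (hg : ∀ t, 0 ≤ t → HasDerivAt g (g' t) t) (hg0 : ∀ t, 0 ≤ g t) (hg1 : ∀ t, 0 ≤ t → g t ≤ 1)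
    (hw : BddC2 Q K w) (hwper : LatPer m h w) (hδ0 : 0 ≤ δ) (hδ1 : δ ≤ 1)
    (hk : k = U + 2 + M * L) (hβ : 0 < β) (hρ : 0 < ρ) {N : ℕ}
    (hres : (m + 2) * (3 * U + U ^ 2) * (K * (1 + δ * (3 * U + U ^ 2)) ^ N) * δ < ρ)
    (hreact : ∀ n < N, ∀ s ∈ Set.Ioc 0 δ, ∀ z,
      g (n * δ + s) * smoothStep u s ((smoothStep u δ)^[n] w) z ≤ 1 →
      M * f (g (n * δ + s) * smoothStep u s ((smoothStep u δ)^[n] w) z) ≤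
        g' (n * δ + s) * smoothStep u s ((smoothStep u δ)^[n] w) z)
    (hinit : ∀ z, T 0 z ≤ g 0 * w z + barrier 1 β ρ z) :
    ∀ n ≤ N, ∀ z, T (n * δ) z ≤
      g (n * δ) * (smoothStep u δ)^[n] w z + barrier (Real.exp (k * (n * δ))) β ρ z := by
  have hU := hu.nonneg
  have hK := hw.nonneg_bound
  intro n
  induction n with
  | zero => intro _ z; simpa using hinit z
  | succ n ih =>
    intro hn z
    have hpow : (1 + δ * (3 * U + U ^ 2)) ^ n ≤ (1 + δ * (3 * U + U ^ 2)) ^ N :=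
      pow_le_pow_right₀ (by nlinarith [mul_nonneg hδ0 (by positivity : 0 ≤ 3 * U + U ^ 2)])
        (by omega)
    have := hT.le_step hh hM hu huper hL0 hL hg hg0 hg1 (bddC2_iterate_smoothStep hu hw hδ0 hδ1 n)
      (latPer_iterate_smoothStep huper hwper δ n) (t₀ := n * δ) (by positivity) hδ1 hk hβ hρ
      (lt_of_le_of_lt (by gcongr) hres) (hreact n (by omega)) (ih (by omega)) δ ⟨hδ0, le_rfl⟩ z
    rw [Function.iterate_succ_apply']
    simpa [add_mul] using this

lemma exists_step_count {t U D c K V ρ : ℝ} (ht : 0 < t) (hV : 0 ≤ V) (hD : 0 ≤ D)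
    (hc : 0 ≤ c) (hK : 0 ≤ K) (hρ : 0 < ρ) :
    ∃ (N : ℕ) (δ : ℝ), N * δ = t ∧ 0 < δ ∧ δ ≤ 1 / 8 ∧ δ * U ≤ 1 / 2 ∧ D * (δ * U) ^ 2 ≤ 1 / 2 ∧
      (1 + 2 * (D * (δ * U) ^ 2)) ^ N ≤ 2 ∧ c * (K * (1 + δ * V) ^ N) * δ < ρ := by
  have hlim : Filter.Tendsto (fun N : ℕ => t / N) Filter.atTop (nhds 0) :=
    tendsto_const_div_atTop_nhds_zero_nat t
  have ev : ∀ (F : ℝ → ℝ) (B : ℝ), Continuous F → F 0 < B →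
      ∀ᶠ N : ℕ in Filter.atTop, F (t / N) < B := fun F B hF hB =>
    ((hF.tendsto 0).comp hlim).eventually_lt_const hB
  obtain ⟨N, h1, h2, h3, h4, h5, hN⟩ :=
    ((ev (fun δ => δ) (1 / 8) (by fun_prop) (by norm_num)).and
    ((ev (fun δ => δ * U) (1 / 2) (by fun_prop) (by norm_num)).and
    ((ev (fun δ => D * (δ * U) ^ 2) (1 / 2) (by fun_prop) (by norm_num)).and
    ((ev (fun δ => Real.exp (2 * D * U ^ 2 * t * δ)) 2 (by fun_prop) (by norm_num)).and
    ((ev (fun δ => c * (K * Real.exp (V * t)) * δ) ρ (by fun_prop) (by simpa using hρ)).and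
    (Filter.eventually_gt_atTop 0)))))).exists
  have hN' : (0 : ℝ) < N := Nat.cast_pos.2 hN
  have hNδ : N * (t / N) = t := by field_simp
  have hpow : ∀ x : ℝ, 0 ≤ x → (1 + x) ^ N ≤ Real.exp (N * x) := fun x hx => by
    rw [Real.exp_nat_mul]
    exact pow_le_pow_left₀ (by positivity) (by linarith [Real.add_one_le_exp x]) N
  refine ⟨N, t / N, hNδ, by positivity, h1.le, h2.le, h3.le, ?_, ?_⟩
  · refine (hpow _ (by positivity)).trans (le_of_eq_of_le (congrArg Real.exp ?_) h4.le)
    calc _ = 2 * D * U ^ 2 * (N * (t / N)) * (t / N) := by ring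
      _ = _ := by rw [hNδ]
  · refine lt_of_le_of_lt ?_ h5
    have := hpow (t / N * V) (by positivity)
    rw [← mul_assoc (N : ℝ), hNδ, mul_comm t V] at this
    gcongr

/-- A quantitative form of quenching: `L¹`-small data decay at the rate of the heat equation. -/
lemma exists_forall_le_inv_sqrt {m : ℕ} {h M L Cf p : ℝ} (hh : 0 < h) (hM : 0 < M)
    {u : (Fin (m + 1) → ℝ) → Fin (m + 1) → ℝ} (hu : ContDiff ℝ 2 u)
    (hu_div : ∀ z, ∑ i, pd i (fun w => u w i) z = 0)
    (hu_per : ∀ z (i : Fin (m + 1)), u (z + Pi.single i h) = u z) {f : ℝ → ℝ}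
    (hL0 : 0 < L) (hL : ∀ x ∈ Set.Icc (0 : ℝ) 1, ∀ y ∈ Set.Icc x 1, f y ≤ f x + L * (y - x))
    (hfL : ∀ s ∈ Set.Icc (0 : ℝ) 1, f s ≤ L * s) (hCf : 0 < Cf) (hp : 3 < p)
    (hfp : ∀ s ∈ Set.Icc (0 : ℝ) 1, f s ≤ Cf * s ^ p) :
    ∃ ε D : ℝ, 0 < ε ∧ 0 < D ∧
      ∀ (T0 : (Fin (m + 1) → ℝ) → ℝ) (T : ℝ → (Fin (m + 1) → ℝ) → ℝ),
        IsCylSol m h M u f T0 T →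
        (∫⁻ z in cylCell m h, ENNReal.ofReal (T0 z)) ≤ ENNReal.ofReal ε →
        ∀ t ≥ 1, ∀ z, T t z ≤ D * (√t)⁻¹ := by
  obtain ⟨U, hU⟩ := exists_bddField hh hu hu_per
  have hU0 := hU.nonneg
  have huper : LatPer m h u := latPer_of_single fun z j => hu_per z j.succ
  obtain ⟨C, hC, hdecay⟩ := exists_iterate_smoothStep_le m hh
  set r := (p - 1) / 2 - 1 with hr
  have hr0 : 0 < r := by rw [hr]; linarith
  set b := M * L * 2 ^ (r + 1) / r with hb
  have hb0 : 0 < b := by positivity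
  set D := (b * r * 5 ^ (-(r + 1)) / (M * Cf)) ^ (p - 1)⁻¹ with hD
  have hD0 : 0 < D := by positivity
  have hDp : M * Cf * D ^ (p - 1) = b * r * 5 ^ (-(r + 1)) := by
    rw [hD, Real.rpow_inv_rpow (by positivity) (by linarith)]
    field_simp
  set E := Real.exp b with hE
  have hE0 : 0 < E := Real.exp_pos b
  set g : ℝ → ℝ := fun t => Real.exp (-b * (1 + t) ^ (-r)) with hg
  have hg0 : ∀ t, 0 ≤ g t := fun t => (Real.exp_pos _).le
  have hg1 : ∀ t, 0 ≤ t → g t ≤ 1 := fun t ht => by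
    rw [hg, Real.exp_le_one_iff, neg_mul, neg_nonpos]
    positivity
  refine ⟨D / (C * E), D, by positivity, hD0, fun T0 T hT hint t ht z => ?_⟩
  have hT0 : T 0 = T0 := funext hT.init
  have hcont : Continuous T0 := by
    rw [← hT0, ← continuousOn_univ]
    exact hT.cont.comp (f := fun z => ((0 : ℝ), z)) (by fun_prop)
      fun z _ => Set.mem_ofPred_eq ▸ le_refl (0 : ℝ)
  have h01 : ∀ z, T0 z ∈ Set.Icc (0 : ℝ) 1 := fun z => hT0 ▸ hT.mem_Icc 0 z le_rfl
  have hper0 : LatPer m h T0 := hT0 ▸ hT.latPer le_rfl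
  set k := U + 2 + M * L with hk
  have key : ∀ β > 0, ∀ ρ > 0, T t z ≤ D * (√t)⁻¹ + barrier (Real.exp (k * t)) β ρ z := by
    intro β hβ ρ hρ
    obtain ⟨K, φ, hφ, hφper, hφint, hφle⟩ := exists_mollify hh hcont hper0 h01 hβ hρ
    have hK := hφ.nonneg_bound
    have hw := hφ.const_mul hE0.le
    have hwper : LatPer m h fun z => E * φ z := fun a ha z => by simp only [hφper a ha z]
    have hwint : ∫⁻ z in cylCell m h, ENNReal.ofReal (E * φ z) ≤ ENNReal.ofReal (D / C) := by
      simp_rw [ENNReal.ofReal_mul hE0.le]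
      rw [lintegral_const_mul _ (by have := hφ.contDiff.continuous.measurable; fun_prop),
        show D / C = E * (D / (C * E)) by field_simp, ENNReal.ofReal_mul hE0.le]
      gcongr
      exact hφint.trans hint
    obtain ⟨N, δ, hNδ, hδ0, hδ8, hδU, hδD, hpow, hres⟩ :=
      exists_step_count (t := t) (U := U) (D := 4 ^ (m + 1) + (m + 1).factorial * 2 ^ (m + 1))
        (c := (m + 2) * (3 * U + U ^ 2)) (K := E * K) (V := 3 * U + U ^ 2) (by linarith)
        (by positivity) (by positivity) (by positivity) (by positivity) hρ
    have hdec : ∀ n ≤ N, 1 / 2 ≤ n * δ → ∀ z,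
        (smoothStep u δ)^[n] (fun z => E * φ z) z ≤ D * (√(n * δ))⁻¹ := by
      intro n hn hnδ z
      have h4 : 4 ≤ n := by
        have : (4 : ℝ) ≤ n := by nlinarith [(Nat.cast_nonneg n : (0 : ℝ) ≤ n)]
        exact_mod_cast this
      have := hdecay hU huper hu_div rfl hw hwper (by positivity) hwint hδ0 (by linarith) hδU hδD
        n h4 hnδ ((pow_le_pow_right₀ (le_add_of_nonneg_right (by positivity)) hn).trans hpow) z
      rwa [mul_div_cancel₀ _ hC.ne'] at this
    have hreact : ∀ n < N, ∀ s ∈ Set.Ioc 0 δ, ∀ z,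
        g (n * δ + s) * smoothStep u s ((smoothStep u δ)^[n] fun z => E * φ z) z ≤ 1 →
        M * f (g (n * δ + s) * smoothStep u s ((smoothStep u δ)^[n] fun z => E * φ z) z) ≤
          g (n * δ + s) * (b * r * (1 + (n * δ + s)) ^ (-(r + 1))) *
            smoothStep u s ((smoothStep u δ)^[n] fun z => E * φ z) z := by
      intro n hn s hs z hle
      have hnδ0 : 0 ≤ n * δ := by positivity
      have hw' := bddC2_iterate_smoothStep hU hw hδ0.le (by linarith) n
      have hv0 := (hw'.smoothStep hU hs.1.le (by linarith [hs.2])).nonneg z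
      have hs0 := hs.1
      refine (reaction_le (B := D * (√(n * δ))⁻¹)
        (a := b * r * (1 + (n * δ + s)) ^ (-(r + 1))) hM (by linarith) hCf.le hfL hfp
        (mul_nonneg (hg0 _) hv0) hle ?_).trans_eq (by ring)
      rcases lt_or_ge (n * δ) (1 / 2) with hlt | hge
      · left
        have : (2 : ℝ) ^ (-(r + 1)) ≤ (1 + (n * δ + s)) ^ (-(r + 1)) :=
          Real.rpow_le_rpow_of_nonpos (by positivity) (by linarith [hs.2]) (by linarith)
        refine le_of_eq_of_le ?_ (mul_le_mul_of_nonneg_left this (by positivity))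
        rw [hb, Real.rpow_neg (by norm_num)]
        field_simp
      · right
        have hB := hdec n hn.le hge
        constructor
        · have hQ : BddC2 (D * (√(n * δ))⁻¹) _ _ :=
            ⟨hw'.contDiff, hw'.nonneg, hB, hw'.fderiv_le, hw'.fderiv2_le⟩
          exact (mul_le_of_le_one_left hv0 (hg1 _ (by positivity))).trans
            ((hQ.smoothStep hU hs.1.le (by linarith [hs.2])).le z)
        · have hx : (0 : ℝ) < n * δ := by linarith
          have e : ((√(n * δ))⁻¹) ^ (p - 1) = (n * δ) ^ (-(r + 1)) := by
            rw [Real.sqrt_eq_rpow, ← Real.rpow_neg hx.le, ← Real.rpow_mul hx.le, hr]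
            congr 1
            ring
          rw [Real.mul_rpow hD0.le (by positivity), ← mul_assoc, hDp, e, mul_assoc,
            ← Real.mul_rpow (by norm_num) hx.le]
          gcongr b * r * ?_
          exact Real.rpow_le_rpow_of_nonpos (by positivity) (by linarith [hs.2]) (by linarith)
    have hinit : ∀ z, T 0 z ≤ g 0 * (E * φ z) + barrier 1 β ρ z := fun z => by
      have : g 0 * E = 1 := by simp [hg, hE, ← Real.exp_add]
      rw [hT0, ← mul_assoc, this, one_mul, barrier, one_mul]
      exact hφle z
    have := hT.le_iterate hh hM hU huper hL0.le hL (fun t ht => hasDerivAt_exp_neg_rpow b r ht)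
      hg0 hg1 hw hwper hδ0.le (by linarith) hk hβ hρ hres hreact hinit N le_rfl z
    rw [hNδ] at this
    have hN := hdec N le_rfl (by rw [hNδ]; linarith) z
    rw [hNδ] at hN
    refine this.trans (add_le_add_left ((mul_le_of_le_one_left ?_ (hg1 t (by linarith))).trans hN) _)
    exact (bddC2_iterate_smoothStep hU hw hδ0.le (by linarith) N).nonneg z
  refine le_of_forall_pos_le_add fun η hη => ?_
  refine (key (η / (2 * Real.exp (k * t) * Real.cosh (z 0))) (by positivity)
    (η / (2 * Real.exp (k * t))) (by positivity)).trans_eq ?_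
  rw [barrier]
  have := (Real.cosh_pos (z 0)).ne'
  field_simp
  ring

/-- If moreover `f(T) ≤ c T^p` on `[0,θ]` for some `p > 3`, then there is
`ε > 0` such that every classical solution with `0 ≤ T₀ ≤ 1` and `‖T₀‖₁ ≤ ε` quenches. -/
theorem quenching_paper_stmt1
    (m : ℕ) (hm : 1 ≤ m) (h M : ℝ) (hh : 0 < h) (hM : 0 < M)
    (u : (Fin (m+1) → ℝ) → Fin (m+1) → ℝ)
    (hu_smooth : ContDiff ℝ (⊤ : ℕ∞) u)
    (hu_div : ∀ z, ∑ i, pd i (fun w => u w i) z = 0)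
    (hu_per : ∀ z (i : Fin (m+1)), u (z + Pi.single i h) = u z)
    (hu_mean : ∀ i, ∫ z in Set.univ.pi fun _ : Fin (m+1) => Set.Ico (0:ℝ) h, u z i = 0)
    (f : ℝ → ℝ) (hf_lip : ∃ K, LipschitzOnWith K f (Set.Icc 0 1))
    (hf0 : f 0 = 0) (hf1 : f 1 = 0) (hf_pos : ∀ s ∈ Set.Ioo (0:ℝ) 1, 0 < f s)
    (c θ p : ℝ) (hc : 0 < c) (hθ : 0 < θ) (hp : 3 < p)
    (hfp : ∀ s ∈ Set.Icc (0:ℝ) θ, f s ≤ c * s ^ p) :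
    ∃ ε : ℝ, 0 < ε ∧
      ∀ (T0 : (Fin (m+1) → ℝ) → ℝ) (T : ℝ → (Fin (m+1) → ℝ) → ℝ),
        IsCylSol m h M u f T0 T →
        (∀ z, T0 z ∈ Set.Icc (0:ℝ) 1) →
        (∫⁻ z in cylCell m h, ENNReal.ofReal (T0 z)) ≤ ENNReal.ofReal ε →
        CylQuenches m T := by
  obtain ⟨K, hK⟩ := hf_lip
  set L : ℝ := K + 1 with hLdef
  have hL0 : 0 < L := by positivity
  have hL : ∀ x ∈ Set.Icc (0 : ℝ) 1, ∀ y ∈ Set.Icc x 1, f y ≤ f x + L * (y - x) := by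
    intro x hx y hy
    have h1 := hK.dist_le_mul y ⟨hx.1.trans hy.1, hy.2⟩ x hx
    rw [Real.dist_eq, Real.dist_eq, abs_of_nonneg (sub_nonneg.2 hy.1)] at h1
    linarith [le_abs_self (f y - f x), hy.1]
  have hfL : ∀ s ∈ Set.Icc (0 : ℝ) 1, f s ≤ L * s := fun s hs => by
    simpa [hf0] using hL 0 (by simp) s hs
  have hCf : ∀ s ∈ Set.Icc (0 : ℝ) 1, f s ≤ (c + L / θ ^ p) * s ^ p := by
    intro s hs
    have hsp : 0 ≤ s ^ p := Real.rpow_nonneg hs.1 p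
    have hpos : 0 ≤ L / θ ^ p * s ^ p := by positivity
    rcases le_or_gt s θ with hle | hgt
    · linarith [hfp s ⟨hs.1, hle⟩]
    · have h1 : L ≤ L / θ ^ p * s ^ p := by
        rw [div_mul_eq_mul_div, le_div_iff₀ (by positivity)]
        exact mul_le_mul_of_nonneg_left (Real.rpow_le_rpow hθ.le hgt.le (by linarith)) hL0.le
      have h2 : L * s ≤ L := mul_le_of_le_one_right hL0.le hs.2
      have h3 : 0 ≤ c * s ^ p := by positivity
      linarith [hfL s hs]
  obtain ⟨ε, D, hε, hD, H⟩ := exists_forall_le_inv_sqrt hh hM (hu_smooth.of_le (by norm_cast)) hu_div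
    hu_per hL0 hL hfL (Cf := c + L / θ ^ p) (by positivity) hp hCf
  refine ⟨ε, hε, fun T0 T hT _ hint η hη => ?_⟩
  have hlim : Filter.Tendsto (fun t => D * (√t)⁻¹) Filter.atTop (nhds 0) := by
    simpa using (Real.tendsto_sqrt_atTop.inv_tendsto_atTop).const_mul D
  obtain ⟨t₀, ht₀⟩ := Filter.eventually_atTop.1
    ((hlim.eventually_lt_const hη).and (Filter.eventually_ge_atTop 1))
  exact ⟨t₀, fun t ht z => (H T0 T hT hint t (ht₀ t ht).2 z).trans (ht₀ t ht).1.le⟩
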